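/- arXiv:2408.11643 — 5 statements merged into one kernel-verified Lean document; each statement's English description precedes it below -/
import Mathlib

section
/- Let E be a number field with a nontrivial field automorphism σ of order 2 with fixed field F, I a nonzero fractional O_E-ideal and α ∈ F^× such that Tr_{E/ℚ}(α x σ(y)) ∈ ℤ for all x,y ∈ I. Set L = I and L^♯ = {x ∈ E : Tr_{E/ℚ}(α x σ(y)) ∈ ℤ for all y ∈ I}. Then α·I·σ(I)·D_E is an integral ideal of O_E and the quotient L^♯/L is isomorphic, as an O_E-module, to O_E/(α·I·σ(I)·D_E). -/
set_option synthInstance.maxHeartbeats 1000000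
set_option maxHeartbeats 1000000

open NumberField FractionalIdeal
open scoped nonZeroDivisors

namespace FractionalIdeal

variable {R K : Type*} [CommRing R] [Field K] [Algebra R K] [IsFractionRing R K]

/-- The quotient of the unit fractional ideal by an integral ideal `D` is `R ⧸ D`. -/
noncomputable def oneQuotientEquiv (D : Ideal R) :
    (↥((1 : FractionalIdeal R⁰ K) : Submodule R K) ⧸
      Submodule.comap ((1 : FractionalIdeal R⁰ K) : Submodule R K).subtype
        ((D : FractionalIdeal R⁰ K) : Submodule R K)) ≃ₗ[R] R ⧸ D :=
  (Submodule.Quotient.equiv D _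
    ((LinearEquiv.ofInjective (Algebra.linearMap R K) (IsFractionRing.injective R K)).trans
      (LinearEquiv.ofEq _ _ (by rw [coe_one, Submodule.one_eq_range]))) (by
    ext ⟨x, hx⟩
    simp only [Submodule.mem_map, Submodule.mem_comap, Submodule.subtype_apply,
      coe_coeIdeal, IsLocalization.mem_coeSubmodule]
    refine exists_congr fun y => and_congr_right fun _ => ?_
    rw [Subtype.ext_iff]
    rfl)).symm

/-- If `J ≤ I` and `D = J / I` then `I ⧸ J ≃ R ⧸ D`. -/
theorem nonempty_quotientEquiv_of_mul_coeIdeal_eq [IsDedekindDomain R]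
    {I J : FractionalIdeal R⁰ K} {D : Ideal R} (hJ : J ≠ 0) (hJI : J ≤ I)
    (h : I * (D : FractionalIdeal R⁰ K) = J) :
    Nonempty ((↥(I : Submodule R K) ⧸
      Submodule.comap (I : Submodule R K).subtype (J : Submodule R K)) ≃ₗ[R] R ⧸ D) := by
  have hD : (D : FractionalIdeal R⁰ K) ≠ 0 := by
    rintro h0
    exact hJ (by rw [← h, h0, mul_zero])
  have hI : I ≠ 0 := by
    rintro rfl
    exact hJ (by rw [← h, zero_mul])
  exact ⟨(quotientEquiv I J 1 D (by rw [h, one_mul]) hJI coeIdeal_le_one hD hI).trans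
    (oneQuotientEquiv D)⟩

end FractionalIdeal

/-- For an `O_E`-lattice `(I, α)` (so `Tr_{E/ℚ}(α x σ(y)) ∈ ℤ` for all
`x, y ∈ I`), the ideal `α·I·σ(I)·D_E` is an integral ideal of `O_E`, and the quotient
`L♯/L` of the dual lattice by the lattice is isomorphic, as an `O_E`-module, to
`O_E/(α·I·σ(I)·D_E)`. -/
theorem dual_quotient_isom_quotient_by_discriminantIdeal
    (E F : Type*) [Field E] [NumberField E] [Field F] [NumberField F] [Algebra F E]
    (σ : E ≃+* E)
    (hσ2 : ∀ x, σ (σ x) = x)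
    (hσne : σ ≠ RingEquiv.refl E)
    (hfix : ∀ x : E, σ x = x ↔ x ∈ (algebraMap F E).range)
    (I : FractionalIdeal (𝓞 E)⁰ E) (hI : I ≠ 0)
    (Iσ : FractionalIdeal (𝓞 E)⁰ E)
    (hIσ : ∀ x : E, x ∈ Iσ ↔ ∃ y ∈ I, σ y = x)
    (α : F) (hα : α ≠ 0)
    (hlat : ∀ x ∈ I, ∀ y ∈ I,
      ∃ n : ℤ, Algebra.trace ℚ E (algebraMap F E α * x * σ y) = (n : ℚ))
    (Lsharp : FractionalIdeal (𝓞 E)⁰ E)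
    (hLsharp : ((Lsharp : Submodule (𝓞 E) E) : Set E)
      = {x : E | ∀ y ∈ I, ∃ n : ℤ, Algebra.trace ℚ E (algebraMap F E α * x * σ y) = (n : ℚ)}) :
    (∃ D : Ideal (𝓞 E),
        (D : FractionalIdeal (𝓞 E)⁰ E)
          = spanSingleton (𝓞 E)⁰ (algebraMap F E α) * I * Iσ
              * (differentIdeal ℤ (𝓞 E) : FractionalIdeal (𝓞 E)⁰ E))
      ∧ ∀ D : Ideal (𝓞 E),
          (D : FractionalIdeal (𝓞 E)⁰ E)
            = spanSingleton (𝓞 E)⁰ (algebraMap F E α) * I * Iσ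
                * (differentIdeal ℤ (𝓞 E) : FractionalIdeal (𝓞 E)⁰ E) →
          Nonempty
            ((↥(Lsharp : Submodule (𝓞 E) E) ⧸
                Submodule.comap (Lsharp : Submodule (𝓞 E) E).subtype (I : Submodule (𝓞 E) E))
              ≃ₗ[𝓞 E] ((𝓞 E) ⧸ D)) := by
  set J : FractionalIdeal (𝓞 E)⁰ E := spanSingleton (𝓞 E)⁰ (algebraMap F E α) * Iσ with hJdef
  have hα' : algebraMap F E α ≠ 0 := by simpa using hα
  have hIσ0 : Iσ ≠ 0 := by
    obtain ⟨y, hy, hy0⟩ := exists_ne_zero_mem_isInteger hI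
    rintro rfl
    have hmem := (hIσ (σ (algebraMap (𝓞 E) E y))).mpr ⟨_, hy0, rfl⟩
    exact hy (by simpa [mem_zero_iff] using hmem)
  have hJ : J ≠ 0 := mul_ne_zero (by simpa [spanSingleton_eq_zero_iff] using hα') hIσ0
  have hdual : Lsharp = dual ℤ ℚ J := by
    ext x
    have hx : x ∈ Lsharp ↔ ∀ y ∈ I,
        ∃ n : ℤ, Algebra.trace ℚ E (algebraMap F E α * x * σ y) = (n : ℚ) :=
      Set.ext_iff.mp hLsharp x
    rw [hx, mem_dual hJ]
    constructor
    · intro h a ha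
      obtain ⟨z, hz, rfl⟩ := mem_singleton_mul.mp ha
      obtain ⟨y, hy, rfl⟩ := (hIσ z).mp hz
      obtain ⟨n, hn⟩ := h y hy
      refine ⟨n, ?_⟩
      rw [Algebra.traceForm_apply, mul_left_comm, ← mul_assoc, hn]
      rfl
    · intro h y hy
      obtain ⟨n, hn⟩ := h (algebraMap F E α * σ y)
        (mem_singleton_mul.mpr ⟨_, (hIσ _).mpr ⟨y, hy, rfl⟩, rfl⟩)
      refine ⟨n, ?_⟩
      rw [Algebra.traceForm_apply, mul_left_comm, ← mul_assoc] at hn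
      rw [← hn]
      rfl
  have hLne : Lsharp ≠ 0 := hdual ▸ dual_ne_zero ℤ ℚ hJ
  have hle : I ≤ Lsharp := fun x hx => hLsharp.ge (hlat x hx)
  have hdisc : spanSingleton (𝓞 E)⁰ (algebraMap F E α) * I * Iσ
      * (differentIdeal ℤ (𝓞 E) : FractionalIdeal (𝓞 E)⁰ E) = Lsharp⁻¹ * I := by
    rw [coeIdeal_differentIdeal ℤ ℚ E (𝓞 E), hdual, dual_eq_mul_inv ℤ ℚ J, mul_inv, inv_inv,
      hJdef]
    ring
  rw [hdisc]
  refine ⟨?_, fun D hD => nonempty_quotientEquiv_of_mul_coeIdeal_eq hI hle ?_⟩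
  · obtain ⟨D, hD⟩ := le_one_iff_exists_coeIdeal.mp
      (show Lsharp⁻¹ * I ≤ 1 from (mul_le_mul_right hle _).trans_eq (inv_mul_cancel₀ hLne))
    exact ⟨D, hD⟩
  · rw [hD, mul_inv_cancel_left₀ hLne]
end

section
/- Let E be a number field with a nontrivial field automorphism σ of order 2 with fixed field F. Let v be a nonzero prime ideal of O_F that ramifies in E, let P_v be the unique prime of O_E above v, and suppose that the P_v-adic valuation of the different D_E of E/ℚ is odd. Then for every O_E-lattice (I,α), the P_v-adic valuation of the discriminant ideal α·I·σ(I)·D_E is odd. -/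
set_option synthInstance.maxHeartbeats 1000000
set_option maxHeartbeats 1000000

open NumberField FractionalIdeal IsDedekindDomain
open scoped nonZeroDivisors

/-- A nonzero ideal not contained in `P` has `P`-adic valuation zero. -/
theorem count_coeIdeal_eq_zero_of_not_le {B : Type*} [CommRing B] [IsDedekindDomain B]
    (K : Type*) [Field K] [Algebra B K] [IsFractionRing B K] (P : HeightOneSpectrum B)
    {J : Ideal B} (hJ : ¬ J ≤ P.asIdeal) :
    FractionalIdeal.count K P (J : FractionalIdeal B⁰ K) = 0 := by
  classical
  have hJ0 : J ≠ 0 := by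
    rintro rfl
    exact hJ bot_le
  rw [FractionalIdeal.count_coe K P hJ0, Nat.cast_eq_zero]
  by_contra h
  have hle := (Associates.count_ne_zero_iff_dvd hJ0 P.irreducible).mp h
  exact hJ (Ideal.le_of_dvd hle)

/-- If `v` extends to `P ^ e` along `f`, with `e ≠ 0`, then the `P`-adic valuation of the
extension of an ideal is `e` times its `v`-adic valuation. -/
theorem count_map_of_map_eq_pow {A B : Type*} [CommRing A] [IsDedekindDomain A]
    [CommRing B] [IsDedekindDomain B]
    (L K : Type*) [Field L] [Algebra A L] [IsFractionRing A L]
    [Field K] [Algebra B K] [IsFractionRing B K]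
    (f : A →+* B) (v : HeightOneSpectrum A) (P : HeightOneSpectrum B) {e : ℕ} (he : e ≠ 0)
    (hf : v.asIdeal.map f = P.asIdeal ^ e) {J : Ideal A} (hJ : J ≠ 0) :
    FractionalIdeal.count K P (J.map f : FractionalIdeal B⁰ K) =
      e * FractionalIdeal.count L v (J : FractionalIdeal A⁰ L) := by
  have hcomap : v.asIdeal = P.asIdeal.comap f :=
    v.isMaximal.eq_of_le (Ideal.IsPrime.ne_top inferInstance)
      (Ideal.map_le_iff_le_comap.mp (hf.le.trans (Ideal.pow_le_self he)))
  obtain ⟨J', hJ', hndvd⟩ :=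
    (FiniteMultiplicity.of_not_isUnit v.irreducible.not_isUnit hJ).exists_eq_pow_mul_and_not_dvd
  generalize multiplicity v.asIdeal J = n at hJ'
  subst hJ'
  have hle : ¬ J' ≤ v.asIdeal := fun h => hndvd (Ideal.dvd_iff_le.mpr h)
  have hmap : ¬ J'.map f ≤ P.asIdeal := by
    rwa [Ideal.map_le_iff_le_comap, ← hcomap]
  have hJ'0 : J' ≠ 0 := right_ne_zero_of_mul hJ
  have hmap0 : J'.map f ≠ 0 := fun h => hmap (h.le.trans bot_le)
  rw [Ideal.map_mul, Ideal.map_pow, hf, coeIdeal_mul, coeIdeal_mul, ← pow_mul, coeIdeal_pow,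
    coeIdeal_pow, FractionalIdeal.count_mul, FractionalIdeal.count_mul,
    count_coeIdeal_eq_zero_of_not_le K P hmap, count_coeIdeal_eq_zero_of_not_le L v hle,
    FractionalIdeal.count_pow_self, FractionalIdeal.count_pow_self]
  · push_cast
    ring
  · exact pow_ne_zero _ (coeIdeal_ne_zero.mpr v.ne_bot)
  · exact coeIdeal_ne_zero.mpr hJ'0
  · exact pow_ne_zero _ (coeIdeal_ne_zero.mpr P.ne_bot)
  · exact coeIdeal_ne_zero.mpr hmap0

/-- If `v` extends to `P ^ 2`, then elements of the smaller field have even `P`-adic valuation. -/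
theorem even_count_spanSingleton_algebraMap
    {E F : Type*} [Field E] [NumberField E] [Field F] [NumberField F] [Algebra F E]
    (v : HeightOneSpectrum (𝓞 F)) (P : HeightOneSpectrum (𝓞 E))
    (hram : v.asIdeal.map (algebraMap (𝓞 F) (𝓞 E)) = P.asIdeal ^ 2) {α : F} (hα : α ≠ 0) :
    Even (FractionalIdeal.count E P (spanSingleton (𝓞 E)⁰ (algebraMap F E α))) := by
  have key : ∀ a : 𝓞 F, a ≠ 0 → Even (FractionalIdeal.count E P
      (spanSingleton (𝓞 E)⁰ (algebraMap F E (algebraMap (𝓞 F) F a)))) := by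
    intro a ha
    have h := count_map_of_map_eq_pow F E (algebraMap (𝓞 F) (𝓞 E)) v P two_ne_zero hram
      (J := Ideal.span {a}) (by simpa using ha)
    rw [Ideal.map_span, Set.image_singleton, coeIdeal_span_singleton] at h
    exact even_iff_two_dvd.mpr ⟨_, by exact_mod_cast h⟩
  obtain ⟨a, b, hb, rfl⟩ := IsFractionRing.div_surjective (A := 𝓞 F) α
  have hb0 : b ≠ 0 := nonZeroDivisors.ne_zero hb
  have ha0 : a ≠ 0 := by
    rintro rfl
    simp at hα
  have hne : ∀ c : 𝓞 F, c ≠ 0 →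
      spanSingleton (𝓞 E)⁰ (algebraMap F E (algebraMap (𝓞 F) F c)) ≠ 0 := by
    intro c hc
    simpa [spanSingleton_ne_zero_iff] using hc
  rw [map_div₀, div_eq_mul_inv, ← spanSingleton_mul_spanSingleton, ← spanSingleton_inv,
    FractionalIdeal.count_mul E P (hne a ha0) (inv_ne_zero (hne b hb0)),
    FractionalIdeal.count_inv]
  exact (key a ha0).add (key b hb0).neg

/-- An automorphism fixing the prime `P` preserves `P`-adic valuations of fractional ideals. -/
theorem count_eq_of_mem_iff_exists_apply_eq {E : Type*} [Field E] [NumberField E] (σ : E ≃+* E)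
    (P : HeightOneSpectrum (𝓞 E))
    (hP : P.asIdeal.map (RingOfIntegers.mapRingEquiv σ) = P.asIdeal)
    {I Iσ : FractionalIdeal (𝓞 E)⁰ E} (hI : I ≠ 0)
    (hIσ : ∀ x : E, x ∈ Iσ ↔ ∃ y ∈ I, σ y = x) :
    Iσ ≠ 0 ∧ FractionalIdeal.count E P Iσ = FractionalIdeal.count E P I := by
  set τ : 𝓞 E ≃+* 𝓞 E := RingOfIntegers.mapRingEquiv σ
  have key : ∀ J : Ideal (𝓞 E), J ≠ 0 → FractionalIdeal.count E P
      (J.map τ : FractionalIdeal (𝓞 E)⁰ E) =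
        FractionalIdeal.count E P (J : FractionalIdeal (𝓞 E)⁰ E) := by
    intro J hJ
    exact (count_map_of_map_eq_pow E E (τ : 𝓞 E →+* 𝓞 E) P P one_ne_zero
      (by rw [pow_one]; exact hP) hJ).trans (by rw [Nat.cast_one, one_mul])
  obtain ⟨a, J, ha, rfl⟩ := FractionalIdeal.exists_eq_spanSingleton_mul I
  have hJ : J ≠ 0 := by
    rintro rfl
    simp at hI
  have hJτ : J.map τ ≠ 0 := by
    rwa [ne_eq, Ideal.zero_eq_bot, Ideal.map_eq_bot_iff_of_injective τ.injective]
  have hτa : τ a ≠ 0 := by simpa using ha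
  have hIσ' : Iσ = spanSingleton (𝓞 E)⁰ (algebraMap (𝓞 E) E (τ a))⁻¹ *
      (J.map τ : FractionalIdeal (𝓞 E)⁰ E) := by
    ext x
    rw [hIσ]
    simp only [mem_singleton_mul, mem_coeIdeal]
    constructor
    · rintro ⟨_, ⟨_, ⟨j, hj, rfl⟩, rfl⟩, rfl⟩
      refine ⟨_, ⟨τ j, Ideal.mem_map_of_mem _ hj, rfl⟩, ?_⟩
      rw [map_mul, map_inv₀]
      rfl
    · rintro ⟨_, ⟨k, hk, rfl⟩, rfl⟩
      obtain ⟨j, hj, rfl⟩ := (Ideal.mem_map_of_equiv τ k).mp hk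
      refine ⟨_, ⟨_, ⟨j, hj, rfl⟩, rfl⟩, ?_⟩
      rw [map_mul, map_inv₀]
      rfl
  have hspan : FractionalIdeal.count E P (spanSingleton (𝓞 E)⁰ (algebraMap (𝓞 E) E (τ a))) =
      FractionalIdeal.count E P (spanSingleton (𝓞 E)⁰ (algebraMap (𝓞 E) E a)) := by
    have h := key (Ideal.span {a}) (by simpa using ha)
    rwa [Ideal.map_span, Set.image_singleton, coeIdeal_span_singleton,
      coeIdeal_span_singleton] at h
  have hne : ∀ c : 𝓞 E, c ≠ 0 → (spanSingleton (𝓞 E)⁰ (algebraMap (𝓞 E) E c))⁻¹ ≠ 0 := by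
    intro c hc
    exact inv_ne_zero (by simpa [spanSingleton_ne_zero_iff] using hc)
  rw [hIσ', ← spanSingleton_inv, ← spanSingleton_inv]
  refine ⟨mul_ne_zero (hne _ hτa) (coeIdeal_ne_zero.mpr hJτ), ?_⟩
  rw [FractionalIdeal.count_mul E P (hne _ hτa) (coeIdeal_ne_zero.mpr hJτ),
    FractionalIdeal.count_mul E P (hne _ ha) (coeIdeal_ne_zero.mpr hJ),
    FractionalIdeal.count_inv, FractionalIdeal.count_inv, hspan, key J hJ]

/-- An automorphism over `F` fixes a prime whose square is extended from `F`. -/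
theorem map_mapRingEquiv_eq_of_map_eq_sq
    {E F : Type*} [Field E] [Field F] [Algebra F E]
    (σ : E ≃+* E) (hσ : ∀ x : F, σ (algebraMap F E x) = algebraMap F E x)
    {v : Ideal (𝓞 F)} {P : Ideal (𝓞 E)} [hP : P.IsPrime]
    (hram : v.map (algebraMap (𝓞 F) (𝓞 E)) = P ^ 2) :
    P.map (RingOfIntegers.mapRingEquiv σ) = P := by
  have hcomp : ((RingOfIntegers.mapRingEquiv σ : 𝓞 E ≃+* 𝓞 E) : 𝓞 E →+* 𝓞 E).comp
      (algebraMap (𝓞 F) (𝓞 E)) = algebraMap (𝓞 F) (𝓞 E) := by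
    ext x
    exact hσ x
  have hsq : P.map (RingOfIntegers.mapRingEquiv σ) ^ 2 = P ^ 2 := by
    rw [← Ideal.map_pow, ← hram]
    exact (Ideal.map_map _ _).trans (congrArg (fun f => Ideal.map f v) hcomp)
  have hprime : (P.map (RingOfIntegers.mapRingEquiv σ)).IsPrime :=
    Ideal.map_isPrime_of_equiv _
  exact le_antisymm (hP.le_of_pow_le (hsq.le.trans (Ideal.pow_le_self two_ne_zero)))
    (hprime.le_of_pow_le (hsq.ge.trans (Ideal.pow_le_self two_ne_zero)))

/-- If `v` is a prime of `O_F` that ramifies in `E` with unique prime `P_v`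
of `O_E` above it (i.e. `v·O_E = P_v²`), and the `P_v`-adic valuation of the different `D_E`
of `E/ℚ` is odd, then for every `O_E`-lattice `(I, α)` the `P_v`-adic valuation of the
discriminant ideal `α·I·σ(I)·D_E` is odd. -/
theorem odd_valuation_of_discriminantIdeal_at_ramified
    (E F : Type*) [Field E] [NumberField E] [Field F] [NumberField F] [Algebra F E]
    (σ : E ≃+* E)
    (hσ2 : ∀ x, σ (σ x) = x)
    (hσne : σ ≠ RingEquiv.refl E)
    (hfix : ∀ x : E, σ x = x ↔ x ∈ (algebraMap F E).range)
    (v : Ideal (𝓞 F)) (hv : v.IsPrime) (hv0 : v ≠ ⊥)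
    (P : HeightOneSpectrum (𝓞 E))
    (hram : Ideal.map (algebraMap (𝓞 F) (𝓞 E)) v = P.asIdeal ^ 2)
    (hodd : Odd (FractionalIdeal.count E P
      (differentIdeal ℤ (𝓞 E) : FractionalIdeal (𝓞 E)⁰ E)))
    (I : FractionalIdeal (𝓞 E)⁰ E) (hI : I ≠ 0)
    (Iσ : FractionalIdeal (𝓞 E)⁰ E)
    (hIσ : ∀ x : E, x ∈ Iσ ↔ ∃ y ∈ I, σ y = x)
    (α : F) (hα : α ≠ 0)
    (hlat : ∀ x ∈ I, ∀ y ∈ I,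
      ∃ n : ℤ, Algebra.trace ℚ E (algebraMap F E α * x * σ y) = (n : ℚ)) :
    Odd (FractionalIdeal.count E P
      (spanSingleton (𝓞 E)⁰ (algebraMap F E α) * I * Iσ
        * (differentIdeal ℤ (𝓞 E) : FractionalIdeal (𝓞 E)⁰ E))) := by
  have hPσ := map_mapRingEquiv_eq_of_map_eq_sq σ (fun x => (hfix _).mpr ⟨x, rfl⟩) hram
  obtain ⟨hIσ0, hcount⟩ := count_eq_of_mem_iff_exists_apply_eq σ P hPσ hI hIσ
  have heven := even_count_spanSingleton_algebraMap ⟨v, hv, hv0⟩ P hram hα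
  have hα0 : spanSingleton (𝓞 E)⁰ (algebraMap F E α) ≠ 0 := by
    simpa [spanSingleton_ne_zero_iff] using hα
  have hD0 : (differentIdeal ℤ (𝓞 E) : FractionalIdeal (𝓞 E)⁰ E) ≠ 0 := by
    intro h
    rw [h, FractionalIdeal.count_zero] at hodd
    exact absurd hodd (by decide)
  rw [FractionalIdeal.count_mul E P (mul_ne_zero (mul_ne_zero hα0 hI) hIσ0) hD0,
    FractionalIdeal.count_mul E P (mul_ne_zero hα0 hI) hIσ0,
    FractionalIdeal.count_mul E P hα0 hI, hcount, add_assoc (FractionalIdeal.count E P _)]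
  exact (heven.add (Even.add_self _)).add_odd hodd
end

section
/- Let E be a number field with a nontrivial field automorphism σ of order 2 with fixed field F, and suppose that no nonzero prime ideal of O_F ramifies in E. Let (I,α) be an O_E-lattice with discriminant ideal 𝒟 = α·I·σ(I)·D_E. Let s be the number of real embeddings of F that extend to imaginary embeddings of E, let a be the number of real embeddings τ of F extending to imaginary embeddings of E such that τ(α) < 0, and let m be the number of primes v of O_F that are inert in E such that the valuation of 𝒟 at the prime of O_E above v is odd. Then 2s − 4a ≡ 4m (mod 8). (Equivalently, the signature (σ₁,σ₂) of the trace form, which satisfies σ₁ − σ₂ = 2s − 4a, satisfies σ₁ − σ₂ ≡ 4m (mod 8).) -/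
set_option synthInstance.maxHeartbeats 1000000
set_option maxHeartbeats 1000000

open NumberField FractionalIdeal IsDedekindDomain
open scoped nonZeroDivisors

section QuadraticGaussSum

open Complex Filter Topology HurwitzZeta

/-- Splitting the sum defining the theta function according to residues modulo `2 n`. -/
theorem jacobiTheta_eq_sum_evenKernel (n : ℕ) (hn : 0 < n) {t : ℝ} (ht : 0 < t) :
    jacobiTheta (1 / (2 * n : ℕ) + I * t / (2 * n : ℕ) ^ 2) =
      ∑ r : Fin (2 * n), cexp (Real.pi * I * (r : ℕ) ^ 2 / (2 * n : ℕ)) *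
        evenKernel (((r : ℕ) / (2 * n : ℕ) : ℝ) : UnitAddCircle) t := by
  have hN : ((2 * n : ℕ) : ℂ) ≠ 0 := by exact_mod_cast (by omega : 2 * n ≠ 0)
  have : NeZero (2 * n) := ⟨by omega⟩
  set τ : ℂ := 1 / (2 * n : ℕ) + I * t / (2 * n : ℕ) ^ 2 with hτ
  have hτim : 0 < τ.im := by
    have : τ = ((1 / (2 * n : ℕ) : ℝ) : ℂ) + ((t / (2 * n : ℕ) ^ 2 : ℝ) : ℂ) * I := by
      rw [hτ]; push_cast; ring
    rw [this, add_im, ofReal_im, im_ofReal_mul, I_im]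
    positivity
  have key : ∀ (j : ℤ) (r : Fin (2 * n)),
      cexp (Real.pi * I * ((j * (2 * n : ℕ) + (r : ℕ) : ℤ) : ℂ) ^ 2 * τ) =
      cexp (Real.pi * I * (r : ℕ) ^ 2 / (2 * n : ℕ)) *
        ((Real.exp (-Real.pi * (j + ((r : ℕ) / (2 * n : ℕ) : ℝ)) ^ 2 * t) : ℝ) : ℂ) := by
    intro j r
    rw [ofReal_exp, ← Complex.exp_add, Complex.exp_eq_exp_iff_exists_int]
    refine ⟨j ^ 2 * n + j * r, ?_⟩
    rw [hτ]
    push_cast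
    push_cast at hN
    have hn' : (n : ℂ) ≠ 0 := by exact_mod_cast hn.ne'
    field_simp
    ring_nf
    simp only [I_sq]
    ring
  have hs : HasSum (fun k : ℤ ↦ cexp (Real.pi * I * (k : ℂ) ^ 2 * τ)) (jacobiTheta τ) := by
    have := hasSum_jacobiTheta₂_term 0 hτim
    rw [← jacobiTheta_eq_jacobiTheta₂] at this
    simpa [jacobiTheta₂_term] using this
  have hs2 := ((Int.divModEquiv (2 * n)).symm.hasSum_iff.mpr hs)
  have hs3 := ((Equiv.prodComm _ _).hasSum_iff.mpr hs2)
  have hfib : ∀ r : Fin (2 * n), HasSum (fun j : ℤ ↦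
      (((fun k : ℤ ↦ cexp (Real.pi * I * (k : ℂ) ^ 2 * τ)) ∘ (Int.divModEquiv (2 * n)).symm) ∘
        (Equiv.prodComm (Fin (2 * n)) ℤ)) (r, j))
      (cexp (Real.pi * I * (r : ℕ) ^ 2 / (2 * n : ℕ)) *
        evenKernel (((r : ℕ) / (2 * n : ℕ) : ℝ) : UnitAddCircle) t) := by
    intro r
    have h1 := (hasSum_ofReal.mpr (hasSum_int_evenKernel ((r : ℕ) / (2 * n : ℕ) : ℝ) ht)).mul_left
      (cexp (Real.pi * I * (r : ℕ) ^ 2 / (2 * n : ℕ)))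
    refine h1.congr_fun ?_
    intro j
    rw [← key]
    simp
  exact (hs3.prod_fiberwise hfib).unique (hasSum_fintype _)

theorem tendsto_cosKernel_atTop (a : UnitAddCircle) : Tendsto (cosKernel a) atTop (𝓝 1) := by
  obtain ⟨p, hp, h⟩ := isBigO_atTop_cosKernel_sub a
  have h0 : Tendsto (fun x : ℝ ↦ Real.exp (-p * x)) atTop (𝓝 0) := by
    refine Real.tendsto_exp_atBot.comp ?_
    exact tendsto_id.const_mul_atTop_of_neg (by linarith)
  simpa using (h.trans_tendsto h0).add_const 1

theorem jacobiTheta_nat_add (n : ℕ) (τ : ℂ) : jacobiTheta ((2 * n : ℕ) + τ) = jacobiTheta τ := by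
  induction n with
  | zero => simp
  | succ n ih =>
    rw [← ih, ← jacobiTheta_two_add ((2 * n : ℕ) + τ)]
    congr 1
    push_cast
    ring

theorem jacobiTheta_functional_equation (τ : ℂ) :
    jacobiTheta τ = 1 / (-I * τ) ^ (1 / 2 : ℂ) * jacobiTheta (-1 / τ) := by
  simp_rw [jacobiTheta_eq_jacobiTheta₂]
  rw [jacobiTheta₂_functional_equation]
  simp

theorem ofReal_mul_cpow_half {x : ℝ} (hx : 0 < x) {u : ℂ} (hu : u ≠ 0) :
    ((x : ℂ) * u) ^ (1 / 2 : ℂ) = (x : ℂ) ^ (1 / 2 : ℂ) * u ^ (1 / 2 : ℂ) := by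
  have hx' : (x : ℂ) ≠ 0 := by exact_mod_cast hx.ne'
  rw [cpow_def_of_ne_zero (mul_ne_zero hx' hu), cpow_def_of_ne_zero hx', cpow_def_of_ne_zero hu,
    log_ofReal_mul hx hu, ← Complex.exp_add, ofReal_log hx.le]
  ring_nf

/-- The exact formula relating the Gauss sum weights to the theta function near infinity. -/
theorem sum_cosKernel_eq (n : ℕ) (hn : 0 < n) {x : ℝ} (hx : 0 < x) :
    ∑ r : Fin (2 * n), cexp (Real.pi * I * (r : ℕ) ^ 2 / (2 * n : ℕ)) *
        cosKernel (((r : ℕ) / (2 * n : ℕ) : ℝ) : UnitAddCircle) x =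
      1 / (-I * (1 / (2 * n : ℕ) + I / (x * (2 * n : ℕ) ^ 2))) ^ (1 / 2 : ℂ) *
      (1 / ((2 * n : ℕ) / ((2 * n : ℕ) + I / x)) ^ (1 / 2 : ℂ)) *
        jacobiTheta (I * x - 1 / (2 * n : ℕ)) := by
  have hN0 : (0 : ℝ) < (2 * n : ℕ) := by exact_mod_cast (by omega : 0 < 2 * n)
  have hN : ((2 * n : ℕ) : ℂ) ≠ 0 := by exact_mod_cast hN0.ne'
  have hxc : (x : ℂ) ≠ 0 := by exact_mod_cast hx.ne'
  have h1 := jacobiTheta_eq_sum_evenKernel n hn (inv_pos.mpr hx)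
  set N : ℂ := ((2 * n : ℕ) : ℂ) with hNdef
  set z : ℂ := 1 / N + I / (x * N ^ 2) with hz
  have hz' : 1 / N + I * (x⁻¹ : ℝ) / N ^ 2 = z := by
    rw [hz]; push_cast; field_simp
  have hNI : N * x + I ≠ 0 := by
    intro h
    have := congrArg im h
    rw [hNdef, ← ofReal_natCast, ← ofReal_mul, add_im, ofReal_im, I_im] at this
    norm_num at this
  have hNI2 : N + I / x ≠ 0 := by
    intro h
    apply hNI
    have := congrArg (· * (x : ℂ)) h
    simp only [add_mul, zero_mul, div_mul_cancel₀ _ hxc] at this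
    exact this
  have hz0 : z ≠ 0 := by
    have : z = (N * x + I) / (x * N ^ 2) := by rw [hz]; field_simp
    rw [this]
    exact div_ne_zero hNI (mul_ne_zero hxc (pow_ne_zero _ hN))
  have hsum : ∑ r : Fin (2 * n), cexp (Real.pi * I * (r : ℕ) ^ 2 / N) *
        cosKernel (((r : ℕ) / (2 * n : ℕ) : ℝ) : UnitAddCircle) x =
        (1 / (x : ℂ) ^ (1 / 2 : ℂ)) * jacobiTheta z := by
    have e1 : ((x ^ (1 / 2 : ℝ) : ℝ) : ℂ) = (x : ℂ) ^ (1 / 2 : ℂ) := by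
      rw [ofReal_cpow hx.le]; norm_num
    have e2 : (x : ℂ) ^ (1 / 2 : ℂ) ≠ 0 := by
      rw [← e1]; exact_mod_cast (Real.rpow_pos_of_pos hx _).ne'
    rw [← hz', h1, Finset.mul_sum]
    refine Finset.sum_congr rfl fun r _ ↦ ?_
    rw [evenKernel_functional_equation, ofReal_mul, Real.inv_rpow hx.le, one_div (x ^ _)⁻¹,
      inv_inv, one_div x⁻¹, inv_inv, e1]
    field_simp
  set w : ℂ := N + -1 / z with hw
  have hw' : -I * w = ((x⁻¹ : ℝ) : ℂ) * (N / (N + I / x)) := by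
    have : z = (N * x + I) / (x * N ^ 2) := by rw [hz]; field_simp
    rw [hw, this]
    push_cast
    field_simp
    ring_nf
    simp [I_sq]
  have hw2 : -1 / w = I * x - 1 / N := by
    have : w = N * I / (N * x + I) := by
      have : z = (N * x + I) / (x * N ^ 2) := by rw [hz]; field_simp
      rw [hw, this]
      field_simp
      ring
    rw [this]
    field_simp
    ring_nf
    simp [I_sq]
  have e3 : ((x⁻¹ : ℝ) : ℂ) ^ (1 / 2 : ℂ) = 1 / (x : ℂ) ^ (1 / 2 : ℂ) := by
    push_cast
    rw [inv_cpow _ _ (by rw [arg_ofReal_of_nonneg hx.le]; exact Real.pi_pos.ne), ← one_div]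
  have e2 : (x : ℂ) ^ (1 / 2 : ℂ) ≠ 0 := by
    rw [Ne, cpow_eq_zero_iff]; tauto
  rw [hsum, jacobiTheta_functional_equation z, ← jacobiTheta_nat_add n, ← hNdef, ← hw,
    jacobiTheta_functional_equation w, hw2, hw', ofReal_mul_cpow_half (inv_pos.mpr hx)
      (div_ne_zero hN hNI2), e3]
  field_simp

/-- The quadratic Gauss sum modulo `2 n`, up to a positive factor. -/
theorem sum_exp_sq_eq (n : ℕ) (hn : 0 < n) : ∃ r : ℝ, 0 < r ∧
    ∑ k : Fin (2 * n), cexp (Real.pi * I * (k : ℕ) ^ 2 / (2 * n : ℕ)) =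
      r * cexp (Real.pi * I / 4) := by
  have hN0 : (0 : ℝ) < (2 * n : ℕ) := by exact_mod_cast (by omega : 0 < 2 * n)
  have hN : ((2 * n : ℕ) : ℂ) ≠ 0 := by exact_mod_cast hN0.ne'
  have hx1 : Tendsto (fun x : ℝ ↦ I / (x : ℂ)) atTop (𝓝 0) := by
    have h0 : Tendsto (fun x : ℝ ↦ ((x⁻¹ : ℝ) : ℂ)) atTop (𝓝 ((0 : ℝ) : ℂ)) :=
      (continuous_ofReal.tendsto 0).comp tendsto_inv_atTop_zero
    have := h0.const_mul I
    simpa [div_eq_mul_inv] using this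
  have hl : Tendsto (fun x : ℝ ↦ ∑ r : Fin (2 * n), cexp (Real.pi * I * (r : ℕ) ^ 2 / (2 * n : ℕ)) *
        cosKernel (((r : ℕ) / (2 * n : ℕ) : ℝ) : UnitAddCircle) x) atTop
        (𝓝 (∑ r : Fin (2 * n), cexp (Real.pi * I * (r : ℕ) ^ 2 / (2 * n : ℕ)) * ((1 : ℝ) : ℂ))) :=
    tendsto_finsetSum _ fun r _ ↦ ((continuous_ofReal.tendsto 1).comp
      (tendsto_cosKernel_atTop _)).const_mul _
  have hr1 : Tendsto (fun x : ℝ ↦ 1 / (-I * (1 / (2 * n : ℕ) + I / (x * (2 * n : ℕ) ^ 2))) ^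
      (1 / 2 : ℂ)) atTop (𝓝 (1 / (-I * (1 / (2 * n : ℕ) + 0 / (2 * n : ℕ) ^ 2)) ^ (1 / 2 : ℂ))) := by
    have hne : -I * (1 / (2 * n : ℕ) + 0 / (2 * n : ℕ) ^ 2) ≠ 0 := by simpa using hn.ne'
    have hre : -I * (1 / (2 * n : ℕ) + 0 / (2 * n : ℕ) ^ 2) ∈ slitPlane := by
      refine Or.inr ?_
      have : -I * (1 / (2 * n : ℕ) + 0 / (2 * n : ℕ) ^ 2) = ((-(1 / (2 * n : ℕ)) : ℝ) : ℂ) * I := by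
        push_cast; ring
      rw [this, im_ofReal_mul, I_im, mul_one]
      exact neg_ne_zero.mpr (one_div_ne_zero hN0.ne')
    refine Tendsto.div tendsto_const_nhds (Tendsto.cpow ?_ tendsto_const_nhds hre) ?_
    · refine Tendsto.const_mul _ (Tendsto.const_add _ ?_)
      simpa only [div_div] using hx1.div_const (((2 * n : ℕ) : ℂ) ^ 2)
    · rw [Ne, cpow_eq_zero_iff]
      tauto
  have hr2 : Tendsto (fun x : ℝ ↦ 1 / (((2 * n : ℕ) : ℂ) / ((2 * n : ℕ) + I / x)) ^ (1 / 2 : ℂ))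
      atTop (𝓝 (1 / (((2 * n : ℕ) : ℂ) / ((2 * n : ℕ) + 0)) ^ (1 / 2 : ℂ))) := by
    have h1 : ((2 * n : ℕ) : ℂ) / ((2 * n : ℕ) + 0) = 1 := by rw [add_zero, div_self hN]
    refine Tendsto.div tendsto_const_nhds (Tendsto.cpow ?_ tendsto_const_nhds ?_) ?_
    · exact Tendsto.div tendsto_const_nhds (hx1.const_add _) (by simpa using hn.ne')
    · rw [h1]; exact one_mem_slitPlane
    · rw [h1]; simp
  have hr3 : Tendsto (fun x : ℝ ↦ jacobiTheta (I * x - 1 / (2 * n : ℕ))) atTop (𝓝 1) := by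
    have him : ∀ x : ℝ, (I * x - 1 / (2 * n : ℕ)).im = x := by
      intro x
      have : I * x - 1 / (2 * n : ℕ) = (x : ℂ) * I - ((1 / (2 * n : ℕ) : ℝ) : ℂ) := by
        push_cast; ring
      rw [this, sub_im, ofReal_im, im_ofReal_mul, I_im]
      ring
    have ht : Tendsto (fun x : ℝ ↦ I * x - 1 / (2 * n : ℕ)) atTop (comap im atTop) := by
      rw [tendsto_comap_iff]
      refine tendsto_id.congr fun x ↦ (him x).symm
    have h0 : Tendsto (fun x : ℝ ↦ Real.exp (-Real.pi * x)) atTop (𝓝 0) :=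
      Real.tendsto_exp_atBot.comp (tendsto_id.const_mul_atTop_of_neg (by linarith [Real.pi_pos]))
    have h1 := isBigO_at_im_infty_jacobiTheta_sub_one.comp_tendsto ht
    have h2 : Tendsto ((fun τ : ℂ ↦ Real.exp (-Real.pi * τ.im)) ∘
        fun x : ℝ ↦ I * x - 1 / (2 * n : ℕ)) atTop (𝓝 0) :=
      h0.congr fun x ↦ by simp only [Function.comp_apply, him]
    simpa using (h1.trans_tendsto h2).add_const 1
  have h := tendsto_nhds_unique (hl.congr' ?_) ((hr1.mul hr2).mul hr3)
  · refine ⟨((2 * n : ℕ) : ℝ) ^ (1 / 2 : ℝ), Real.rpow_pos_of_pos hN0 _, ?_⟩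
    simp only [ofReal_one, mul_one] at h
    rw [h, add_zero, div_self hN, one_cpow, _root_.div_one, mul_one, zero_div, add_zero]
    have e : -I * (1 / ((2 * n : ℕ) : ℂ)) = (((2 * n : ℕ) : ℝ)⁻¹ : ℝ) * (-I) := by
      push_cast; ring
    rw [e, ofReal_mul_cpow_half (inv_pos.mpr hN0) (neg_ne_zero.mpr I_ne_zero)]
    have e2 : (-I) ^ (1 / 2 : ℂ) = cexp (-(Real.pi * I / 4)) := by
      rw [cpow_def_of_ne_zero (neg_ne_zero.mpr I_ne_zero), log_neg_I]
      congr 1; ring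
    have e3 : (((((2 * n : ℕ) : ℝ)⁻¹ : ℝ) : ℂ)) ^ (1 / 2 : ℂ) =
        (((((2 * n : ℕ) : ℝ) ^ (1 / 2 : ℝ) : ℝ)) : ℂ)⁻¹ := by
      rw [← ofReal_inv, ← Real.inv_rpow hN0.le, ofReal_cpow (inv_nonneg.mpr hN0.le)]
      norm_num
    rw [e2, e3, Complex.exp_neg, one_div, mul_inv, inv_inv, inv_inv]
  · filter_upwards [eventually_gt_atTop 0] with x hx
    exact sum_cosKernel_eq n hn hx

end QuadraticGaussSum

section FiniteQuadraticSums

open scoped Classical in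
/-- A sum of a quadratic character over a finite group reduces to the orthogonal complement of any
subgroup on which the character is trivial. -/
theorem sum_eq_sum_orthogonal {Q : Type*} [AddCommGroup Q] [Fintype Q] {χ : Q → ℂ}
    {β : Q → Q → ℂ} (hχ : ∀ x y, χ (x + y) = χ x * χ y * β x y)
    (hβ : ∀ x y z, β x (y + z) = β x y * β x z) {H K : AddSubgroup Q}
    (hH : ∀ h ∈ H, χ h = 1) (hK : ∀ x, x ∈ K ↔ ∀ h ∈ H, β x h = 1) :
    ∑ x, χ x = ∑ x : K, χ x := by
  have h1 : ∀ x, ∑ h : H, β x h = if x ∈ K then (Fintype.card H : ℂ) else 0 := by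
    intro x
    split_ifs with hx
    · rw [Finset.sum_congr rfl fun (h : H) _ ↦ (hK x).1 hx h h.2]
      simp
    · obtain ⟨h0, hh0, hne⟩ : ∃ h0 ∈ H, β x h0 ≠ 1 := by
        by_contra! hcon
        exact hx ((hK x).2 hcon)
      have h2 : ∑ h : H, β x h = β x h0 * ∑ h : H, β x h := by
        rw [Finset.mul_sum]
        refine (Fintype.sum_equiv (Equiv.addLeft (⟨h0, hh0⟩ : H)) _ _ fun h ↦ ?_).symm
        simp [hβ]
      have h3 : (1 - β x h0) * ∑ h : H, β x h = 0 := by linear_combination h2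
      exact (mul_eq_zero.1 h3).resolve_left (sub_ne_zero.2 hne.symm)
  have h2 : (Fintype.card H : ℂ) * ∑ x, χ x = Fintype.card H * ∑ x : K, χ x := by
    calc (Fintype.card H : ℂ) * ∑ x, χ x = ∑ h : H, ∑ x, χ (x + h) := by
          rw [Finset.sum_congr rfl fun (h : H) _ ↦
            Fintype.sum_equiv (Equiv.addRight (h : Q)) (fun x ↦ χ (x + h)) χ fun x ↦ rfl]
          simp
      _ = ∑ x, χ x * ∑ h : H, β x h := by
          rw [Finset.sum_comm]
          refine Finset.sum_congr rfl fun x _ ↦ ?_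
          rw [Finset.mul_sum]
          refine Finset.sum_congr rfl fun h _ ↦ ?_
          rw [hχ, hH h h.2, mul_one]
      _ = Fintype.card H * ∑ x : K, χ x := by
          simp_rw [h1, mul_ite, mul_zero]
          rw [← Finset.sum_filter, Finset.mul_sum,
            Finset.sum_subtype (p := (· ∈ K)) _ (by simp)]
          exact Finset.sum_congr rfl fun x _ ↦ mul_comm _ _
  exact mul_left_cancel₀ (by exact_mod_cast Fintype.card_ne_zero) h2

open scoped Classical in
/-- A sum of a quadratic character over a subgroup which is a union of cosets of a subgroup on
which it is invariant. -/
theorem sum_eq_card_mul_sum_of_cosets {Q Y : Type*} [AddCommGroup Q] [Fintype Q] [Fintype Y]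
    {χ : Q → ℂ} {H K : AddSubgroup Q} (hHK : H ≤ K) (c : Y → Q) (hc : ∀ y, c y ∈ K)
    (hχ : ∀ y, ∀ h ∈ H, χ (c y + h) = χ (c y)) (hinj : ∀ y y', c y - c y' ∈ H → y = y')
    (hsurj : ∀ z ∈ K, ∃ y, z - c y ∈ H) :
    ∑ x : K, χ x = Fintype.card H * ∑ y, χ (c y) := by
  have h1 : ∑ p : Y × H, χ (c p.1 + p.2) = ∑ x : K, χ x := by
    refine Fintype.sum_bijective
      (fun p ↦ (⟨c p.1 + p.2, K.add_mem (hc _) (hHK p.2.2)⟩ : K)) ⟨?_, ?_⟩ _ _ fun p ↦ rfl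
    · rintro ⟨y, h, hh⟩ ⟨y', h', hh'⟩ heq
      have heq' : c y + h = c y' + h' := congrArg Subtype.val heq
      have hy : y = y' := hinj _ _ (by
        rw [show c y - c y' = h' - h by
          rw [sub_eq_sub_iff_add_eq_add, heq', add_comm]]
        exact H.sub_mem hh' hh)
      subst hy
      simpa using heq'
    · rintro ⟨z, hz⟩
      obtain ⟨y, hy⟩ := hsurj z hz
      exact ⟨(y, ⟨_, hy⟩), by simp⟩
  rw [← h1, Fintype.sum_prod_type, Finset.mul_sum]
  refine Finset.sum_congr rfl fun y _ ↦ ?_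
  rw [Finset.sum_congr rfl fun (h : H) _ ↦ hχ y h h.2]
  simp

open scoped Classical in
/-- A sum of a quadratic character over the sum of two orthogonal subgroups. -/
theorem exists_mul_sum_sup_eq {Q : Type*} [AddCommGroup Q] [Fintype Q] {χ : Q → ℂ}
    {β : Q → Q → ℂ} (hχ : ∀ x y, χ (x + y) = χ x * χ y * β x y) {K₁ K₂ K : AddSubgroup Q}
    (h₁ : K₁ ≤ K) (h₂ : K₂ ≤ K) (hK : ∀ z ∈ K, ∃ x ∈ K₁, ∃ y ∈ K₂, x + y = z)
    (hβ : ∀ x ∈ K₁, ∀ y ∈ K₂, β x y = 1) :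
    ∃ r : ℝ, 0 < r ∧ (r : ℂ) * ∑ x : K, χ x = (∑ x : K₁, χ x) * ∑ x : K₂, χ x := by
  let f : K₁ × K₂ →+ K := (AddSubgroup.inclusion h₁).coprod (AddSubgroup.inclusion h₂)
  have hf : Function.Surjective f := by
    rintro ⟨z, hz⟩
    obtain ⟨x, hx, y, hy, rfl⟩ := hK z hz
    exact ⟨(⟨x, hx⟩, ⟨y, hy⟩), rfl⟩
  have hcard : ∀ z : K, (Finset.univ.filter fun p ↦ f p = z).card =
      (Finset.univ.filter fun p ↦ f p = 0).card := fun z ↦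
    AddMonoidHom.card_fiber_eq_of_mem_range f (hf z) (hf 0)
  refine ⟨(Finset.univ.filter fun p ↦ f p = 0).card, ?_, ?_⟩
  · exact_mod_cast Finset.card_pos.2 ⟨0, by simp⟩
  · rw [Finset.sum_mul_sum, ← Fintype.sum_prod_type' (f := fun (x : K₁) (y : K₂) ↦ χ x * χ y)]
    have h3 : ∀ p : K₁ × K₂, χ p.1 * χ p.2 = χ (f p) := by
      intro p
      change _ = χ ((p.1 : Q) + p.2)
      rw [hχ, hβ _ p.1.2 _ p.2.2, mul_one]
    rw [Finset.sum_congr rfl fun p _ ↦ h3 p, ← Finset.sum_fiberwise _ f, Finset.mul_sum]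
    refine Finset.sum_congr rfl fun z _ ↦ ?_
    rw [Finset.sum_congr rfl (g := fun _ ↦ χ z) fun p hp ↦ by rw [(Finset.mem_filter.1 hp).2]]
    rw [Finset.sum_const, ← hcard z, nsmul_eq_mul]
    congr!

end FiniteQuadraticSums

section DiagonalSums

open Complex

/-- The additive character `x ↦ exp (2 π i x)` of `ℚ`. -/
noncomputable def ratExp (x : ℚ) : ℂ := cexp (2 * Real.pi * I * x)

theorem ratExp_add (x y : ℚ) : ratExp (x + y) = ratExp x * ratExp y := by
  simp only [ratExp, ← Complex.exp_add]
  push_cast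
  ring_nf

theorem ratExp_eq_one_iff {x : ℚ} : ratExp x = 1 ↔ ∃ n : ℤ, x = n := by
  rw [ratExp, Complex.exp_eq_one_iff]
  refine exists_congr fun n ↦ ⟨fun h ↦ ?_, fun h ↦ by rw [h]; push_cast; ring⟩
  have : (2 * Real.pi * I : ℂ) ≠ 0 := by simp [Real.pi_ne_zero]
  have h2 : (x : ℂ) = n := mul_left_cancel₀ this (by rw [h]; ring)
  exact_mod_cast h2

theorem ratExp_intCast (n : ℤ) : ratExp n = 1 := ratExp_eq_one_iff.2 ⟨n, rfl⟩

theorem ratExp_ne_zero (x : ℚ) : ratExp x ≠ 0 := Complex.exp_ne_zero _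

theorem ratExp_sum {ι : Type*} (s : Finset ι) (f : ι → ℚ) :
    ratExp (∑ i ∈ s, f i) = ∏ i ∈ s, ratExp (f i) := by
  classical
  induction s using Finset.induction_on with
  | empty => simpa using ratExp_intCast 0
  | insert i s hi ih => rw [Finset.sum_insert hi, Finset.prod_insert hi, ratExp_add, ih]

theorem ratExp_eq_of_sub {x y : ℚ} (n : ℤ) (h : x - y = n) : ratExp x = ratExp y := by
  rw [← sub_add_cancel x y, ratExp_add, h, ratExp_intCast, one_mul]

/-- The Gauss sum weight on `ℤ / 2n`. -/
noncomputable def zmodQuadChar (n : ℤ) (z : ZMod (2 * n.natAbs)) : ℂ :=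
  ratExp ((z.val : ℚ) ^ 2 / (4 * n))

theorem zmodQuadChar_intCast {n : ℤ} (hn : n ≠ 0) (k : ℤ) :
    zmodQuadChar n (k : ZMod (2 * n.natAbs)) = ratExp ((k : ℚ) ^ 2 / (4 * n)) := by
  have : NeZero (2 * n.natAbs) := ⟨by omega⟩
  have h1 : (((k : ZMod (2 * n.natAbs)).val : ℤ) : ZMod (2 * n.natAbs)) = (k : ZMod _) := by simp
  rw [ZMod.intCast_eq_intCast_iff_dvd_sub] at h1
  obtain ⟨c, hc⟩ := h1
  have h2 : ∃ d : ℤ, k = ((k : ZMod (2 * n.natAbs)).val : ℤ) + 2 * n * d := by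
    rcases Int.natAbs_eq n with h | h
    · refine ⟨c, ?_⟩
      rw [Nat.cast_mul, ← h] at hc
      push_cast at hc
      linear_combination hc
    · refine ⟨-c, ?_⟩
      have h' : ((n.natAbs : ℕ) : ℤ) = -n := by omega
      rw [Nat.cast_mul, h'] at hc
      push_cast at hc
      linear_combination hc
  obtain ⟨d, hd⟩ := h2
  refine (ratExp_eq_of_sub (d * (k : ZMod (2 * n.natAbs)).val + n * d ^ 2) ?_).symm
  have hd' : (k : ℚ) = ((k : ZMod (2 * n.natAbs)).val : ℚ) + 2 * n * d := by exact_mod_cast hd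
  have hn' : (n : ℚ) ≠ 0 := by exact_mod_cast hn
  rw [hd']
  push_cast
  field_simp
  ring

theorem sum_zmodQuadChar_of_pos {n : ℕ} (hn : 0 < n) : ∃ r : ℝ, 0 < r ∧
    ∑ k : Fin (2 * n), ratExp ((k : ℕ) ^ 2 / (4 * n)) = r * cexp (Real.pi * I / 4) := by
  obtain ⟨r, hr, h⟩ := sum_exp_sq_eq n hn
  refine ⟨r, hr, h ▸ Finset.sum_congr rfl fun k _ ↦ ?_⟩
  rw [ratExp]
  have : (n : ℂ) ≠ 0 := by exact_mod_cast hn.ne'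
  congr 1
  push_cast
  field_simp
  ring

theorem sum_zmod_eq_sum_fin {M : Type*} [AddCommMonoid M] (N : ℕ) [NeZero N] (f : ℕ → M) :
    ∑ z : ZMod N, f z.val = ∑ k : Fin N, f k := by
  cases N with
  | zero => exact (NeZero.ne 0 rfl).elim
  | succ N => rfl

theorem sum_zmodQuadChar {n : ℤ} (hn : n ≠ 0) [NeZero (2 * n.natAbs)] : ∃ r : ℝ, 0 < r ∧
    ∑ z, zmodQuadChar n z = r * cexp (Real.pi * I / 4 * (SignType.sign n : ℤ)) := by
  have hpos : 0 < n.natAbs := Int.natAbs_pos.2 hn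
  obtain ⟨r, hr, h⟩ := sum_zmodQuadChar_of_pos hpos
  have h1 : ∑ z, zmodQuadChar n z =
      ∑ k : Fin (2 * n.natAbs), ratExp ((k : ℕ) ^ 2 / (4 * n)) :=
    sum_zmod_eq_sum_fin (2 * n.natAbs) fun k ↦ ratExp ((k : ℚ) ^ 2 / (4 * n))
  refine ⟨r, hr, ?_⟩
  rcases lt_or_gt_of_ne hn with hn0 | hn0
  · have e : ((n.natAbs : ℕ) : ℚ) = -n := by
      rw [Nat.cast_natAbs, abs_of_neg hn0, Int.cast_neg]
    have h2 := congrArg (starRingEnd ℂ) h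
    rw [h1, sign_neg hn0]
    rw [map_sum, map_mul, conj_ofReal, ← exp_conj] at h2
    convert h2 using 1
    · refine Finset.sum_congr rfl fun k _ ↦ ?_
      rw [ratExp, ratExp, ← exp_conj, e]
      congr 1
      simp [map_ofNat]
      ring
    · simp [map_ofNat]
      ring_nf
      simp
  · have e : ((n.natAbs : ℕ) : ℚ) = n := by
      rw [Nat.cast_natAbs, abs_of_pos hn0]
    rw [h1, sign_pos hn0, ← e, h]
    simp

/-- The Gauss sum of a diagonal lattice. -/
theorem sum_prod_zmodQuadChar {ι : Type*} [Fintype ι] [DecidableEq ι] {n : ι → ℤ}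
    (hn : ∀ i, n i ≠ 0) [∀ i, NeZero (2 * (n i).natAbs)] : ∃ r : ℝ, 0 < r ∧
    ∑ z : (∀ i, ZMod (2 * (n i).natAbs)), ∏ i, zmodQuadChar (n i) (z i) =
      r * cexp (Real.pi * I / 4 * (∑ i, (SignType.sign (n i) : ℤ) : ℤ)) := by
  choose r hr h using fun i ↦ sum_zmodQuadChar (hn i)
  refine ⟨∏ i, r i, Finset.prod_pos fun i _ ↦ hr i, ?_⟩
  rw [← Fintype.piFinset_univ, ← Finset.prod_univ_sum, Finset.prod_congr rfl fun i _ ↦ h i,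
    Finset.prod_mul_distrib, ← Complex.exp_sum, ← Finset.mul_sum]
  push_cast
  rfl

end DiagonalSums

section TraceSignature

open scoped Classical in
theorem sum_sign_eq_card_sub_card {κ R : Type*} [Fintype κ] [Ring R] [LinearOrder R]
    [IsStrictOrderedRing R] (f : κ → R) :
    ∑ k, (SignType.sign (f k) : ℤ) =
      Fintype.card {k // 0 < f k} - Fintype.card {k // 0 < -f k} := by
  have h : ∀ k, (SignType.sign (f k) : ℤ) =
      (if 0 < f k then 1 else 0) - (if 0 < -f k then 1 else 0) := by
    intro k
    rcases lt_trichotomy (f k) 0 with h | h | h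
    · simp [h, h.le.not_gt]
    · simp [h]
    · simp [h, h.le.not_gt]
  rw [Finset.sum_congr rfl fun k _ ↦ h k, Finset.sum_sub_distrib]
  simp [Fintype.card_subtype]

open scoped Classical in
theorem card_pos_add_card_neg_pos {κ R : Type*} [Fintype κ] [Ring R] [LinearOrder R]
    [IsStrictOrderedRing R] {f : κ → R} (hf : ∀ k, f k ≠ 0) :
    Fintype.card {k // 0 < f k} + Fintype.card {k // 0 < -f k} = Fintype.card κ := by
  rw [← Fintype.card_subtype_or_disjoint, Fintype.card_subtype, Finset.filter_true_of_mem]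
  · exact Finset.card_univ
  · intro k _
    rcases lt_or_gt_of_ne (hf k) with h | h
    · exact Or.inr (neg_pos.2 h)
    · exact Or.inl h
  · rw [Pi.disjoint_iff]
    intro k
    rw [Prop.disjoint_iff]
    rcases lt_or_gt_of_ne (hf k) with h | h <;> simp [h.le]

open NumberField.InfinitePlace

open scoped Classical in
/-- A family orthogonal for the form `Tr (c x y)` has at most `r₊ + r₂` members of positive
square. -/
theorem card_trace_pos_le {F : Type*} [Field F] [NumberField F] {c : F} {ι : Type*} [Fintype ι]
    {b : ι → F} (hb : Pairwise fun i j ↦ Algebra.trace ℚ F (c * (b i * b j)) = 0) :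
    Fintype.card {i // 0 < Algebra.trace ℚ F (c * (b i * b i))} ≤
      Fintype.card {τ : F →+* ℝ // 0 < τ c} + nrComplexPlaces F := by
  by_contra! hlt
  let X (t : {i // 0 < Algebra.trace ℚ F (c * (b i * b i))} → ℝ) (φ : F →+* ℂ) : ℂ :=
    ∑ i, (t i : ℂ) * φ (b i)
  have hXadd (t t') (φ) : X (t + t') φ = X t φ + X t' φ := by
    simp [X, add_mul, Finset.sum_add_distrib]
  have hXsmul (r : ℝ) (t) (φ) : X (r • t) φ = r * X t φ := by
    simp [X, Finset.mul_sum, mul_assoc]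
  choose root hroot using fun z : ℂ ↦ IsAlgClosed.exists_pow_nat_eq z two_pos
  let L : ({i // 0 < Algebra.trace ℚ F (c * (b i * b i))} → ℝ) →ₗ[ℝ]
      (({τ : F →+* ℝ // 0 < τ c} ⊕ {w : InfinitePlace F // IsComplex w}) → ℝ) :=
    { toFun := fun t ↦ Sum.elim (fun τ ↦ (X t (Complex.ofRealHom.comp τ.1)).re)
        (fun w ↦ (root (w.1.embedding c) * X t w.1.embedding).re)
      map_add' := fun t t' ↦ by
        ext (τ | w) <;> simp [hXadd, mul_add]
      map_smul' := fun r t ↦ by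
        ext (τ | w) <;> simp [hXsmul]
        ring }
  obtain ⟨t, ht, ht0⟩ : ∃ t ∈ LinearMap.ker L, t ≠ 0 := by
    apply Submodule.exists_mem_ne_zero_of_ne_bot
    apply LinearMap.ker_ne_bot_of_finrank_lt
    simpa [nrComplexPlaces] using hlt
  have hLt : L t = 0 := ht
  have hre (φ : F →+* ℂ) : (φ c * X t φ ^ 2).re ≤ 0 := by
    by_cases hφ : ComplexEmbedding.IsReal φ
    · have e : Complex.ofRealHom.comp hφ.embedding = φ := by
        ext x; simp
      have hX : X t φ = ((X t φ).re : ℂ) := by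
        refine (Complex.conj_eq_iff_re.1 ?_).symm
        simp only [X, map_sum, map_mul, Complex.conj_ofReal]
        exact Finset.sum_congr rfl fun i _ ↦ by
          rw [← ComplexEmbedding.conjugate_coe_eq, ComplexEmbedding.isReal_iff.1 hφ]
      have hc : φ c = (hφ.embedding c : ℂ) := by simp
      rw [hX, hc]
      by_cases hpos : 0 < hφ.embedding c
      · have := congrFun hLt (Sum.inl ⟨hφ.embedding, hpos⟩)
        simp only [L, LinearMap.coe_mk, AddHom.coe_mk, Sum.elim_inl, e, Pi.zero_apply] at this
        simp [this]
      · norm_cast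
        exact mul_nonpos_of_nonpos_of_nonneg (not_lt.1 hpos) (sq_nonneg _)
    · have key (z : ℂ) (hz : z.re = 0) : (z ^ 2).re ≤ 0 := by
        rw [sq, Complex.mul_re, hz]
        nlinarith [sq_nonneg z.im]
      have hw : IsComplex (InfinitePlace.mk φ) := isComplex_mk_iff.2 hφ
      have := congrFun hLt (Sum.inr ⟨_, hw⟩)
      simp only [L, LinearMap.coe_mk, AddHom.coe_mk, Sum.elim_inr, Pi.zero_apply] at this
      have h2 := key _ this
      rw [mul_pow, hroot] at h2
      rcases embedding_mk_eq φ with h | h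
      · rwa [h] at h2
      · rw [h] at h2
        have hX : X t (ComplexEmbedding.conjugate φ) = starRingEnd ℂ (X t φ) := by
          simp [X]
        rw [hX, ComplexEmbedding.conjugate_coe_eq, ← map_pow, ← map_mul, Complex.conj_re] at h2
        exact h2
  have hsum : ((∑ i, t i ^ 2 * (Algebra.trace ℚ F (c * (b i * b i)) : ℚ) : ℝ) : ℂ) =
      ∑ φ : F →ₐ[ℚ] ℂ, φ c * X t φ ^ 2 := by
    have h1 : ∀ φ : F →ₐ[ℚ] ℂ, φ c * X t φ ^ 2 =
        ∑ i, ∑ j, (t i : ℂ) * t j * φ (c * (b i * b j)) := by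
      intro φ
      rw [sq, Finset.sum_mul_sum, Finset.mul_sum]
      refine Finset.sum_congr rfl fun i _ ↦ ?_
      rw [Finset.mul_sum]
      refine Finset.sum_congr rfl fun j _ ↦ ?_
      simp
      ring
    rw [Finset.sum_congr rfl fun φ _ ↦ h1 φ, Finset.sum_comm]
    push_cast
    refine Finset.sum_congr rfl fun i _ ↦ ?_
    rw [Finset.sum_comm, Finset.sum_eq_single i]
    · rw [← Finset.mul_sum, ← trace_eq_sum_embeddings ℂ, sq, eq_ratCast, mul_comm]
    · intro j _ hj
      rw [← Finset.mul_sum, ← trace_eq_sum_embeddings ℂ, hb (fun h ↦ hj (Subtype.ext h).symm)]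
      simp
    · simp
  have hpos : 0 < ∑ i, t i ^ 2 * ((Algebra.trace ℚ F (c * (b i * b i)) : ℚ) : ℝ) := by
    obtain ⟨i, hi⟩ := Function.ne_iff.1 ht0
    refine Finset.sum_pos' (fun j _ ↦ ?_) ⟨i, Finset.mem_univ _, ?_⟩
    · exact mul_nonneg (sq_nonneg _) (by exact_mod_cast j.2.le)
    · exact mul_pos (pow_two_pos_of_ne_zero hi) (by exact_mod_cast i.2)
  have h3 := congrArg Complex.re hsum
  rw [Complex.ofReal_re, Complex.re_sum] at h3
  exact absurd (h3 ▸ Finset.sum_nonpos fun φ _ ↦ hre φ) (not_le.2 hpos)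

open scoped Classical in
/-- The signature of the form `Tr (c x y)` is the sum of the signs of `c` at the real
embeddings. -/
theorem sum_sign_trace_eq {F : Type*} [Field F] [NumberField F] {c : F} (hc : c ≠ 0) {ι : Type*}
    [Fintype ι] (b : Module.Basis ι ℚ F)
    (hb : Pairwise fun i j ↦ Algebra.trace ℚ F (c * (b i * b j)) = 0) :
    (∀ i, Algebra.trace ℚ F (c * (b i * b i)) ≠ 0) ∧
    ∑ i, (SignType.sign (Algebra.trace ℚ F (c * (b i * b i))) : ℤ) =
      ∑ τ : F →+* ℝ, (SignType.sign (τ c) : ℤ) := by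
  have hne : ∀ i, Algebra.trace ℚ F (c * (b i * b i)) ≠ 0 := by
    intro i hi
    have h1 : ∀ y, Algebra.trace ℚ F (c * (b i * y)) = 0 := by
      intro y
      have : (Algebra.trace ℚ F) ∘ₗ (LinearMap.mulLeft ℚ (c * b i)) = 0 := by
        refine b.ext fun j ↦ ?_
        rcases eq_or_ne i j with rfl | hij
        · simpa [mul_assoc] using hi
        · simpa [mul_assoc] using hb hij
      simpa [mul_assoc] using LinearMap.congr_fun this y
    have h2 := h1 ((c * b i)⁻¹)
    rw [← mul_assoc, mul_inv_cancel₀ (mul_ne_zero hc (b.ne_zero i))] at h2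
    have h3 : Algebra.trace ℚ F 1 = Module.finrank ℚ F := by
      simpa using Algebra.trace_algebraMap (S := F) (1 : ℚ)
    rw [h3] at h2
    exact Module.finrank_pos.ne' (by exact_mod_cast h2 : Module.finrank ℚ F = 0)
  refine ⟨hne, ?_⟩
  have h1 := card_trace_pos_le (c := c) hb
  have h2 := card_trace_pos_le (c := -c) (b := b) fun i j hij ↦ by simp [hb hij]
  simp only [neg_mul, map_neg] at h2
  have h3 := card_pos_add_card_neg_pos hne
  have h4 := card_pos_add_card_neg_pos (f := fun τ : F →+* ℝ ↦ τ c) fun τ ↦ by simpa using hc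
  have h5 : Fintype.card (F →+* ℝ) = nrRealPlaces F := by
    rw [← card_real_embeddings]
    refine Fintype.card_congr ⟨fun τ ↦ ⟨Complex.ofRealHom.comp τ, ?_⟩, fun φ ↦ φ.2.embedding,
      fun τ ↦ ?_, fun φ ↦ ?_⟩
    · ext x
      simp
    · ext x
      apply Complex.ofReal_injective
      rw [ComplexEmbedding.IsReal.coe_embedding_apply]
      rfl
    · ext x
      simp
  have h6 := card_add_two_mul_card_eq_rank F
  have h7 := Module.finrank_eq_card_basis b
  rw [sum_sign_eq_card_sub_card, sum_sign_eq_card_sub_card]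
  omega

end TraceSignature

section LatticeGaussSums

variable {V ι : Type*} [AddCommGroup V] [Module ℚ V] [Fintype ι]

/-- The parametrization of the dual of an orthogonal lattice by integral vectors. -/
noncomputable def dualParam (e : Module.Basis ι ℚ V) (n : ι → ℤ) : (ι → ℤ) →+ V where
  toFun k := ∑ i, ((k i : ℚ) / (2 * n i)) • e i
  map_zero' := by simp
  map_add' k l := by simp [add_div, add_smul, Finset.sum_add_distrib]

variable {B : V →ₗ[ℚ] V →ₗ[ℚ] ℚ} {e : Module.Basis ι ℚ V} {n : ι → ℤ}

theorem bilin_dualParam_right (horth : ∀ i j, i ≠ j → B (e i) (e j) = 0)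
    (hn : ∀ i, B (e i) (e i) = 2 * n i) (hn0 : ∀ i, n i ≠ 0) (i : ι) (l : ι → ℤ) :
    B (e i) (dualParam e n l) = l i := by
  have hi : (n i : ℚ) ≠ 0 := by exact_mod_cast hn0 i
  simp only [dualParam, AddMonoidHom.coe_mk, ZeroHom.coe_mk, map_sum, map_smul, smul_eq_mul]
  rw [Finset.sum_eq_single i (fun j _ hj ↦ by rw [horth i j hj.symm, mul_zero]) (by simp), hn]
  field_simp

theorem bilin_dualParam (horth : ∀ i j, i ≠ j → B (e i) (e j) = 0)
    (hn : ∀ i, B (e i) (e i) = 2 * n i) (hn0 : ∀ i, n i ≠ 0) (k l : ι → ℤ) :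
    B (dualParam e n k) (dualParam e n l) = ∑ i, (k i : ℚ) * l i / (2 * n i) := by
  have hl := fun i ↦ bilin_dualParam_right horth hn hn0 i l
  generalize dualParam e n l = y at hl ⊢
  simp only [dualParam, AddMonoidHom.coe_mk, ZeroHom.coe_mk, map_sum, map_smul,
    LinearMap.sum_apply, LinearMap.smul_apply, smul_eq_mul, hl]
  exact Finset.sum_congr rfl fun i _ ↦ by ring

theorem exists_dualParam_eq (horth : ∀ i j, i ≠ j → B (e i) (e j) = 0)
    (hn : ∀ i, B (e i) (e i) = 2 * n i) (hn0 : ∀ i, n i ≠ 0) {x : V}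
    (hx : ∀ i, ∃ z : ℤ, B (e i) x = z) : ∃ k, dualParam e n k = x := by
  choose k hk using hx
  refine ⟨k, ?_⟩
  rw [← e.sum_repr x]
  simp only [dualParam, AddMonoidHom.coe_mk, ZeroHom.coe_mk]
  refine Finset.sum_congr rfl fun i _ ↦ ?_
  have hi : (n i : ℚ) ≠ 0 := by exact_mod_cast hn0 i
  have h : B (e i) x = 2 * n i * e.repr x i := by
    conv_lhs => rw [← e.sum_repr x]
    simp only [map_sum, map_smul, smul_eq_mul]
    rw [Finset.sum_eq_single i (fun j _ hj ↦ by rw [horth i j hj.symm, mul_zero]) (by simp), hn]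
    ring
  rw [← hk, h]
  congr 1
  field_simp

/-- Reduction of integral vectors modulo `2 nᵢ`. -/
def reduceParam (n : ι → ℤ) : (ι → ℤ) →+ (∀ i, ZMod (2 * (n i).natAbs)) where
  toFun k i := k i
  map_zero' := by ext; simp
  map_add' k l := by ext; simp

theorem reduceParam_surjective {ι : Type*} (n : ι → ℤ) : Function.Surjective (reduceParam n) := fun z ↦ by
  choose k hk using fun i ↦ ZMod.intCast_surjective (z i)
  exact ⟨k, funext hk⟩

theorem dualParam_mem_of_reduceParam_eq_zero {M : AddSubgroup V} (he : ∀ i, e i ∈ M)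
    (hn0 : ∀ i, n i ≠ 0) {k : ι → ℤ} (hk : reduceParam n k = 0) : dualParam e n k ∈ M := by
  simp only [dualParam, AddMonoidHom.coe_mk, ZeroHom.coe_mk]
  refine M.sum_mem fun i _ ↦ ?_
  have h1 : ((k i : ℤ) : ZMod (2 * (n i).natAbs)) = 0 := congrFun hk i
  rw [ZMod.intCast_zmod_eq_zero_iff_dvd, Nat.cast_mul, Int.natCast_natAbs] at h1
  obtain ⟨c, hc⟩ : 2 * n i ∣ k i := (abs_dvd_abs _ _).1 <| by
    have := (abs_dvd_abs _ _).2 h1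
    simpa [abs_mul] using this
  have hi : (n i : ℚ) ≠ 0 := by exact_mod_cast hn0 i
  have : (k i : ℚ) / (2 * n i) = c := by
    rw [hc]
    push_cast
    field_simp
  rw [this, Int.cast_smul_eq_zsmul]
  exact M.zsmul_mem (he i) c

/-- The subgroup of the finite discriminant group cut out by a lattice. -/
noncomputable def discSubgroup (e : Module.Basis ι ℚ V) (n : ι → ℤ) (U : AddSubgroup V) :
    AddSubgroup (∀ i, ZMod (2 * (n i).natAbs)) :=
  (U.comap (dualParam e n)).map (reduceParam n)

theorem reduceParam_mem_discSubgroup_iff {U : AddSubgroup V} (he : ∀ i, e i ∈ U)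
    (hn0 : ∀ i, n i ≠ 0) {k : ι → ℤ} :
    reduceParam n k ∈ discSubgroup e n U ↔ dualParam e n k ∈ U := by
  refine ⟨?_, fun h ↦ ⟨k, h, rfl⟩⟩
  rintro ⟨l, hl, hlk⟩
  have h : dualParam e n (k - l) ∈ U :=
    dualParam_mem_of_reduceParam_eq_zero he hn0 (by rw [map_sub, hlk, sub_self])
  rw [map_sub] at h
  simpa using U.add_mem h hl

theorem discSubgroup_mono {U W : AddSubgroup V} (h : U ≤ W) :
    discSubgroup e n U ≤ discSubgroup e n W :=
  AddSubgroup.map_mono (AddSubgroup.comap_mono h)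

/-- The Gauss sum weight on the discriminant group of an orthogonal lattice. -/
noncomputable def discChar (n : ι → ℤ) (z : ∀ i, ZMod (2 * (n i).natAbs)) : ℂ :=
  ∏ i, zmodQuadChar (n i) (z i)

theorem discChar_reduceParam (horth : ∀ i j, i ≠ j → B (e i) (e j) = 0)
    (hn : ∀ i, B (e i) (e i) = 2 * n i) (hn0 : ∀ i, n i ≠ 0) (k : ι → ℤ) :
    discChar n (reduceParam n k) =
      ratExp (B (dualParam e n k) (dualParam e n k) / 2) := by
  rw [bilin_dualParam horth hn hn0, Finset.sum_div, ratExp_sum]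
  refine Finset.prod_congr rfl fun i _ ↦ ?_
  refine (zmodQuadChar_intCast (hn0 i) (k i)).trans ?_
  congr 1
  rw [div_div]
  ring

theorem exists_bilin_eq_intCast (hsymm : ∀ x y, B x y = B y x) {M : AddSubgroup V}
    (hM : ∀ x ∈ M, ∃ z : ℤ, B x x = 2 * z) {x y : V} (hx : x ∈ M) (hy : y ∈ M) :
    ∃ z : ℤ, B x y = z := by
  obtain ⟨a, ha⟩ := hM x hx
  obtain ⟨b, hb⟩ := hM y hy
  obtain ⟨c, hc⟩ := hM _ (M.add_mem hx hy)
  simp only [map_add, LinearMap.add_apply, hsymm y x] at hc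
  exact ⟨c - a - b, by push_cast; linarith⟩

open scoped Classical in
/-- Milgram's argument: the signature modulo `8` of an even lattice whose discriminant form is an
orthogonal sum of forms with negative Gauss sums. -/
theorem eight_dvd_sum_sign_add {V : Type u} {ι κ : Type*} [AddCommGroup V] [Module ℚ V]
    [Fintype ι] {B : V →ₗ[ℚ] V →ₗ[ℚ] ℚ} {e : Module.Basis ι ℚ V} {n : ι → ℤ}
    (hsymm : ∀ x y, B x y = B y x) (horth : ∀ i j, i ≠ j → B (e i) (e j) = 0)
    (hn : ∀ i, B (e i) (e i) = 2 * n i) (hn0 : ∀ i, n i ≠ 0)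
    {M : AddSubgroup V} (he : ∀ i, e i ∈ M) (hM : ∀ x ∈ M, ∃ z : ℤ, B x x = 2 * z)
    {S : Finset κ} {U : κ → AddSubgroup V} (hMU : ∀ p ∈ S, M ≤ U p)
    (hUM : ∀ p ∈ S, ∀ x ∈ U p, ∀ y ∈ M, ∃ z : ℤ, B x y = z)
    (hUU : ∀ p ∈ S, ∀ p' ∈ S, p ≠ p' → ∀ x ∈ U p, ∀ y ∈ U p', ∃ z : ℤ, B x y = z)
    (hsup : ∀ x, (∀ y ∈ M, ∃ z : ℤ, B x y = z) → x ∈ M ⊔ ⨆ p ∈ S, U p)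
    (hneg : ∀ p ∈ S, ∃ (Y : Type u) (_ : Fintype Y) (c : Y → V), (∀ y, c y ∈ U p) ∧
      (∀ y y', c y - c y' ∈ M → y = y') ∧ (∀ x ∈ U p, ∃ y, x - c y ∈ M) ∧
      ∃ r : ℝ, r < 0 ∧ ∑ y, ratExp (B (c y) (c y) / 2) = r) :
    (8 : ℤ) ∣ ∑ i, (SignType.sign (n i) : ℤ) + 4 * S.card := by
  have hNZ : ∀ i, NeZero (2 * (n i).natAbs) := fun i ↦ ⟨by have := hn0 i; omega⟩
  have hχ0 : ∀ z, discChar n z ≠ 0 := fun z ↦ Finset.prod_ne_zero_iff.2 fun i _ ↦ ratExp_ne_zero _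
  set χ := discChar n with hχdef
  have hχk : ∀ k, χ (reduceParam n k) = ratExp (B (dualParam e n k) (dualParam e n k) / 2) :=
    discChar_reduceParam horth hn hn0
  let β : (∀ i, ZMod (2 * (n i).natAbs)) → (∀ i, ZMod (2 * (n i).natAbs)) → ℂ :=
    fun x y ↦ χ (x + y) / (χ x * χ y)
  have hχ : ∀ x y, χ (x + y) = χ x * χ y * β x y := fun x y ↦
    (mul_div_cancel₀ _ (mul_ne_zero (hχ0 x) (hχ0 y))).symm
  have hβ : ∀ k l, β (reduceParam n k) (reduceParam n l) =
      ratExp (B (dualParam e n k) (dualParam e n l)) := by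
    intro k l
    simp only [β]
    rw [div_eq_iff (mul_ne_zero (hχ0 _) (hχ0 _)), ← map_add,
      hχk, hχk, hχk, ← ratExp_add, ← ratExp_add]
    congr 1
    simp only [map_add, LinearMap.add_apply, hsymm (dualParam e n l) (dualParam e n k)]
    ring
  have hβadd : ∀ x y z, β x (y + z) = β x y * β x z := by
    intro x y z
    obtain ⟨k, rfl⟩ := reduceParam_surjective n x
    obtain ⟨l, rfl⟩ := reduceParam_surjective n y
    obtain ⟨m, rfl⟩ := reduceParam_surjective n z
    rw [← map_add, hβ, hβ, hβ, map_add, map_add, ratExp_add]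
  have hMint : ∀ x ∈ M, ∀ y ∈ M, ∃ z : ℤ, B x y = z := fun x hx y hy ↦
    exists_bilin_eq_intCast hsymm hM hx hy
  have hparam : ∀ x, (∀ y ∈ M, ∃ z : ℤ, B x y = z) → ∃ k, dualParam e n k = x := fun x hx ↦
    exists_dualParam_eq horth hn hn0 fun i ↦ by
      rw [hsymm]
      exact hx _ (he i)
  have hχM : ∀ h ∈ discSubgroup e n M, χ h = 1 := by
    rintro _ ⟨k, hk, rfl⟩
    rw [hχk]
    obtain ⟨z, hz⟩ := hM _ hk
    rw [hz]
    exact ratExp_eq_one_iff.2 ⟨z, by ring⟩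
  have hdual : ∀ T ⊆ S, ∀ x ∈ M ⊔ ⨆ p ∈ T, U p, ∀ y, (∀ z ∈ M, ∃ t : ℤ, B z y = t) →
      (∀ p ∈ T, ∀ z ∈ U p, ∃ t : ℤ, B z y = t) → ∃ t : ℤ, B x y = t := by
    intro T hT x hx y hy hyT
    let N : AddSubgroup V := (AddMonoidHom.range (Int.castAddHom ℚ)).comap (B.flip y).toAddMonoidHom
    have hN : ∀ z, z ∈ N ↔ ∃ t : ℤ, B z y = t := fun z ↦
      ⟨fun ⟨t, ht⟩ ↦ ⟨t, ht.symm⟩, fun ⟨t, ht⟩ ↦ ⟨t, ht.symm⟩⟩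
    refine (hN x).1 ((sup_le (fun z hz ↦ (hN z).2 (hy z hz)) ?_ : M ⊔ ⨆ p ∈ T, U p ≤ N) hx)
    exact iSup₂_le fun p hp z hz ↦ (hN z).2 (hyT p hp z hz)
  have hTM : ∀ T ⊆ S, ∀ x ∈ M ⊔ ⨆ p ∈ T, U p, ∀ y ∈ M, ∃ z : ℤ, B x y = z := fun T hT x hx y hy ↦
    hdual T hT x hx y (fun z hz ↦ hMint z hz y hy) fun p hp z hz ↦ hUM p (hT hp) z hz y hy
  have hA : ∑ x, χ x = ∑ x : discSubgroup e n (M ⊔ ⨆ p ∈ S, U p), χ x := by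
    refine sum_eq_sum_orthogonal hχ hβadd hχM fun x ↦ ?_
    obtain ⟨k, rfl⟩ := reduceParam_surjective n x
    rw [reduceParam_mem_discSubgroup_iff (fun i ↦ AddSubgroup.mem_sup_left (he i)) hn0]
    constructor
    · rintro hk _ ⟨l, hl, rfl⟩
      rw [hβ, ratExp_eq_one_iff]
      exact hTM S subset_rfl _ hk _ hl
    · intro h
      refine hsup _ fun y hy ↦ ?_
      obtain ⟨l, rfl⟩ := hparam y fun z hz ↦ hMint y hy z hz
      have := h (reduceParam n l) ⟨l, hy, rfl⟩
      rwa [hβ, ratExp_eq_one_iff] at this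
  have hB : ∀ T ⊆ S, ∃ r : ℝ, 0 < r ∧
      ∑ x : discSubgroup e n (M ⊔ ⨆ p ∈ T, U p), χ x = r * (-1) ^ T.card := by
    intro T
    induction T using Finset.induction_on with
    | empty =>
      intro _
      have hempty : M ⊔ ⨆ p ∈ (∅ : Finset κ), U p = M := by simp
      rw [hempty, Finset.card_empty, pow_zero]
      simp only [mul_one]
      rw [Finset.sum_congr rfl fun (x : discSubgroup e n M) _ ↦ hχM x x.2]
      refine ⟨Fintype.card (discSubgroup e n M), by exact_mod_cast Fintype.card_pos, ?_⟩
      simp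
    | insert p T hp ih =>
      intro hT
      have hpS : p ∈ S := hT (Finset.mem_insert_self p T)
      have hTS : T ⊆ S := (Finset.subset_insert p T).trans hT
      obtain ⟨r, hr, h⟩ := ih hTS
      obtain ⟨Y, _, c, hcU, hcinj, hcsurj, ρ, hρ, hsum⟩ := hneg p hpS
      choose k hk using fun y ↦ hparam (c y) fun z hz ↦ hUM p hpS _ (hcU y) z hz
      have heU : ∀ i, e i ∈ U p := fun i ↦ hMU p hpS (he i)
      have hC : ∑ x : discSubgroup e n (U p), χ x =
          Fintype.card (discSubgroup e n M) * ∑ y, χ (reduceParam n (k y)) := by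
        refine sum_eq_card_mul_sum_of_cosets (discSubgroup_mono (hMU p hpS)) _ ?_ ?_ ?_ ?_
        · intro y
          rw [reduceParam_mem_discSubgroup_iff heU hn0, hk]
          exact hcU y
        · rintro y _ ⟨l, hl, rfl⟩
          rw [hχ, hχM _ ⟨l, hl, rfl⟩, mul_one, hβ, hk,
            ratExp_eq_one_iff.2 (hUM p hpS _ (hcU y) _ hl), mul_one]
        · intro y y' h
          rw [← map_sub, reduceParam_mem_discSubgroup_iff he hn0, map_sub, hk, hk] at h
          exact hcinj y y' h
        · rintro _ ⟨l, hl, rfl⟩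
          obtain ⟨y, hy⟩ := hcsurj _ hl
          refine ⟨y, ?_⟩
          rw [← map_sub, reduceParam_mem_discSubgroup_iff he hn0, map_sub, hk]
          exact hy
      have hsum' : ∑ y, χ (reduceParam n (k y)) = ρ := by
        rw [← hsum]
        exact Finset.sum_congr rfl fun y _ ↦ by rw [hχk, hk]
      have hsupeq : M ⊔ ⨆ p' ∈ insert p T, U p' = (M ⊔ ⨆ p' ∈ T, U p') ⊔ U p := by
        rw [Finset.iSup_insert, sup_comm (U p), sup_assoc]
      obtain ⟨t, ht, htsum⟩ := exists_mul_sum_sup_eq hχ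
        (K₁ := discSubgroup e n (M ⊔ ⨆ p' ∈ T, U p')) (K₂ := discSubgroup e n (U p))
        (K := discSubgroup e n (M ⊔ ⨆ p' ∈ insert p T, U p'))
        (discSubgroup_mono (hsupeq ▸ le_sup_left)) (discSubgroup_mono (hsupeq ▸ le_sup_right)) (by
          rintro _ ⟨l, hl, rfl⟩
          rw [SetLike.mem_coe, AddSubgroup.mem_comap, hsupeq, AddSubgroup.mem_sup] at hl
          obtain ⟨x, hx, y, hy, hxy⟩ := hl
          obtain ⟨lx, rfl⟩ := hparam x (hTM T hTS x hx)
          obtain ⟨ly, rfl⟩ := hparam y (hUM p hpS y hy)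
          refine ⟨_, ⟨lx, hx, rfl⟩, _, ⟨l - lx, ?_, rfl⟩, by rw [← map_add]; simp⟩
          rw [SetLike.mem_coe, AddSubgroup.mem_comap, map_sub, ← hxy]
          simpa using hy) (by
          rintro _ ⟨lx, hx, rfl⟩ _ ⟨ly, hy, rfl⟩
          rw [hβ, ratExp_eq_one_iff]
          refine hdual T hTS _ hx _ (fun z hz ↦ ?_) fun p' hp' z hz ↦ ?_
          · rw [hsymm]
            exact hUM p hpS _ hy z hz
          · exact hUU p' (hTS hp') p hpS (fun h ↦ hp (h ▸ hp')) z hz _ hy)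
      rw [h, hC, hsum'] at htsum
      have hcard : 0 < (Fintype.card (discSubgroup e n M) : ℝ) := by exact_mod_cast Fintype.card_pos
      refine ⟨r * (Fintype.card (discSubgroup e n M) * -ρ) / t,
        div_pos (mul_pos hr (mul_pos hcard (neg_pos.2 hρ))) ht, ?_⟩
      have ht' : (t : ℂ) ≠ 0 := by exact_mod_cast ht.ne'
      apply mul_left_cancel₀ ht'
      rw [htsum, Finset.card_insert_of_notMem hp]
      push_cast
      field_simp
      ring
  obtain ⟨r, hr, h1⟩ := sum_prod_zmodQuadChar hn0
  obtain ⟨r', hr', h2⟩ := hB S subset_rfl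
  rw [← hA, hχdef] at h2
  unfold discChar at h2
  rw [h1] at h2
  have h3 : Complex.exp (Real.pi * Complex.I / 4 *
      (∑ i, (SignType.sign (n i) : ℤ) + 4 * S.card : ℤ)) = (r' / r : ℝ) := by
    have hr0 : (r : ℂ) ≠ 0 := by exact_mod_cast hr.ne'
    rw [Int.cast_add, mul_add, Complex.exp_add, show Real.pi * Complex.I / 4 *
      ((4 * S.card : ℤ) : ℂ) = S.card * (Real.pi * Complex.I) by push_cast; ring,
      Complex.exp_nat_mul, Complex.exp_pi_mul_I]
    apply mul_left_cancel₀ hr0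
    rw [← mul_assoc, h2, mul_assoc, ← mul_pow]
    push_cast
    field_simp
    simp
  generalize ∑ i, (SignType.sign (n i) : ℤ) + 4 * S.card = N at h3 ⊢
  have h4 : (r' / r : ℝ) = 1 := by
    have h5 := congrArg norm h3
    rw [Complex.norm_real, Real.norm_of_nonneg (div_pos hr' hr).le] at h5
    rw [← h5, show (Real.pi * Complex.I / 4 * N : ℂ) = (Real.pi / 4 * N : ℝ) * Complex.I by
      push_cast; ring, Complex.norm_exp_ofReal_mul_I]
  rw [h4, Complex.ofReal_one, Complex.exp_eq_one_iff] at h3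
  obtain ⟨z, hz⟩ := h3
  refine ⟨z, ?_⟩
  have h6 : (Real.pi * Complex.I : ℂ) ≠ 0 := by simp [Real.pi_ne_zero]
  have h7 : (N : ℂ) = (8 * z : ℤ) := by
    apply mul_left_cancel₀ h6
    push_cast
    linear_combination 4 * hz
  exact_mod_cast h7

end LatticeGaussSums

section QuadraticTraceForm

set_option linter.unusedSectionVars false

variable {E F : Type*} [Field E] [NumberField E] [Field F] [NumberField F] [Algebra F E]

/-- An involution with fixed field `F` generates the Galois group of `E / F`. -/
theorem exists_gal_of_involution (σ : E ≃+* E) (hσ2 : ∀ x, σ (σ x) = x)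
    (hσne : σ ≠ RingEquiv.refl E) (hfix : ∀ x : E, σ x = x ↔ x ∈ (algebraMap F E).range) :
    ∃ τ : Gal(E/F), (∀ x, τ x = σ x) ∧ IsGalois F E ∧ τ ≠ 1 ∧ ∀ g : Gal(E/F), g = 1 ∨ g = τ := by
  let τ : Gal(E/F) := AlgEquiv.ofRingEquiv (f := σ) fun x ↦ (hfix _).2 ⟨x, rfl⟩
  have hτ : ∀ x, τ x = σ x := fun x ↦ rfl
  have hsq : τ ^ 2 = 1 := by
    ext x
    rw [sq]
    exact hσ2 x
  have hbot : IntermediateField.fixedField (Subgroup.zpowers τ) = ⊥ := by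
    refine le_bot_iff.1 fun x hx ↦ ?_
    rw [IntermediateField.mem_fixedField_iff] at hx
    obtain ⟨y, hy⟩ := (hfix x).1 (hx τ (Subgroup.mem_zpowers τ))
    exact IntermediateField.mem_bot.2 ⟨y, hy⟩
  have htop : Subgroup.zpowers τ = ⊤ := by
    rw [← IntermediateField.fixingSubgroup_fixedField (Subgroup.zpowers τ), hbot,
      IntermediateField.fixingSubgroup_bot]
  refine ⟨τ, hτ, IsGalois.of_fixedField_eq_bot F E (htop ▸ hbot), ?_, fun g ↦ ?_⟩
  · rintro h
    exact hσne (RingEquiv.ext fun x ↦ by rw [← hτ, h]; rfl)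
  · obtain ⟨k, rfl⟩ := Subgroup.mem_zpowers_iff.1 (htop ▸ Subgroup.mem_top g)
    rcases Int.even_or_odd' k with ⟨c, rfl | rfl⟩
    · left
      rw [zpow_mul]
      norm_cast
      rw [hsq, one_zpow]
    · right
      rw [zpow_add, zpow_mul, zpow_one]
      norm_cast
      rw [hsq, one_zpow, one_mul]

variable {σ : Gal(E/F)}

theorem univ_gal_eq [DecidableEq Gal(E/F)] (hG : ∀ g : Gal(E/F), g = 1 ∨ g = σ) :
    (Finset.univ : Finset Gal(E/F)) = {1, σ} := by
  ext g
  simpa using hG g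

theorem gal_apply_apply (hσ : σ ≠ 1) (hG : ∀ g : Gal(E/F), g = 1 ∨ g = σ) (x : E) :
    σ (σ x) = x := by
  have h : σ * σ = 1 := by
    rcases hG (σ * σ) with h | h
    · exact h
    · exact (hσ (mul_eq_left.1 h)).elim
  exact AlgEquiv.congr_fun h x

theorem exists_gal_apply_eq_neg (hσ : σ ≠ 1) (hG : ∀ g : Gal(E/F), g = 1 ∨ g = σ) :
    ∃ d : E, d ≠ 0 ∧ σ d = -d := by
  obtain ⟨x, hx⟩ : ∃ x, σ x ≠ x := by
    by_contra! h
    exact hσ (AlgEquiv.ext h)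
  refine ⟨x - σ x, sub_ne_zero.2 hx.symm, ?_⟩
  rw [map_sub, gal_apply_apply hσ hG, neg_sub]

/-- The form `(x, y) ↦ Tr (α x σ(y))`. -/
noncomputable def twistedTrace (σ : Gal(E/F)) (α : F) : E →ₗ[ℚ] E →ₗ[ℚ] ℚ :=
  LinearMap.mk₂ ℚ (fun x y ↦ Algebra.trace ℚ E (algebraMap F E α * x * σ y))
    (fun x x' y ↦ by rw [← map_add]; ring_nf)
    (fun c x y ↦ by
      rw [← map_smul, mul_smul_comm, smul_mul_assoc])
    (fun x y y' ↦ by rw [← map_add, map_add σ]; ring_nf)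
    (fun c x y ↦ by
      rw [show σ (c • y) = c • σ y from map_rat_smul (σ : E →+* E) c y, mul_smul_comm, map_smul])

theorem twistedTrace_apply (α : F) (x y : E) :
    twistedTrace σ α x y = Algebra.trace ℚ E (algebraMap F E α * x * σ y) := rfl

theorem trace_gal_apply (x : E) : Algebra.trace ℚ E (σ x) = Algebra.trace ℚ E x :=
  Algebra.trace_eq_of_algEquiv (σ.restrictScalars ℚ) x

theorem twistedTrace_comm (hσ : σ ≠ 1) (hG : ∀ g : Gal(E/F), g = 1 ∨ g = σ) (α : F) (x y : E) :
    twistedTrace σ α x y = twistedTrace σ α y x := by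
  rw [twistedTrace_apply, twistedTrace_apply, ← trace_gal_apply (σ := σ)]
  simp only [map_mul, AlgEquiv.commutes, gal_apply_apply hσ hG]
  ring_nf

variable [IsGalois F E]

theorem algebraMap_trace_eq_add (hσ : σ ≠ 1) (hG : ∀ g : Gal(E/F), g = 1 ∨ g = σ) (x : E) :
    algebraMap F E (Algebra.trace F E x) = x + σ x := by
  classical
  rw [trace_eq_sum_automorphisms, univ_gal_eq hG, Finset.sum_pair hσ.symm, AlgEquiv.one_apply]

theorem algebraMap_norm_eq_mul (hσ : σ ≠ 1) (hG : ∀ g : Gal(E/F), g = 1 ∨ g = σ) (x : E) :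
    algebraMap F E (Algebra.norm F x) = x * σ x := by
  classical
  rw [Algebra.norm_eq_prod_automorphisms, univ_gal_eq hG, Finset.prod_pair hσ.symm,
    AlgEquiv.one_apply]

theorem finrank_eq_two_of_gal (hσ : σ ≠ 1) (hG : ∀ g : Gal(E/F), g = 1 ∨ g = σ) :
    Module.finrank F E = 2 := by
  classical
  rw [← IsGalois.card_aut_eq_finrank, Nat.card_eq_fintype_card, ← Finset.card_univ, univ_gal_eq hG,
    Finset.card_pair hσ.symm]

theorem trace_algebraMap_mul (a : F) (x : E) :
    Algebra.trace ℚ E (algebraMap F E a * x) = Algebra.trace ℚ F (a * Algebra.trace F E x) := by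
  rw [← Algebra.trace_trace (S := F), ← Algebra.smul_def, map_smul, smul_eq_mul]

theorem trace_algebraMap_eq_two_mul (hσ : σ ≠ 1) (hG : ∀ g : Gal(E/F), g = 1 ∨ g = σ) (a : F) :
    Algebra.trace ℚ E (algebraMap F E a) = 2 * Algebra.trace ℚ F a := by
  rw [← Algebra.trace_trace (S := F), Algebra.trace_algebraMap, finrank_eq_two_of_gal hσ hG,
    map_nsmul, nsmul_eq_mul]
  norm_num

theorem twistedTrace_self (hσ : σ ≠ 1) (hG : ∀ g : Gal(E/F), g = 1 ∨ g = σ) (α : F) (x : E) :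
    twistedTrace σ α x x = 2 * Algebra.trace ℚ F (α * Algebra.norm F x) := by
  rw [twistedTrace_apply, mul_assoc, ← algebraMap_norm_eq_mul hσ hG, ← map_mul,
    trace_algebraMap_eq_two_mul hσ hG]

theorem exists_orthogonal_trace_basis (c : F) :
    ∃ v : Module.Basis (Fin (Module.finrank ℚ F)) ℚ F,
      Pairwise fun i j ↦ Algebra.trace ℚ F (c * (v i * v j)) = 0 := by
  have : Invertible (2 : ℚ) := invertibleOfNonzero two_ne_zero
  let B : LinearMap.BilinForm ℚ F := (Algebra.traceForm ℚ F).compLeft (LinearMap.mulLeft ℚ c)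
  have hB : ∀ x y, B x y = Algebra.trace ℚ F (c * (x * y)) := fun x y ↦ by
    simp [B, Algebra.traceForm_apply, mul_assoc]
  obtain ⟨v, hv⟩ := LinearMap.BilinForm.exists_orthogonal_basis (B := B)
    ⟨fun x y ↦ by simp only [hB, RingHom.id_apply, mul_comm x y]⟩
  exact ⟨v, fun i j hij ↦ (hB _ _).symm.trans (hv hij)⟩

/-- A lattice in `E` contains an orthogonal basis, whose signature is computed by the signs of `α`
at the real embeddings of `F`. -/
theorem exists_orthogonal_basis_mem (hσ : σ ≠ 1) (hG : ∀ g : Gal(E/F), g = 1 ∨ g = σ) {α : F}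
    (hα : α ≠ 0) {d : E} (hd : d ≠ 0) (hσd : σ d = -d) {M : AddSubgroup E}
    (hM : ∀ x ∈ M, ∃ z : ℤ, twistedTrace σ α x x = 2 * z)
    (hMspan : ∀ x, ∃ N : ℤ, N ≠ 0 ∧ N • x ∈ M) :
    ∃ (e : Module.Basis (Fin (Module.finrank ℚ F) ⊕ Fin (Module.finrank ℚ F)) ℚ E)
      (n : Fin (Module.finrank ℚ F) ⊕ Fin (Module.finrank ℚ F) → ℤ), (∀ i, e i ∈ M) ∧
      (∀ i j, i ≠ j → twistedTrace σ α (e i) (e j) = 0) ∧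
      (∀ i, twistedTrace σ α (e i) (e i) = 2 * n i) ∧ (∀ i, n i ≠ 0) ∧
      ∑ i, (SignType.sign (n i) : ℤ) = ∑ τ : F →+* ℝ,
        ((SignType.sign (τ α) : ℤ) + SignType.sign (τ (α * Algebra.norm F d))) := by
  have hNd : Algebra.norm F d ≠ 0 := Algebra.norm_ne_zero_iff.2 hd
  obtain ⟨v, hv⟩ := exists_orthogonal_trace_basis α
  obtain ⟨w, hw⟩ := exists_orthogonal_trace_basis (α * Algebra.norm F d)
  obtain ⟨hv0, hvs⟩ := sum_sign_trace_eq hα v hv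
  obtain ⟨hw0, hws⟩ := sum_sign_trace_eq (mul_ne_zero hα hNd) w hw
  let f : Fin (Module.finrank ℚ F) ⊕ Fin (Module.finrank ℚ F) → E :=
    Sum.elim (fun i ↦ algebraMap F E (v i)) fun j ↦ d * algebraMap F E (w j)
  have hvv (x y : F) : twistedTrace σ α (algebraMap F E x) (algebraMap F E y) =
      2 * Algebra.trace ℚ F (α * (x * y)) := by
    rw [twistedTrace_apply, AlgEquiv.commutes, ← map_mul, ← map_mul,
      trace_algebraMap_eq_two_mul hσ hG, mul_assoc]
  have hww (x y : F) : twistedTrace σ α (d * algebraMap F E x) (d * algebraMap F E y) =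
      2 * Algebra.trace ℚ F (α * Algebra.norm F d * (x * y)) := by
    rw [← trace_algebraMap_eq_two_mul hσ hG, twistedTrace_apply, map_mul σ, AlgEquiv.commutes]
    simp only [map_mul, algebraMap_norm_eq_mul hσ hG]
    ring_nf
  have hvw (x y : F) : twistedTrace σ α (algebraMap F E x) (d * algebraMap F E y) = 0 := by
    have h := trace_gal_apply (σ := σ) (algebraMap F E α * algebraMap F E x *
      σ (d * algebraMap F E y))
    simp only [map_mul, AlgEquiv.commutes, hσd, map_neg] at h
    rw [twistedTrace_apply, map_mul σ, AlgEquiv.commutes, hσd]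
    simp only [neg_mul, mul_neg, map_neg, neg_neg] at h ⊢
    linarith
  have hforth : ∀ i j, i ≠ j → twistedTrace σ α (f i) (f j) = 0 := by
    rintro (i | i) (j | j) hij
    · exact (hvv _ _).trans (by rw [hv fun h ↦ hij (congrArg _ h), mul_zero])
    · exact hvw _ _
    · exact (twistedTrace_comm hσ hG _ _ _).trans (hvw _ _)
    · exact (hww _ _).trans (by rw [hw fun h ↦ hij (congrArg _ h), mul_zero])
  choose N hN0 hN using fun i ↦ hMspan (f i)
  choose n hn using fun i ↦ hM _ (hN i)
  have hNn : ∀ i, (2 * n i : ℚ) = N i ^ 2 * twistedTrace σ α (f i) (f i) := by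
    intro i
    rw [← hn, ← Int.cast_smul_eq_zsmul ℚ]
    simp only [map_smul, LinearMap.smul_apply, smul_eq_mul]
    ring
  have hN2 : ∀ i, (0 : ℚ) < N i ^ 2 := fun i ↦ by
    have := hN0 i
    positivity
  have hsgn : ∀ i, SignType.sign (n i) = SignType.sign (twistedTrace σ α (f i) (f i) / 2) := by
    intro i
    have : (n i : ℚ) = N i ^ 2 * (twistedTrace σ α (f i) (f i) / 2) := by
      linarith [hNn i]
    have h2 := congrArg SignType.sign this
    rw [sign_mul, sign_pos (hN2 i), one_mul] at h2
    rw [← h2]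
    rcases lt_trichotomy (n i) 0 with h | h | h
    · rw [sign_neg h, sign_neg (by exact_mod_cast h)]
    · simp [h]
    · rw [sign_pos h, sign_pos (by exact_mod_cast h)]
  have hinl : ∀ i, twistedTrace σ α (f (Sum.inl i)) (f (Sum.inl i)) / 2 =
      Algebra.trace ℚ F (α * (v i * v i)) := fun i ↦ by
    rw [div_eq_iff two_ne_zero, mul_comm _ (2 : ℚ)]
    exact hvv _ _
  have hinr : ∀ i, twistedTrace σ α (f (Sum.inr i)) (f (Sum.inr i)) / 2 =
      Algebra.trace ℚ F (α * Algebra.norm F d * (w i * w i)) := fun i ↦ by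
    rw [div_eq_iff two_ne_zero, mul_comm _ (2 : ℚ)]
    exact hww _ _
  have hn0 : ∀ i, n i ≠ 0 := fun i ↦ by
    rw [← sign_ne_zero, hsgn, sign_ne_zero]
    rcases i with i | i
    · rw [hinl]
      exact hv0 i
    · rw [hinr]
      exact hw0 i
  have horth : ∀ i j, i ≠ j → twistedTrace σ α (N i • f i) (N j • f j) = 0 := fun i j hij ↦ by
    rw [map_zsmul, map_zsmul, LinearMap.smul_apply, hforth i j hij, smul_zero, smul_zero]
  have hcard : Fintype.card (Fin (Module.finrank ℚ F) ⊕ Fin (Module.finrank ℚ F)) =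
      Module.finrank ℚ E := by
    rw [Fintype.card_sum, Fintype.card_fin, ← Module.finrank_mul_finrank ℚ F E,
      finrank_eq_two_of_gal hσ hG, mul_two]
  have hlin : LinearIndependent ℚ fun i ↦ N i • f i :=
    LinearMap.linearIndependent_of_isOrthoᵢ (B := twistedTrace σ α)
      (fun i j hij ↦ horth i j hij) fun i ↦ by
        rw [hn]
        exact mul_ne_zero two_ne_zero (by exact_mod_cast hn0 i)
  have : Nonempty (Fin (Module.finrank ℚ F) ⊕ Fin (Module.finrank ℚ F)) :=
    ⟨Sum.inl ⟨0, Module.finrank_pos⟩⟩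
  refine ⟨basisOfLinearIndependentOfCardEqFinrank hlin hcard, n, ?_, ?_, ?_, hn0, ?_⟩
  · simpa using hN
  · simpa only [coe_basisOfLinearIndependentOfCardEqFinrank] using horth
  · simpa only [coe_basisOfLinearIndependentOfCardEqFinrank] using hn
  · rw [Fintype.sum_sum_type, Finset.sum_add_distrib, ← hvs, ← hws]
    simp only [hsgn, hinl, hinr]

theorem exists_comp_algebraMap_eq_iff (hσ : σ ≠ 1) (hG : ∀ g : Gal(E/F), g = 1 ∨ g = σ) {d : E}
    (hd : d ≠ 0) (hσd : σ d = -d) (τ : F →+* ℝ) :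
    (∃ τ' : E →+* ℝ, τ'.comp (algebraMap F E) = τ) ↔ τ (Algebra.norm F d) < 0 := by
  have hd2 : algebraMap F E (Algebra.norm F d) = -(d ^ 2) := by
    rw [algebraMap_norm_eq_mul hσ hG, hσd]
    ring
  constructor
  · rintro ⟨τ', rfl⟩
    rw [RingHom.comp_apply, hd2, map_neg, map_pow, neg_lt_zero]
    exact pow_two_pos_of_ne_zero ((map_ne_zero τ').2 hd)
  · intro hneg
    let φ : E →+* ℂ := ComplexEmbedding.lift E (Complex.ofRealHom.comp τ)
    have hφ : ∀ x, φ (algebraMap F E x) = τ x := fun x ↦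
      ComplexEmbedding.lift_algebraMap_apply E (Complex.ofRealHom.comp τ) x
    have hφd : starRingEnd ℂ (φ d) = φ d := by
      have h1 : φ d ^ 2 = (√(-τ (Algebra.norm F d)) : ℝ) ^ 2 := by
        rw [← Complex.ofReal_pow, Real.sq_sqrt (by linarith), Complex.ofReal_neg, ← hφ, hd2,
          map_neg, map_pow, neg_neg]
      rcases sq_eq_sq_iff_eq_or_eq_neg.1 h1 with h | h <;> rw [h] <;> simp
    have hdecomp : ∀ x, x = algebraMap F E (Algebra.trace F E x / 2) +
        algebraMap F E (Algebra.trace F E (x / d) / 2) * d := by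
      intro x
      rw [map_div₀, map_div₀, algebraMap_trace_eq_add hσ hG, algebraMap_trace_eq_add hσ hG,
        map_div₀, hσd, map_ofNat]
      field_simp
      ring
    have hreal : ComplexEmbedding.IsReal φ := by
      rw [ComplexEmbedding.isReal_iff]
      ext x
      rw [ComplexEmbedding.conjugate_coe_eq, hdecomp x, map_add, map_mul, hφ, hφ]
      simp [hφd]
    refine ⟨hreal.embedding, RingHom.ext fun x ↦ Complex.ofReal_injective ?_⟩
    rw [RingHom.comp_apply, ComplexEmbedding.IsReal.coe_embedding_apply, hφ]

theorem sum_sign_add_sign_eq (hσ : σ ≠ 1) (hG : ∀ g : Gal(E/F), g = 1 ∨ g = σ) {α : F}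
    (hα : α ≠ 0) {d : E} (hd : d ≠ 0) (hσd : σ d = -d) :
    ∑ τ : F →+* ℝ, ((SignType.sign (τ α) : ℤ) + SignType.sign (τ (α * Algebra.norm F d))) =
      2 * (Nat.card {τ : F →+* ℝ // ¬∃ τ' : E →+* ℝ, τ'.comp (algebraMap F E) = τ} : ℤ) -
      4 * (Nat.card {τ : F →+* ℝ //
        (¬∃ τ' : E →+* ℝ, τ'.comp (algebraMap F E) = τ) ∧ τ α < 0} : ℤ) := by
  classical
  have hNd : Algebra.norm F d ≠ 0 := Algebra.norm_ne_zero_iff.2 hd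
  simp only [exists_comp_algebraMap_eq_iff hσ hG hd hσd, Nat.card_eq_fintype_card,
    Fintype.card_subtype, Finset.card_filter]
  push_cast
  rw [Finset.mul_sum, Finset.mul_sum, ← Finset.sum_sub_distrib]
  refine Finset.sum_congr rfl fun τ _ ↦ ?_
  rw [map_mul, sign_mul]
  rcases lt_or_gt_of_ne ((map_ne_zero τ).2 hNd) with h | h <;>
    rcases lt_or_gt_of_ne ((map_ne_zero τ).2 hα) with h' | h' <;>
    simp [h, h', h.not_gt, h'.not_gt]

end QuadraticTraceForm

section FiniteFieldNorm

variable (K K' : Type*) [Field K] [Field K'] [Algebra K K'] [Fintype K']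

theorem card_filter_unitsMap_norm_eq [DecidableEq K] [DecidableEq K'] (u : Kˣ) :
    (Finset.univ.filter fun x : K'ˣ ↦ Units.map (Algebra.norm K (S := K')) x = u).card =
      Nat.card (Units.map (Algebra.norm K (S := K'))).ker := by
  classical
  obtain ⟨x₀, hx₀⟩ := FiniteField.unitsMap_norm_surjective K K' u
  rw [← Fintype.card_subtype, ← Nat.card_eq_fintype_card]
  refine (Nat.card_congr (Equiv.subtypeEquiv (Equiv.mulLeft x₀) fun x ↦ ?_)).symm
  rw [Equiv.coe_mulLeft, map_mul, hx₀, mul_eq_left, MonoidHom.mem_ker]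

/-- The sum of a nontrivial additive character over the norms from a proper extension of finite
fields is a negative integer. -/
theorem exists_sum_addChar_norm_eq_neg [Fintype K] (ψ : AddChar K ℂ) (hψ : ψ ≠ 0)
    (hKK' : Module.finrank K K' = 2) :
    ∃ r : ℝ, r < 0 ∧ ∑ y : K', ψ (Algebra.norm K y) = r := by
  classical
  set c := Nat.card (Units.map (Algebra.norm K (S := K'))).ker with hc
  have hsum : ∑ y : K', ψ (Algebra.norm K y) = 1 + c * ∑ u : Kˣ, ψ u := by
    have h0 : ∑ y : K', ψ (Algebra.norm K y) =
        ψ (Algebra.norm K (0 : K')) + ∑ x : K'ˣ, ψ (Algebra.norm K (x : K')) := by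
      rw [← Finset.add_sum_erase _ _ (Finset.mem_univ (0 : K'))]
      congr 1
      refine (Finset.sum_bij (fun (x : K'ˣ) _ ↦ (x : K')) (by simp) ?_ ?_ ?_).symm
      · exact fun a _ b _ h ↦ Units.ext h
      · exact fun b hb ↦ ⟨Units.mk0 b (by simpa using hb), by simp, rfl⟩
      · exact fun _ _ ↦ rfl
    have : Nontrivial K' := inferInstance
    rw [h0, Algebra.norm_zero, AddChar.map_zero_eq_one]
    congr 1
    rw [← Finset.sum_fiberwise (s := Finset.univ)
      (g := fun x : K'ˣ ↦ Units.map (Algebra.norm K (S := K')) x), Finset.mul_sum]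
    refine Finset.sum_congr rfl fun u _ ↦ ?_
    rw [Finset.sum_congr rfl (g := fun _ ↦ ψ u), Finset.sum_const,
      card_filter_unitsMap_norm_eq, nsmul_eq_mul]
    intro x hx
    rw [← (Finset.mem_filter.1 hx).2, Units.coe_map]
  have hunits : ∑ u : Kˣ, ψ u = -1 := by
    have h1 := AddChar.sum_eq_zero_of_ne_one hψ
    rw [← Finset.add_sum_erase _ _ (Finset.mem_univ (0 : K)), AddChar.map_zero_eq_one] at h1
    refine Eq.trans ?_ (neg_eq_of_add_eq_zero_right h1).symm
    refine Finset.sum_bij (fun (x : Kˣ) _ ↦ (x : K)) (by simp) ?_ ?_ ?_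
    · exact fun a _ b _ h ↦ Units.ext h
    · exact fun b hb ↦ ⟨Units.mk0 b (by simpa using hb), by simp, rfl⟩
    · exact fun _ _ ↦ rfl
  have hc1 : 1 < c := by
    have hmul := Subgroup.card_mul_index (Units.map (Algebra.norm K (S := K'))).ker
    rw [Subgroup.index_ker, MonoidHom.range_eq_top.2 (FiniteField.unitsMap_norm_surjective K K'),
      Subgroup.card_top, ← hc, Nat.card_units, Nat.card_units, Nat.card_eq_fintype_card,
      Nat.card_eq_fintype_card, Module.card_eq_pow_finrank (K := K) (V := K'), hKK'] at hmul
    have hq := Fintype.one_lt_card (α := K)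
    obtain ⟨t, ht⟩ : ∃ t, Fintype.card K = t + 2 := ⟨Fintype.card K - 2, by omega⟩
    rw [ht] at hmul
    have h2 : (t + 2) ^ 2 - 1 = (t + 3) * (t + 1) := by
      rw [Nat.sub_eq_iff_eq_add (Nat.one_le_pow _ _ (by omega))]
      ring
    rw [h2, show t + 2 - 1 = t + 1 by omega] at hmul
    have := Nat.eq_of_mul_eq_mul_right (by omega) hmul
    omega
  refine ⟨1 - c, ?_, ?_⟩
  · have : (1 : ℝ) < c := by exact_mod_cast hc1
    linarith
  · rw [hsum, hunits]
    push_cast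
    ring

end FiniteFieldNorm

section UnramifiedPrimes

open scoped Pointwise

set_option linter.unusedSectionVars false

variable {E F : Type*} [Field E] [NumberField E] [Field F] [NumberField F] [Algebra F E]
  {σ : Gal(E/F)}

theorem coe_gal_smul (g : Gal(E/F)) (x : 𝓞 E) : ((g • x : 𝓞 E) : E) = g x := rfl

theorem gal_smul_algebraMap (g : Gal(E/F)) (r : 𝓞 F) :
    g • algebraMap (𝓞 F) (𝓞 E) r = algebraMap (𝓞 F) (𝓞 E) r := by
  apply RingOfIntegers.ext
  rw [coe_gal_smul]
  exact g.commutes r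

theorem gal_smul_map_algebraMap (g : Gal(E/F)) (v : Ideal (𝓞 F)) :
    g • v.map (algebraMap (𝓞 F) (𝓞 E)) = v.map (algebraMap (𝓞 F) (𝓞 E)) := by
  rw [Ideal.pointwise_smul_def, Ideal.map_map]
  congr 1
  ext r
  exact congrArg _ (gal_smul_algebraMap g r)

variable [IsGalois F E]

theorem card_gal_eq_two (hσ : σ ≠ 1) (hG : ∀ g : Gal(E/F), g = 1 ∨ g = σ) :
    Nat.card Gal(E/F) = 2 := by
  rw [IsGalois.card_aut_eq_finrank, finrank_eq_two_of_gal hσ hG]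

theorem map_under_eq_and_finrank_eq_two (hσ : σ ≠ 1) (hG : ∀ g : Gal(E/F), g = 1 ∨ g = σ)
    (hunram : ∀ v : Ideal (𝓞 F), v.IsPrime → v ≠ ⊥ →
      ¬∃ P : Ideal (𝓞 E), P.IsPrime ∧ Ideal.map (algebraMap (𝓞 F) (𝓞 E)) v = P ^ 2)
    {P : Ideal (𝓞 E)} (hP : P.IsPrime) (hP0 : P ≠ ⊥) (hσP : σ • P = P) :
    (P.under (𝓞 F)).map (algebraMap (𝓞 F) (𝓞 E)) = P ∧
      Module.finrank (𝓞 F ⧸ P.under (𝓞 F)) (𝓞 E ⧸ P) = 2 := by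
  have hv0 : P.under (𝓞 F) ≠ ⊥ := Ideal.under_ne_bot _ hP0
  have hPm : P.IsMaximal := hP.isMaximal hP0
  have hvp : (P.under (𝓞 F)).IsPrime := inferInstance
  have hvm : (P.under (𝓞 F)).IsMaximal := hvp.isMaximal hv0
  set v := P.under (𝓞 F) with hv
  have hlies : P.LiesOver v := ⟨rfl⟩
  have hover : v.primesOver (𝓞 E) = {P} := by
    refine Set.eq_singleton_iff_unique_mem.2 ⟨⟨hP, hlies⟩, ?_⟩
    rintro Q ⟨hQ, hQv⟩
    obtain ⟨g, rfl⟩ := Ideal.exists_smul_eq_of_isGaloisGroup v P Q Gal(E/F)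
    rcases hG g with rfl | rfl
    · exact one_smul _ _
    · exact hσP
  have hcount := Ideal.ncard_primesOver_mul_ramificationIdxIn_mul_inertiaDegIn v (𝓞 E) Gal(E/F)
  rw [hover, Set.ncard_singleton, one_mul, card_gal_eq_two hσ hG,
    Ideal.ramificationIdxIn_eq_ramificationIdx v P Gal(E/F),
    Ideal.inertiaDegIn_eq_inertiaDeg v P Gal(E/F)] at hcount
  have hmap : v.map (algebraMap (𝓞 F) (𝓞 E)) = P ^ P.ramificationIdx (𝓞 F) := by
    rw [Ideal.map_algebraMap_eq_finsetProd_pow hv0]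
    simp [hover]
  have he2 : P.ramificationIdx (𝓞 F) ≠ 2 := fun h ↦ hunram v hvp hv0 ⟨P, hP, h ▸ hmap⟩
  have he1 : P.ramificationIdx (𝓞 F) = 1 :=
    ((Nat.dvd_prime Nat.prime_two).1 ⟨_, hcount.symm⟩).resolve_right he2
  rw [he1, pow_one] at hmap
  rw [he1, one_mul] at hcount
  exact ⟨hmap, by rw [← Ideal.inertiaDeg_eq_of_isMaximal v P, hcount]⟩

theorem gal_smul_sub_pow_card_mem (hσ : σ ≠ 1) (hG : ∀ g : Gal(E/F), g = 1 ∨ g = σ)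
    (hunram : ∀ v : Ideal (𝓞 F), v.IsPrime → v ≠ ⊥ →
      ¬∃ P : Ideal (𝓞 E), P.IsPrime ∧ Ideal.map (algebraMap (𝓞 F) (𝓞 E)) v = P ^ 2)
    {P : Ideal (𝓞 E)} (hP : P.IsPrime) (hP0 : P ≠ ⊥) (hσP : σ • P = P) :
    (∀ y : 𝓞 E, σ • y - y ^ Nat.card (𝓞 F ⧸ P.under (𝓞 F)) ∈ P) ∧
      ∃ y : 𝓞 E, σ • y - y ∉ P := by
  have hfr := (map_under_eq_and_finrank_eq_two hσ hG hunram hP hP0 hσP).2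
  have hPm : P.IsMaximal := hP.isMaximal hP0
  have hvm : (P.under (𝓞 F)).IsMaximal :=
    Ideal.IsPrime.isMaximal inferInstance (Ideal.under_ne_bot _ hP0)
  let _ : Field (𝓞 E ⧸ P) := Ideal.Quotient.field P
  let _ : Field (𝓞 F ⧸ P.under (𝓞 F)) := Ideal.Quotient.field _
  have hfin : Finite (𝓞 E ⧸ P) := Ideal.finiteQuotientOfFreeOfNeBot P hP0
  have hfinv : Finite (𝓞 F ⧸ P.under (𝓞 F)) :=
    Ideal.finiteQuotientOfFreeOfNeBot _ (Ideal.under_ne_bot _ hP0)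
  set q := Nat.card (𝓞 F ⧸ P.under (𝓞 F)) with hq
  have hq1 : 1 < q := Finite.one_lt_card
  have hcard : Nat.card (𝓞 E ⧸ P) = q ^ 2 := by
    rw [Module.natCard_eq_pow_finrank (K := 𝓞 F ⧸ P.under (𝓞 F)), hfr]
  obtain ⟨y, hy⟩ : ∃ y : 𝓞 E, y - y ^ q ∉ P := by
    by_contra! h
    have hroot : ∀ x : 𝓞 E ⧸ P, x ^ q = x := by
      intro x
      obtain ⟨y, rfl⟩ := Ideal.Quotient.mk_surjective x
      rw [← map_pow]
      exact ((Ideal.Quotient.eq).2 (h y)).symm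
    have _ : Fintype (𝓞 E ⧸ P) := Fintype.ofFinite _
    have hne : (Polynomial.X ^ q - Polynomial.X : Polynomial (𝓞 E ⧸ P)) ≠ 0 :=
      FiniteField.X_pow_card_sub_X_ne_zero _ hq1
    have hle := Polynomial.card_le_degree_of_subset_roots
      (Z := (Finset.univ : Finset (𝓞 E ⧸ P)))
      (p := Polynomial.X ^ q - Polynomial.X) fun x _ ↦ by
        rw [Polynomial.mem_roots hne]
        simp [hroot x]
    rw [FiniteField.X_pow_card_sub_X_natDegree_eq _ hq1, Finset.card_univ,
      ← Nat.card_eq_fintype_card, hcard] at hle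
    nlinarith
  obtain ⟨g, hg⟩ := IsArithFrobAt.exists_of_isInvariant (𝓞 F) Gal(E/F) P
  rcases hG g with rfl | rfl
  · exact (hy (by simpa using hg y)).elim
  · refine ⟨fun y ↦ hg y, y, fun h ↦ hy ?_⟩
    simpa using P.sub_mem (hg y) h

theorem algebraMap_intTrace_eq_add (hσ : σ ≠ 1) (hG : ∀ g : Gal(E/F), g = 1 ∨ g = σ) (y : 𝓞 E) :
    algebraMap (𝓞 F) (𝓞 E) (Algebra.intTrace (𝓞 F) (𝓞 E) y) = y + σ • y := by
  apply RingOfIntegers.ext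
  change algebraMap F E (algebraMap (𝓞 F) F _) = (y : E) + σ y
  rw [Algebra.algebraMap_intTrace (K := F) (L := E), algebraMap_trace_eq_add hσ hG]

/-- In an unramified quadratic extension some integer has trace one. -/
theorem exists_add_gal_smul_eq_one (hσ : σ ≠ 1) (hG : ∀ g : Gal(E/F), g = 1 ∨ g = σ)
    (hunram : ∀ v : Ideal (𝓞 F), v.IsPrime → v ≠ ⊥ →
      ¬∃ P : Ideal (𝓞 E), P.IsPrime ∧ Ideal.map (algebraMap (𝓞 F) (𝓞 E)) v = P ^ 2) :
    ∃ y : 𝓞 E, y + σ • y = 1 := by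
  obtain ⟨y, hy⟩ : ∃ y, Algebra.intTrace (𝓞 F) (𝓞 E) y = 1 := by
    by_contra! hne
    have htop : Ideal.span (Set.range (Algebra.intTrace (𝓞 F) (𝓞 E))) ≠ ⊤ := by
      rw [Ideal.ne_top_iff_one]
      intro h
      rw [← LinearMap.coe_range, Ideal.span, Submodule.span_eq] at h
      obtain ⟨y, hy⟩ := h
      exact hne y hy
    obtain ⟨v, hvm, hv⟩ := Ideal.exists_le_maximal _ htop
    have hv' : ∀ y, Algebra.intTrace (𝓞 F) (𝓞 E) y ∈ v := fun y ↦ hv (Ideal.subset_span ⟨y, rfl⟩)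
    obtain ⟨P, hPm, hPv⟩ := Ideal.exists_maximal_ideal_liesOver_of_isIntegral (S := 𝓞 E) v
    have hP0 : P ≠ ⊥ := Ring.ne_bot_of_isMaximal_of_not_isField hPm (RingOfIntegers.not_isField E)
    have hP : ∀ y : 𝓞 E, y + σ • y ∈ P := fun y ↦ by
      have := hPv.over ▸ hv' y
      rwa [Ideal.mem_comap, algebraMap_intTrace_eq_add hσ hG] at this
    by_cases hσP : σ • P = P
    · obtain ⟨y, hy⟩ := (gal_smul_sub_pow_card_mem hσ hG hunram hPm.isPrime hP0 hσP).2
      have h1 := hP 1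
      rw [smul_one] at h1
      refine hy ?_
      convert P.sub_mem (hP y) (P.mul_mem_right y h1) using 1
      ring
    · have hle : ¬P ≤ σ • P := fun h ↦ hσP (hPm.eq_of_le (by
        rw [Ne, Ideal.eq_top_iff_one, Ideal.mem_pointwise_smul_iff_inv_smul_mem, smul_one]
        exact (Ideal.ne_top_iff_one P).1 hPm.ne_top) h).symm
      obtain ⟨y, hyP, hy⟩ := SetLike.not_le_iff_exists.1 hle
      have h2 := hP (σ⁻¹ • y)
      rw [smul_inv_smul] at h2
      refine hy (Ideal.mem_pointwise_smul_iff_inv_smul_mem.2 ?_)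
      simpa using P.sub_mem h2 hyP
  exact ⟨y, by rw [← algebraMap_intTrace_eq_add hσ hG, hy, map_one]⟩

end UnramifiedPrimes

section ConjugateFractionalIdeals

open scoped Pointwise

set_option linter.unusedSectionVars false

variable {E F : Type*} [Field E] [NumberField E] [Field F] [NumberField F] [Algebra F E]

/-- The action of an automorphism on the fractional ideals of a number field. -/
noncomputable def galConj (σ : Gal(E/F)) :
    FractionalIdeal (𝓞 E)⁰ E ≃+* FractionalIdeal (𝓞 E)⁰ E :=
  ringEquivOfRingEquiv E E (MulSemiringAction.toRingEquiv Gal(E/F) (𝓞 E) σ)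

variable {σ : Gal(E/F)}

theorem mem_galConj {I : FractionalIdeal (𝓞 E)⁰ E} {x : E} :
    x ∈ galConj σ I ↔ ∃ y ∈ I, σ y = x := by
  have h : ∀ y : E, IsFractionRing.ringEquivOfRingEquiv (K := E) (L := E)
      (MulSemiringAction.toRingEquiv Gal(E/F) (𝓞 E) σ) y = σ y := by
    refine RingHom.congr_fun (f := (IsFractionRing.ringEquivOfRingEquiv (K := E) (L := E)
      (MulSemiringAction.toRingEquiv Gal(E/F) (𝓞 E) σ) : E →+* E)) (g := (σ : E →+* E)) ?_
    refine IsFractionRing.ringHom_ext (A := 𝓞 E) fun a ↦ ?_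
    simp only [RingHom.coe_coe, IsFractionRing.ringEquivOfRingEquiv_algebraMap]
    exact coe_gal_smul σ a
  constructor
  · rintro ⟨y, hy, rfl⟩
    exact ⟨y, hy, (h y).symm⟩
  · rintro ⟨y, hy, rfl⟩
    exact ⟨y, hy, h y⟩

theorem galConj_coeIdeal (J : Ideal (𝓞 E)) :
    galConj σ (J : FractionalIdeal (𝓞 E)⁰ E) = (σ • J : Ideal (𝓞 E)) := by
  ext x
  rw [mem_galConj, mem_coeIdeal]
  constructor
  · rintro ⟨y, hy, rfl⟩
    obtain ⟨a, ha, rfl⟩ := (mem_coeIdeal _).1 hy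
    exact ⟨σ • a, Ideal.smul_mem_pointwise_smul σ a J ha, coe_gal_smul σ a⟩
  · rintro ⟨a, ha, rfl⟩
    refine ⟨_, (mem_coeIdeal _).2 ⟨σ⁻¹ • a, Ideal.mem_pointwise_smul_iff_inv_smul_mem.1 ha,
      rfl⟩, ?_⟩
    change ((σ • σ⁻¹ • a : 𝓞 E) : E) = a
    rw [smul_inv_smul]

theorem galConj_galConj (hσ : σ ≠ 1) (hG : ∀ g : Gal(E/F), g = 1 ∨ g = σ)
    (I : FractionalIdeal (𝓞 E)⁰ E) : galConj σ (galConj σ I) = I := by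
  ext x
  simp only [mem_galConj]
  constructor
  · rintro ⟨_, ⟨y, hy, rfl⟩, rfl⟩
    rwa [gal_apply_apply hσ hG]
  · exact fun hx ↦ ⟨σ x, ⟨x, hx, rfl⟩, gal_apply_apply hσ hG x⟩

theorem galConj_ne_zero {I : FractionalIdeal (𝓞 E)⁰ E} (hI : I ≠ 0) : galConj σ I ≠ 0 :=
  (map_ne_zero_iff _ (galConj σ).injective).2 hI

theorem galConj_spanSingleton_algebraMap (α : F) :
    galConj σ (spanSingleton (𝓞 E)⁰ (algebraMap F E α)) =
      spanSingleton (𝓞 E)⁰ (algebraMap F E α) := by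
  ext x
  simp only [mem_galConj, mem_spanSingleton]
  constructor
  · rintro ⟨_, ⟨z, rfl⟩, rfl⟩
    refine ⟨σ • z, ?_⟩
    rw [Algebra.smul_def, Algebra.smul_def, map_mul, σ.commutes]
    rfl
  · rintro ⟨z, rfl⟩
    refine ⟨_, ⟨σ⁻¹ • z, rfl⟩, ?_⟩
    rw [Algebra.smul_def, Algebra.smul_def, map_mul, σ.commutes]
    congr 1
    change ((σ • σ⁻¹ • z : 𝓞 E) : E) = z
    rw [smul_inv_smul]

theorem galConj_dual_one :
    galConj σ (dual ℤ ℚ (1 : FractionalIdeal (𝓞 E)⁰ E)) = dual ℤ ℚ 1 := by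
  have hle : ∀ g : Gal(E/F), ∀ x ∈ dual ℤ ℚ (1 : FractionalIdeal (𝓞 E)⁰ E),
      g x ∈ dual ℤ ℚ (1 : FractionalIdeal (𝓞 E)⁰ E) := by
    intro g x hx
    rw [mem_dual (A := ℤ) (K := ℚ) (B := 𝓞 E) (L := E) one_ne_zero] at hx ⊢
    intro a ha
    obtain ⟨b, rfl⟩ := (mem_one_iff _).1 ha
    convert hx ((g⁻¹ • b : 𝓞 E) : E) ((mem_one_iff _).2 ⟨_, rfl⟩) using 1
    have hgb : (b : E) = g ((g⁻¹ • b : 𝓞 E) : E) := by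
      change (b : E) = ((g • g⁻¹ • b : 𝓞 E) : E)
      rw [smul_inv_smul]
    rw [Algebra.traceForm_apply, Algebra.traceForm_apply, ← trace_gal_apply (σ := g) (x * _),
      map_mul g, ← hgb]
  ext x
  rw [mem_galConj]
  constructor
  · rintro ⟨y, hy, rfl⟩
    exact hle σ y hy
  · exact fun hx ↦ ⟨σ⁻¹ x, hle _ x hx, AlgEquiv.apply_symm_apply σ x⟩

theorem galConj_differentIdeal :
    galConj σ (differentIdeal ℤ (𝓞 E) : FractionalIdeal (𝓞 E)⁰ E) = differentIdeal ℤ (𝓞 E) := by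
  rw [coeIdeal_differentIdeal ℤ ℚ E (𝓞 E), map_inv₀, galConj_dual_one]

/-- The discriminant ideal `α I σ(J) 𝔡` of the pairing `(x, y) ↦ Tr (α x σ(y))` on `I × J`. -/
noncomputable def discrIdeal (σ : Gal(E/F)) (α : F) (I J : FractionalIdeal (𝓞 E)⁰ E) :
    FractionalIdeal (𝓞 E)⁰ E :=
  spanSingleton (𝓞 E)⁰ (algebraMap F E α) * I * galConj σ J *
    (differentIdeal ℤ (𝓞 E) : FractionalIdeal (𝓞 E)⁰ E)

theorem coeIdeal_differentIdeal_ne_zero :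
    (differentIdeal ℤ (𝓞 E) : FractionalIdeal (𝓞 E)⁰ E) ≠ 0 := by
  rw [coeIdeal_differentIdeal ℤ ℚ E (𝓞 E)]
  exact inv_ne_zero (dual_ne_zero ℤ ℚ one_ne_zero)

theorem discrIdeal_mul_mul (α : F) (I J A B : FractionalIdeal (𝓞 E)⁰ E) :
    discrIdeal σ α (A * I) (B * J) = A * galConj σ B * discrIdeal σ α I J := by
  rw [discrIdeal, discrIdeal, map_mul]
  ring

theorem discrIdeal_ne_zero {α : F} (hα : α ≠ 0) {I J : FractionalIdeal (𝓞 E)⁰ E} (hI : I ≠ 0)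
    (hJ : J ≠ 0) : discrIdeal σ α I J ≠ 0 := by
  refine mul_ne_zero (mul_ne_zero (mul_ne_zero ?_ hI) (galConj_ne_zero hJ))
    coeIdeal_differentIdeal_ne_zero
  rwa [spanSingleton_ne_zero_iff, _root_.map_ne_zero]

theorem galConj_discrIdeal (hσ : σ ≠ 1) (hG : ∀ g : Gal(E/F), g = 1 ∨ g = σ) (α : F)
    (I : FractionalIdeal (𝓞 E)⁰ E) : galConj σ (discrIdeal σ α I I) = discrIdeal σ α I I := by
  rw [discrIdeal, map_mul, map_mul, map_mul, galConj_galConj hσ hG, galConj_differentIdeal,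
    galConj_spanSingleton_algebraMap]
  ring

/-- The dual lattice of `I` for the form `(x, y) ↦ Tr (α x σ(y))`. -/
theorem forall_twistedTrace_mem_iff {α : F} (hα : α ≠ 0) {I : FractionalIdeal (𝓞 E)⁰ E}
    (hI : I ≠ 0) (x : E) : (∀ y ∈ I, ∃ z : ℤ, twistedTrace σ α x y = z) ↔
      x ∈ (discrIdeal σ α I I)⁻¹ * I := by
  have h1 : (∀ y ∈ I, ∃ z : ℤ, twistedTrace σ α x y = z) ↔
      algebraMap F E α * x ∈ dual ℤ ℚ (galConj σ I) := by
    rw [mem_dual (galConj_ne_zero hI)]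
    constructor
    · intro h a ha
      obtain ⟨y, hy, rfl⟩ := mem_galConj.1 ha
      obtain ⟨z, hz⟩ := h y hy
      exact ⟨z, hz.symm⟩
    · intro h y hy
      obtain ⟨z, hz⟩ := h (σ y) (mem_galConj.2 ⟨y, hy, rfl⟩)
      exact ⟨z, hz.symm⟩
  have hα' : algebraMap F E α ≠ 0 := (_root_.map_ne_zero _).2 hα
  have h2 : (discrIdeal σ α I I)⁻¹ * I = spanSingleton (𝓞 E)⁰ (algebraMap F E α)⁻¹ *
      dual ℤ ℚ (galConj σ I) := by
    rw [discrIdeal, dual_eq_mul_inv, coeIdeal_differentIdeal ℤ ℚ E (𝓞 E), mul_inv, mul_inv,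
      mul_inv, inv_inv, spanSingleton_inv]
    rw [mul_right_comm, mul_right_comm _ _ I, mul_assoc _ I⁻¹ I, inv_mul_cancel₀ hI, mul_one]
    ring
  rw [h1, h2, mem_singleton_mul]
  constructor
  · exact fun h ↦ ⟨_, h, by field_simp⟩
  · rintro ⟨y, hy, rfl⟩
    rwa [mul_inv_cancel_left₀ hα']

/-- The pairing is integral on `I × J` if its discriminant ideal is integral. -/
theorem exists_twistedTrace_eq_intCast {α : F} {I J : FractionalIdeal (𝓞 E)⁰ E}
    (hIJ : discrIdeal σ α I J ≤ 1) {x y : E} (hx : x ∈ I) (hy : y ∈ J) :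
    ∃ z : ℤ, twistedTrace σ α x y = z := by
  rw [discrIdeal, coeIdeal_differentIdeal ℤ ℚ E (𝓞 E), ← le_mul_inv_iff₀ (pos_iff_ne_zero.2
    (inv_ne_zero (dual_ne_zero ℤ ℚ (one_ne_zero' (FractionalIdeal (𝓞 E)⁰ E))))),
    inv_inv, one_mul] at hIJ
  have hmem := hIJ (mul_mem_mul (mul_mem_mul (mem_spanSingleton_self _ (algebraMap F E α)) hx)
    (mem_galConj.2 ⟨y, hy, rfl⟩))
  rw [mem_dual (A := ℤ) (K := ℚ) (B := 𝓞 E) (L := E) one_ne_zero] at hmem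
  obtain ⟨z, hz⟩ := hmem 1 (one_mem_one _)
  rw [Algebra.traceForm_apply, mul_one] at hz
  exact ⟨z, hz.symm⟩

end ConjugateFractionalIdeals

section StableIdeals

open scoped Pointwise

set_option linter.unusedSectionVars false

variable {E F : Type*} [Field E] [NumberField E] [Field F] [NumberField F] [Algebra F E]
  {σ : Gal(E/F)}

theorem gal_smul_smul_ideal (hσ : σ ≠ 1) (hG : ∀ g : Gal(E/F), g = 1 ∨ g = σ)
    (J : Ideal (𝓞 E)) : σ • σ • J = J := by
  apply coeIdeal_injective (K := E)
  change ((σ • σ • J : Ideal (𝓞 E)) : FractionalIdeal (𝓞 E)⁰ E) = J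
  rw [← galConj_coeIdeal, ← galConj_coeIdeal, galConj_galConj hσ hG]

theorem odd_count_mul_iff {w : HeightOneSpectrum (𝓞 E)} {P 𝔡 : Ideal (𝓞 E)} (hP : P ≠ ⊥)
    (h𝔡 : 𝔡 ≠ ⊥) : Odd (count E w ((P * 𝔡 : Ideal (𝓞 E)) : FractionalIdeal (𝓞 E)⁰ E)) ↔
      (Odd (count E w (P : FractionalIdeal (𝓞 E)⁰ E)) ↔
        ¬Odd (count E w (𝔡 : FractionalIdeal (𝓞 E)⁰ E))) := by
  rw [coeIdeal_mul, count_mul E w (coeIdeal_ne_zero.2 hP) (coeIdeal_ne_zero.2 h𝔡), Int.odd_add,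
    Int.not_odd_iff_even]

/-- A Galois stable ideal in a quadratic extension is a norm times a product of distinct Galois
stable primes. -/
theorem exists_eq_mul_smul_mul_prod (hσ : σ ≠ 1) (hG : ∀ g : Gal(E/F), g = 1 ∨ g = σ)
    (𝔡 : Ideal (𝓞 E)) (h0 : 𝔡 ≠ ⊥) (h𝔡 : σ • 𝔡 = 𝔡) :
    ∃ (J : Ideal (𝓞 E)) (S : Finset (HeightOneSpectrum (𝓞 E))), J ≠ ⊥ ∧
      𝔡 = J * σ • J * ∏ w ∈ S, w.asIdeal ∧ (∀ w ∈ S, σ • w.asIdeal = w.asIdeal) ∧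
      ∀ w : HeightOneSpectrum (𝓞 E), σ • w.asIdeal = w.asIdeal →
        (Odd (count E w (𝔡 : FractionalIdeal (𝓞 E)⁰ E)) ↔ w ∈ S) := by
  classical
  induction 𝔡 using WellFoundedGT.induction with
  | ind 𝔡 ih =>
  by_cases htop : 𝔡 = ⊤
  · subst htop
    refine ⟨⊤, ∅, top_ne_bot, ?_, by simp, fun w _ ↦ ?_⟩
    · rw [h𝔡, Finset.prod_empty, mul_one, ← Ideal.one_eq_top, one_mul]
    · rw [coeIdeal_top, count_one]
      simp
  obtain ⟨P, hPm, hP𝔡⟩ := Ideal.exists_le_maximal 𝔡 htop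
  have hP0 : P ≠ ⊥ := fun h ↦ h0 (le_bot_iff.1 (h ▸ hP𝔡))
  obtain ⟨𝔢, rfl⟩ := Ideal.dvd_iff_le.2 hP𝔡
  have h𝔢0 : 𝔢 ≠ ⊥ := by
    rintro rfl
    exact h0 (Ideal.mul_bot P)
  have hlt : ∀ A B : Ideal (𝓞 E), A ≠ ⊤ → A * B ≠ ⊥ → A * B < B := fun A B hA hAB ↦
    lt_of_le_of_ne Ideal.mul_le_right fun h ↦ hA <| by
      have hB : B ≠ 0 := by
        rintro rfl
        exact hAB (mul_zero A)
      rw [← Ideal.one_eq_top]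
      exact mul_right_cancel₀ hB (h.trans (one_mul B).symm)
  by_cases hσP : σ • P = P
  · have h𝔢 : σ • 𝔢 = 𝔢 := by
      rw [smul_mul', hσP] at h𝔡
      exact mul_left_cancel₀ hP0 h𝔡
    obtain ⟨J, S, hJ, hprod, hS, hodd⟩ := ih 𝔢 (hlt P 𝔢 hPm.ne_top h0) h𝔢0 h𝔢
    let p : HeightOneSpectrum (𝓞 E) := ⟨P, hPm.isPrime, hP0⟩
    by_cases hpS : p ∈ S
    · refine ⟨P * J, S.erase p, mul_ne_zero hP0 hJ, ?_, fun w hw ↦ hS w (Finset.mem_of_mem_erase hw),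
        fun w hw ↦ ?_⟩
      · rw [hprod, ← Finset.mul_prod_erase S _ hpS, smul_mul', hσP]
        ring
      · rw [odd_count_mul_iff hP0 h𝔢0, hodd w hw, Finset.mem_erase]
        by_cases hwp : w = p
        · subst hwp
          simp [hpS, p, show count E p (P : FractionalIdeal (𝓞 E)⁰ E) = 1 from count_self E p]
        · rw [show count E w (P : FractionalIdeal (𝓞 E)⁰ E) = 0 from
            count_maximal_coprime E w (w := p) (Ne.symm hwp)]
          simp [hwp]
    · refine ⟨J, insert p S, hJ, ?_, ?_, fun w hw ↦ ?_⟩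
      · rw [hprod, Finset.prod_insert hpS]
        ring
      · intro w hw
        rcases Finset.mem_insert.1 hw with rfl | hw
        · exact hσP
        · exact hS w hw
      · rw [odd_count_mul_iff hP0 h𝔢0, hodd w hw, Finset.mem_insert]
        by_cases hwp : w = p
        · subst hwp
          simp [hpS, p, show count E p (P : FractionalIdeal (𝓞 E)⁰ E) = 1 from count_self E p]
        · rw [show count E w (P : FractionalIdeal (𝓞 E)⁰ E) = 0 from
            count_maximal_coprime E w (w := p) (Ne.symm hwp)]
          simp [hwp]
  · have hQm : (σ • P).IsPrime := Ideal.IsPrime.smul σ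
    have hQ0 : σ • P ≠ ⊥ := fun h ↦ hP0 <| by
      rw [← gal_smul_smul_ideal hσ hG P, h]
      exact smul_zero σ
    have hdvd : σ • P ∣ 𝔢 := by
      have h1 : σ • P ∣ P * 𝔢 := ⟨σ • 𝔢, by rw [← smul_mul', h𝔡]⟩
      refine ((Ideal.prime_of_isPrime hQ0 hQm).dvd_or_dvd h1).resolve_left fun h ↦ ?_
      exact hσP (hPm.eq_of_le hQm.ne_top (Ideal.dvd_iff_le.1 h)).symm
    obtain ⟨𝔣, rfl⟩ := hdvd
    have h𝔣0 : 𝔣 ≠ ⊥ := by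
      rintro rfl
      exact h𝔢0 (Ideal.mul_bot _)
    have h𝔣 : σ • 𝔣 = 𝔣 := by
      rw [smul_mul', smul_mul', gal_smul_smul_ideal hσ hG, ← mul_assoc, ← mul_assoc,
        mul_comm _ P] at h𝔡
      exact mul_left_cancel₀ (mul_ne_zero hP0 hQ0) h𝔡
    have hlt' : P * (σ • P * 𝔣) < 𝔣 :=
      (hlt P _ hPm.ne_top h0).trans (hlt (σ • P) 𝔣 hQm.ne_top h𝔢0)
    obtain ⟨J, S, hJ, hprod, hS, hodd⟩ := ih 𝔣 hlt' h𝔣0 h𝔣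
    refine ⟨P * J, S, mul_ne_zero hP0 hJ, ?_, hS, fun w hw ↦ ?_⟩
    · conv_lhs => rw [hprod]
      rw [smul_mul']
      ring
    · let p : HeightOneSpectrum (𝓞 E) := ⟨P, hPm.isPrime, hP0⟩
      let p' : HeightOneSpectrum (𝓞 E) := ⟨σ • P, hQm, hQ0⟩
      have hp : p ≠ w := by
        rintro rfl
        exact hσP hw
      have hp' : p' ≠ w := by
        rintro rfl
        exact hσP ((gal_smul_smul_ideal hσ hG P).symm.trans hw).symm
      rw [odd_count_mul_iff hP0 h𝔢0, odd_count_mul_iff hQ0 h𝔣0, hodd w hw,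
        show count E w (P : FractionalIdeal (𝓞 E)⁰ E) = 0 from count_maximal_coprime E w hp,
        show count E w ((σ • P : Ideal (𝓞 E)) : FractionalIdeal (𝓞 E)⁰ E) = 0 from
          count_maximal_coprime E w hp']
      simp

end StableIdeals

section DiscriminantForm

open scoped Pointwise

set_option linter.unusedSectionVars false

variable {E F : Type*} [Field E] [NumberField E] [Field F] [NumberField F] [Algebra F E]
  {σ : Gal(E/F)}

theorem coe_mul_mem_inv_mul {P : Ideal (𝓞 E)} (hP : P ≠ ⊥) {T I : FractionalIdeal (𝓞 E)⁰ E}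
    {p : 𝓞 E} (hp : p ∈ P) {x : E}
    (hx : x ∈ ((P : FractionalIdeal (𝓞 E)⁰ E) * T)⁻¹ * I) : (p : E) * x ∈ T⁻¹ * I := by
  have h := mul_mem_mul ((mem_coeIdeal (𝓞 E)⁰).2 ⟨p, hp, rfl⟩) hx
  rwa [mul_inv, mul_assoc, mul_inv_cancel_left₀ (coeIdeal_ne_zero.2 hP)] at h

theorem coe_mul_mem_of_mem_inv_mul {P : Ideal (𝓞 E)} (hP : P ≠ ⊥)
    {I : FractionalIdeal (𝓞 E)⁰ E} {p : 𝓞 E} (hp : p ∈ P) {x : E}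
    (hx : x ∈ (P : FractionalIdeal (𝓞 E)⁰ E)⁻¹ * I) : (p : E) * x ∈ I := by
  have h := mul_mem_mul ((mem_coeIdeal (𝓞 E)⁰).2 ⟨p, hp, rfl⟩) hx
  rwa [mul_inv_cancel_left₀ (coeIdeal_ne_zero.2 hP)] at h

theorem coe_mul_mem_fractionalIdeal {I : FractionalIdeal (𝓞 E)⁰ E} (r : 𝓞 E) {x : E}
    (hx : x ∈ I) : (r : E) * x ∈ I := by
  have h := Submodule.smul_mem (I : Submodule (𝓞 E) E) r hx
  rwa [Algebra.smul_def] at h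

theorem le_inv_mul {P : Ideal (𝓞 E)} (hP : P ≠ ⊥) (I : FractionalIdeal (𝓞 E)⁰ E) :
    I ≤ (P : FractionalIdeal (𝓞 E)⁰ E)⁻¹ * I := by
  intro x hx
  have h1 : (1 : E) ∈ (P : FractionalIdeal (𝓞 E)⁰ E)⁻¹ := by
    rw [mem_inv_iff (coeIdeal_ne_zero.2 hP)]
    intro y hy
    rw [one_mul]
    exact coeIdeal_le_one hy
  have h := mul_mem_mul h1 hx
  rwa [one_mul] at h

theorem mem_of_mem_inv_mul_of_isCoprime {P T : Ideal (𝓞 E)} (hP : P ≠ ⊥) (hT : T ≠ ⊥)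
    (hPT : IsCoprime P T) {I : FractionalIdeal (𝓞 E)⁰ E} {x : E}
    (hxP : x ∈ (P : FractionalIdeal (𝓞 E)⁰ E)⁻¹ * I)
    (hxT : x ∈ (T : FractionalIdeal (𝓞 E)⁰ E)⁻¹ * I) : x ∈ I := by
  obtain ⟨p, hp, t, ht, hpt⟩ := Ideal.isCoprime_iff_exists.1 hPT
  have hx : x = p * x + t * x := by
    rw [← add_mul, ← map_add, hpt, map_one, one_mul]
  rw [hx]
  exact Submodule.add_mem _ (coe_mul_mem_of_mem_inv_mul hP hp hxP)
    (coe_mul_mem_of_mem_inv_mul hT ht hxT)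

theorem mem_sup_iSup_of_mem_inv_prod_mul (I : FractionalIdeal (𝓞 E)⁰ E)
    (S : Finset (HeightOneSpectrum (𝓞 E))) {x : E}
    (hx : x ∈ ((∏ w ∈ S, w.asIdeal : Ideal (𝓞 E)) : FractionalIdeal (𝓞 E)⁰ E)⁻¹ * I) :
    x ∈ (I : Submodule (𝓞 E) E).toAddSubgroup ⊔ ⨆ w ∈ S,
      (((w.asIdeal : FractionalIdeal (𝓞 E)⁰ E)⁻¹ * I : FractionalIdeal (𝓞 E)⁰ E) :
        Submodule (𝓞 E) E).toAddSubgroup := by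
  classical
  induction S using Finset.induction_on generalizing x with
  | empty =>
    rw [Finset.prod_empty, Ideal.one_eq_top, coeIdeal_top, inv_one, one_mul] at hx
    exact AddSubgroup.mem_sup_left hx
  | insert w S hw ih =>
    have hcop : IsCoprime w.asIdeal (∏ w ∈ S, w.asIdeal) := IsCoprime.prod_right fun w' hw' ↦ by
      have := w.isMaximal
      have := w'.isMaximal
      exact Ideal.isCoprime_of_isMaximal fun h ↦ hw (HeightOneSpectrum.ext h ▸ hw')
    have hS0 : ∏ w ∈ S, w.asIdeal ≠ ⊥ := Finset.prod_ne_zero_iff.2 fun w _ ↦ w.ne_bot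
    obtain ⟨p, hp, t, ht, hpt⟩ := Ideal.isCoprime_iff_exists.1 hcop
    rw [Finset.prod_insert hw, coeIdeal_mul] at hx
    have hxe : x = p * x + t * x := by
      rw [← add_mul, ← map_add, hpt, map_one, one_mul]
    rw [hxe]
    refine AddSubgroup.add_mem _ ?_ ?_
    · have hle := sup_le_sup_left (biSup_mono (f := fun w : HeightOneSpectrum (𝓞 E) ↦
        (((w.asIdeal : FractionalIdeal (𝓞 E)⁰ E)⁻¹ * I : FractionalIdeal (𝓞 E)⁰ E) :
          Submodule (𝓞 E) E).toAddSubgroup) fun w' (hw' : w' ∈ S) ↦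
          Finset.mem_insert_of_mem (b := w) hw')
        (I : Submodule (𝓞 E) E).toAddSubgroup
      exact hle (ih (coe_mul_mem_inv_mul w.ne_bot hp hx))
    · refine AddSubgroup.mem_sup_right (AddSubgroup.mem_iSup_of_mem w
        (AddSubgroup.mem_iSup_of_mem (Finset.mem_insert_self w S) ?_))
      rw [mul_comm] at hx
      rw [mul_comm (w.asIdeal : FractionalIdeal (𝓞 E)⁰ E), mul_comm] at hx
      exact coe_mul_mem_inv_mul hS0 ht hx

/-- If `P` is maximal then `P⁻¹ I / I` is a line over the residue field of `P`. -/
theorem exists_sub_coe_mul_mem {P : Ideal (𝓞 E)} (hPm : P.IsMaximal) (hP : P ≠ ⊥)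
    {I : FractionalIdeal (𝓞 E)⁰ E} (hI : I ≠ 0) {x₀ : E}
    (hx₀ : x₀ ∈ (P : FractionalIdeal (𝓞 E)⁰ E)⁻¹ * I) (hx₀I : x₀ ∉ I) {x : E}
    (hx : x ∈ (P : FractionalIdeal (𝓞 E)⁰ E)⁻¹ * I) : ∃ r : 𝓞 E, x - r * x₀ ∈ I := by
  have hPf : (P : FractionalIdeal (𝓞 E)⁰ E) ≠ 0 := coeIdeal_ne_zero.2 hP
  set K := spanSingleton (𝓞 E)⁰ x₀ + I with hK
  have hKle : K ≤ (P : FractionalIdeal (𝓞 E)⁰ E)⁻¹ * I := by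
    rw [hK, ← sup_eq_add]
    refine sup_le ?_ (le_inv_mul hP I)
    rwa [spanSingleton_le_iff_mem]
  have hIK : I ≤ K := by
    rw [hK, ← sup_eq_add]
    exact le_sup_right
  obtain ⟨L, hL⟩ : ∃ L : Ideal (𝓞 E), (L : FractionalIdeal (𝓞 E)⁰ E) = P * K * I⁻¹ := by
    rw [← le_one_iff_exists_coeIdeal]
    calc P * K * I⁻¹ ≤ P * ((P : FractionalIdeal (𝓞 E)⁰ E)⁻¹ * I) * I⁻¹ := by gcongr
      _ = 1 := by rw [mul_inv_cancel_left₀ hPf, mul_inv_cancel₀ hI]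
  have hPL : P ≤ L := by
    rw [← coeIdeal_le_coeIdeal E, hL]
    calc (P : FractionalIdeal (𝓞 E)⁰ E) = P * I * I⁻¹ := by
          rw [mul_assoc, mul_inv_cancel₀ hI, mul_one]
      _ ≤ P * K * I⁻¹ := by gcongr
  have hKL : K = (P : FractionalIdeal (𝓞 E)⁰ E)⁻¹ * I * L := by
    rw [hL]
    field_simp
  have hLtop : L = ⊤ := by
    by_contra hLtop
    rw [← hPm.eq_of_le hLtop hPL, mul_right_comm, inv_mul_cancel₀ hPf, one_mul] at hKL
    refine hx₀I ?_
    rw [← hKL, hK, ← sup_eq_add]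
    exact (le_sup_left : spanSingleton (𝓞 E)⁰ x₀ ≤ _) (mem_spanSingleton_self _ _)
  rw [hLtop, coeIdeal_top, mul_one] at hKL
  rw [← hKL, hK, mem_add] at hx
  obtain ⟨i, hi, j, hj, rfl⟩ := hx
  obtain ⟨r, rfl⟩ := (mem_spanSingleton _).1 hi
  refine ⟨r, ?_⟩
  rwa [Algebra.smul_def, add_sub_cancel_left]

/-- A multiplicative function on a ring that is trivial on an ideal descends to the quotient. -/
theorem exists_addChar_quotient {R : Type*} [CommRing R] (v : Ideal R) (g : R → ℂ)
    (hadd : ∀ s t, g (s + t) = g s * g t) (hv : ∀ t ∈ v, g t = 1) :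
    ∃ ψ : AddChar (R ⧸ v) ℂ, ∀ t, ψ (Ideal.Quotient.mk v t) = g t := by
  have hg : ∀ s t, Ideal.Quotient.mk v s = Ideal.Quotient.mk v t → g s = g t := by
    intro s t h
    have h1 := hadd (s - t) t
    rwa [sub_add_cancel, hv _ (Ideal.Quotient.eq.1 h), one_mul] at h1
  have hout : ∀ x : R ⧸ v, Ideal.Quotient.mk v (Quotient.out x) = x := fun x ↦ Quotient.out_eq x
  refine ⟨⟨fun x ↦ g (Quotient.out x), ?_, fun x y ↦ ?_⟩, fun t ↦ hg _ _ (hout _)⟩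
  · rw [hg _ 0 ((hout 0).trans (map_zero _).symm), hv 0 v.zero_mem]
  · rw [← hadd]
    exact hg _ _ (by rw [hout, map_add, hout, hout])

variable [IsGalois F E]

theorem algebraMap_intNorm_eq_mul (hσ : σ ≠ 1) (hG : ∀ g : Gal(E/F), g = 1 ∨ g = σ) (y : 𝓞 E) :
    algebraMap (𝓞 F) (𝓞 E) (Algebra.intNorm (𝓞 F) (𝓞 E) y) = y * σ • y := by
  apply RingOfIntegers.ext
  change algebraMap F E (algebraMap (𝓞 F) F _) = (y : E) * σ y
  rw [Algebra.algebraMap_intNorm (K := F) (L := E), algebraMap_norm_eq_mul hσ hG]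

/-- The twisted trace form as a scaled trace of `F` on the line spanned by `x`. -/
theorem twistedTrace_coe_mul_self (hσ : σ ≠ 1) (hG : ∀ g : Gal(E/F), g = 1 ∨ g = σ) (α : F)
    (x : E) (r : 𝓞 E) : twistedTrace σ α (r * x) x = Algebra.trace ℚ F
      (α * Algebra.norm F x * (Algebra.intTrace (𝓞 F) (𝓞 E) r : 𝓞 F)) := by
  have htr : ((Algebra.intTrace (𝓞 F) (𝓞 E) r : 𝓞 F) : F) = Algebra.trace F E r :=
    Algebra.algebraMap_intTrace (K := F) (L := E) r
  rw [twistedTrace_apply, htr, ← trace_algebraMap_mul, map_mul (algebraMap F E),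
    algebraMap_norm_eq_mul hσ hG]
  congr 1
  ring

/-- The integers of trace one make the twisted trace form even on integral lattices. -/
theorem exists_trace_mul_norm_eq_intCast (hσ : σ ≠ 1) (hG : ∀ g : Gal(E/F), g = 1 ∨ g = σ)
    (hunram : ∀ v : Ideal (𝓞 F), v.IsPrime → v ≠ ⊥ →
      ¬∃ P : Ideal (𝓞 E), P.IsPrime ∧ Ideal.map (algebraMap (𝓞 F) (𝓞 E)) v = P ^ 2)
    {α : F} {x : E} {t : 𝓞 F}
    (hx : ∀ r : 𝓞 E, ∃ z : ℤ, twistedTrace σ α ((algebraMap (𝓞 F) (𝓞 E) t * r : 𝓞 E) * x) x = z) :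
    ∃ z : ℤ, Algebra.trace ℚ F (α * Algebra.norm F x * t) = z := by
  obtain ⟨y, hy⟩ := exists_add_gal_smul_eq_one hσ hG hunram
  rw [← algebraMap_intTrace_eq_add hσ hG] at hy
  have hy' : Algebra.intTrace (𝓞 F) (𝓞 E) y = 1 :=
    FaithfulSMul.algebraMap_injective (𝓞 F) (𝓞 E) (hy.trans (map_one _).symm)
  obtain ⟨z, hz⟩ := hx y
  rw [twistedTrace_coe_mul_self hσ hG, ← Algebra.smul_def, map_smul, hy', smul_eq_mul,
    mul_one] at hz
  exact ⟨z, hz⟩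

end DiscriminantForm

section LocalGaussSums

open scoped Pointwise

set_option linter.unusedSectionVars false

variable {E F : Type*} [Field E] [NumberField E] [Field F] [NumberField F] [Algebra F E]
  {σ : Gal(E/F)} [IsGalois F E]

/-- The norm of integers is compatible with the norm of residue fields at inert primes. -/
theorem mk_intNorm_eq_norm_mk (hσ : σ ≠ 1) (hG : ∀ g : Gal(E/F), g = 1 ∨ g = σ)
    (hunram : ∀ v : Ideal (𝓞 F), v.IsPrime → v ≠ ⊥ →
      ¬∃ P : Ideal (𝓞 E), P.IsPrime ∧ Ideal.map (algebraMap (𝓞 F) (𝓞 E)) v = P ^ 2)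
    {P : Ideal (𝓞 E)} (hP : P.IsPrime) (hP0 : P ≠ ⊥) (hσP : σ • P = P) (y : 𝓞 E) :
    Ideal.Quotient.mk (P.under (𝓞 F)) (Algebra.intNorm (𝓞 F) (𝓞 E) y) =
      Algebra.norm (𝓞 F ⧸ P.under (𝓞 F)) (Ideal.Quotient.mk P y) := by
  have hfr := (map_under_eq_and_finrank_eq_two hσ hG hunram hP hP0 hσP).2
  have hPm : P.IsMaximal := hP.isMaximal hP0
  have hvm : (P.under (𝓞 F)).IsMaximal :=
    Ideal.IsPrime.isMaximal inferInstance (Ideal.under_ne_bot _ hP0)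
  let _ : Field (𝓞 E ⧸ P) := Ideal.Quotient.field P
  let _ : Field (𝓞 F ⧸ P.under (𝓞 F)) := Ideal.Quotient.field _
  have hfin : Finite (𝓞 E ⧸ P) := Ideal.finiteQuotientOfFreeOfNeBot P hP0
  have hfinv : Finite (𝓞 F ⧸ P.under (𝓞 F)) :=
    Ideal.finiteQuotientOfFreeOfNeBot _ (Ideal.under_ne_bot _ hP0)
  have hq1 : 1 < Nat.card (𝓞 F ⧸ P.under (𝓞 F)) := Finite.one_lt_card
  have hcard : Nat.card (𝓞 E ⧸ P) = Nat.card (𝓞 F ⧸ P.under (𝓞 F)) ^ 2 := by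
    rw [Module.natCard_eq_pow_finrank (K := 𝓞 F ⧸ P.under (𝓞 F)), hfr]
  have hexp : (Nat.card (𝓞 F ⧸ P.under (𝓞 F)) ^ 2 - 1) / (Nat.card (𝓞 F ⧸ P.under (𝓞 F)) - 1) =
      Nat.card (𝓞 F ⧸ P.under (𝓞 F)) + 1 := by
    refine Nat.div_eq_of_eq_mul_left (by omega) ?_
    simpa using Nat.sq_sub_sq (Nat.card (𝓞 F ⧸ P.under (𝓞 F))) 1
  apply (algebraMap (𝓞 F ⧸ P.under (𝓞 F)) (𝓞 E ⧸ P)).injective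
  rw [FiniteField.algebraMap_norm_eq_pow, hcard, hexp, Ideal.Quotient.algebraMap_mk_of_liesOver,
    algebraMap_intNorm_eq_mul hσ hG, map_mul, pow_succ', ← map_pow]
  congr 1
  exact Ideal.Quotient.eq.2 ((gal_smul_sub_pow_card_mem hσ hG hunram hP hP0 hσP).1 y)

/-- The Gauss sum of the discriminant form at an inert prime is negative. -/
theorem exists_sum_ratExp_eq_neg (hσ : σ ≠ 1) (hG : ∀ g : Gal(E/F), g = 1 ∨ g = σ)
    (hunram : ∀ v : Ideal (𝓞 F), v.IsPrime → v ≠ ⊥ →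
      ¬∃ P : Ideal (𝓞 E), P.IsPrime ∧ Ideal.map (algebraMap (𝓞 F) (𝓞 E)) v = P ^ 2)
    {α : F} (hα : α ≠ 0) {I : FractionalIdeal (𝓞 E)⁰ E} (hI : I ≠ 0)
    {P T : Ideal (𝓞 E)} (hP : P.IsPrime) (hP0 : P ≠ ⊥) (hT : T ≠ ⊥) (hσP : σ • P = P)
    (hPT : IsCoprime P T) (hD : discrIdeal σ α I I = ((P * T : Ideal (𝓞 E)) :
      FractionalIdeal (𝓞 E)⁰ E)) :
    ∃ (_ : Fintype (𝓞 E ⧸ P)) (c : 𝓞 E ⧸ P → E),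
      (∀ y, c y ∈ (P : FractionalIdeal (𝓞 E)⁰ E)⁻¹ * I) ∧ (∀ y y', c y - c y' ∈ I → y = y') ∧
      (∀ x ∈ (P : FractionalIdeal (𝓞 E)⁰ E)⁻¹ * I, ∃ y, x - c y ∈ I) ∧
      ∃ r : ℝ, r < 0 ∧ ∑ y, ratExp (twistedTrace σ α (c y) (c y) / 2) = r := by
  have hPf : (P : FractionalIdeal (𝓞 E)⁰ E) ≠ 0 := coeIdeal_ne_zero.2 hP0
  have hPm : P.IsMaximal := hP.isMaximal hP0
  have hvm : (P.under (𝓞 F)).IsMaximal :=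
    Ideal.IsPrime.isMaximal inferInstance (Ideal.under_ne_bot _ hP0)
  let _ : Field (𝓞 E ⧸ P) := Ideal.Quotient.field P
  let _ : Field (𝓞 F ⧸ P.under (𝓞 F)) := Ideal.Quotient.field _
  have hfin : Finite (𝓞 E ⧸ P) := Ideal.finiteQuotientOfFreeOfNeBot P hP0
  have hfinv : Finite (𝓞 F ⧸ P.under (𝓞 F)) :=
    Ideal.finiteQuotientOfFreeOfNeBot _ (Ideal.under_ne_bot _ hP0)
  let _ : Fintype (𝓞 E ⧸ P) := Fintype.ofFinite _
  let _ : Fintype (𝓞 F ⧸ P.under (𝓞 F)) := Fintype.ofFinite _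
  set U := (P : FractionalIdeal (𝓞 E)⁰ E)⁻¹ * I with hU
  have hU0 : U ≠ 0 := mul_ne_zero (inv_ne_zero hPf) hI
  have hPconj : galConj σ (P : FractionalIdeal (𝓞 E)⁰ E)⁻¹ = (P : FractionalIdeal (𝓞 E)⁰ E)⁻¹ := by
    rw [map_inv₀, galConj_coeIdeal, hσP]
  have hIU : ∀ x ∈ I, ∀ y ∈ U, ∃ z : ℤ, twistedTrace σ α x y = z := fun x hx y hy ↦ by
    refine exists_twistedTrace_eq_intCast (σ := σ) (α := α) ?_ hx hy
    rw [hU, ← one_mul I, ← mul_assoc, mul_one, discrIdeal_mul_mul, hPconj, hD, coeIdeal_mul,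
      one_mul, inv_mul_cancel_left₀ hPf]
    exact coeIdeal_le_one
  obtain ⟨x₀, hx₀, hx₀I⟩ : ∃ x ∈ U, x ∉ I := by
    refine SetLike.not_le_iff_exists.1 fun h ↦ hPm.ne_top ?_
    have h1 : (P : FractionalIdeal (𝓞 E)⁰ E)⁻¹ * I = 1 * I := by
      rw [one_mul]
      exact le_antisymm h (le_inv_mul hP0 I)
    have h2 := mul_right_cancel₀ hI h1
    rw [inv_eq_one] at h2
    rwa [← coeIdeal_inj (K := E), coeIdeal_top]
  have hcover := fun x hx ↦ exists_sub_coe_mul_mem (x := x) hPm hP0 hI hx₀ hx₀I hx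
  obtain ⟨o, hmk⟩ : ∃ o : 𝓞 E ⧸ P → 𝓞 E, ∀ y, Ideal.Quotient.mk P (o y) = y :=
    Ideal.Quotient.mk_surjective.hasRightInverse
  obtain ⟨ψ, hψ⟩ := exists_addChar_quotient (P.under (𝓞 F))
    (fun t ↦ ratExp (Algebra.trace ℚ F (α * Algebra.norm F x₀ * (t : 𝓞 F))))
    (fun s t ↦ by
      have hst : ((s + t : 𝓞 F) : F) = s + t := map_add (algebraMap (𝓞 F) F) s t
      rw [← ratExp_add, ← map_add, hst, mul_add])
    (fun t ht ↦ ratExp_eq_one_iff.2 <| exists_trace_mul_norm_eq_intCast hσ hG hunram fun r ↦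
      hIU _ (coe_mul_mem_of_mem_inv_mul hP0 (P.mul_mem_right r ht) hx₀) _ hx₀)
  have hψ0 : ψ ≠ 0 := by
    rintro rfl
    have h1 : ∀ t : 𝓞 F, ∃ z : ℤ, Algebra.trace ℚ F (α * Algebra.norm F x₀ * t) = z := fun t ↦
      ratExp_eq_one_iff.1 ((hψ t).symm.trans (AddChar.zero_apply _))
    have h2 : ∀ y ∈ U, ∃ z : ℤ, twistedTrace σ α x₀ y = z := by
      intro y hy
      obtain ⟨r, hr⟩ := hcover y hy
      obtain ⟨z, hz⟩ := h1 (Algebra.intTrace (𝓞 F) (𝓞 E) r)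
      obtain ⟨z', hz'⟩ := hIU _ hr _ hx₀
      rw [← twistedTrace_coe_mul_self hσ hG] at hz
      refine ⟨z' + z, ?_⟩
      rw [twistedTrace_comm hσ hG, ← sub_add_cancel y (r * x₀), map_add, LinearMap.add_apply, hz,
        hz']
      push_cast
      rfl
    refine hx₀I (mem_of_mem_inv_mul_of_isCoprime hP0 hT hPT hx₀ ?_)
    rw [forall_twistedTrace_mem_iff hα hU0, hU, discrIdeal_mul_mul, hPconj, hD, coeIdeal_mul,
      mul_assoc, inv_mul_cancel_left₀ hPf, mul_inv, inv_inv, mul_right_comm,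
      mul_inv_cancel_left₀ hPf, mul_comm] at h2
    exact h2
  refine ⟨inferInstance, fun y ↦ (o y : E) * x₀,
    fun y ↦ coe_mul_mem_fractionalIdeal _ hx₀, fun y y' h ↦ ?_, fun x hx ↦ ?_, ?_⟩
  · by_contra hne
    rw [← hmk y, ← hmk y', Ideal.Quotient.eq] at hne
    have hsup : P ⊔ Ideal.span {o y - o y'} = ⊤ :=
      hPm.out.2 _ (lt_of_le_of_ne le_sup_left fun h ↦ hne
        (h.ge (Ideal.mem_sup_right (Ideal.mem_span_singleton_self _))))
    obtain ⟨p, hp, t, ht, hpt⟩ := Ideal.isCoprime_iff_exists.1 (Ideal.isCoprime_iff_sup_eq.2 hsup)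
    obtain ⟨s, rfl⟩ := Ideal.mem_span_singleton'.1 ht
    refine hx₀I ?_
    have hx : x₀ = p * x₀ + (s : E) * ((o y : E) * x₀ -
        (o y' : E) * x₀) := by
      have h1 := congrArg (algebraMap (𝓞 E) E) hpt
      simp only [map_add, map_mul, map_sub, map_one] at h1
      linear_combination -x₀ * h1
    rw [hx]
    exact Submodule.add_mem _ (coe_mul_mem_of_mem_inv_mul hP0 hp hx₀)
      (coe_mul_mem_fractionalIdeal s h)
  · obtain ⟨r, hr⟩ := hcover x hx
    refine ⟨Ideal.Quotient.mk P r, ?_⟩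
    have h1 := coe_mul_mem_of_mem_inv_mul hP0 (Ideal.Quotient.eq.1 (hmk (Ideal.Quotient.mk P r)))
      hx₀
    have h2 : x - r * x₀ - ((o (Ideal.Quotient.mk P r) - r : 𝓞 E) : E) * x₀ ∈ I :=
      Submodule.sub_mem _ hr h1
    have h3 : ((o (Ideal.Quotient.mk P r) - r : 𝓞 E) : E) = o (Ideal.Quotient.mk P r) - r :=
      map_sub (algebraMap (𝓞 E) E) _ _
    rw [h3] at h2
    convert h2 using 1
    ring
  · have hfr := (map_under_eq_and_finrank_eq_two hσ hG hunram hP hP0 hσP).2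
    obtain ⟨r, hr, hsum⟩ := exists_sum_addChar_norm_eq_neg (𝓞 F ⧸ P.under (𝓞 F)) (𝓞 E ⧸ P) ψ hψ0 hfr
    refine ⟨r, hr, hsum ▸ Finset.sum_congr rfl fun y _ ↦ ?_⟩
    have hN : ((Algebra.intNorm (𝓞 F) (𝓞 E) (o y) : 𝓞 F) : F) =
        Algebra.norm F (o y : E) :=
      Algebra.algebraMap_intNorm (K := F) (L := E) _
    conv_rhs => rw [← hmk y]
    rw [← mk_intNorm_eq_norm_mk hσ hG hunram hP hP0 hσP, hψ, twistedTrace_self hσ hG,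
      mul_div_cancel_left₀ _ two_ne_zero, hN, map_mul (Algebra.norm F)]
    congr 2
    ring

end LocalGaussSums

section SignatureCongruence

open scoped Pointwise

set_option linter.unusedSectionVars false

variable {E F : Type*} [Field E] [NumberField E] [Field F] [NumberField F] [Algebra F E]
  {σ : Gal(E/F)} [IsGalois F E]

theorem exists_zsmul_mem_fractionalIdeal {I : FractionalIdeal (𝓞 E)⁰ E} (hI : I ≠ 0) (x : E) :
    ∃ N : ℤ, N ≠ 0 ∧ N • x ∈ I := by
  obtain ⟨z, hz, hz0⟩ : ∃ z ∈ I, z ≠ 0 := by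
    by_contra! h
    exact hI (eq_zero_iff.2 h)
  obtain ⟨N, hN, hNx⟩ := ((IsFractionRing.isAlgebraic_iff ℤ ℚ E).2
    (Algebra.IsAlgebraic.isAlgebraic (R := ℚ) (x / z))).exists_integral_multiple
  refine ⟨N, hN, ?_⟩
  have h := coe_mul_mem_fractionalIdeal (⟨N • (x / z), hNx⟩ : 𝓞 E) hz
  change N • (x / z) * z ∈ I at h
  rwa [smul_mul_assoc, div_mul_cancel₀ _ hz0] at h

/-- The signature congruence for lattices whose discriminant ideal is a product of distinct inert
primes. -/
theorem eight_dvd_of_discrIdeal_eq_prod (hσ : σ ≠ 1) (hG : ∀ g : Gal(E/F), g = 1 ∨ g = σ)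
    (hunram : ∀ v : Ideal (𝓞 F), v.IsPrime → v ≠ ⊥ →
      ¬∃ P : Ideal (𝓞 E), P.IsPrime ∧ Ideal.map (algebraMap (𝓞 F) (𝓞 E)) v = P ^ 2)
    {α : F} (hα : α ≠ 0) {I : FractionalIdeal (𝓞 E)⁰ E} (hI : I ≠ 0)
    {S : Finset (HeightOneSpectrum (𝓞 E))} (hS : ∀ w ∈ S, σ • w.asIdeal = w.asIdeal)
    (hD : discrIdeal σ α I I = ((∏ w ∈ S, w.asIdeal : Ideal (𝓞 E)) :
      FractionalIdeal (𝓞 E)⁰ E)) :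
    (8 : ℤ) ∣ 2 * (Nat.card {τ : F →+* ℝ // ¬∃ τ' : E →+* ℝ, τ'.comp (algebraMap F E) = τ} : ℤ) -
      4 * (Nat.card {τ : F →+* ℝ //
        (¬∃ τ' : E →+* ℝ, τ'.comp (algebraMap F E) = τ) ∧ τ α < 0} : ℤ) + 4 * S.card := by
  classical
  obtain ⟨d, hd, hσd⟩ := exists_gal_apply_eq_neg hσ hG
  have hII : ∀ x ∈ I, ∀ y ∈ I, ∃ z : ℤ, twistedTrace σ α x y = z := fun x hx y hy ↦
    exists_twistedTrace_eq_intCast (by rw [hD]; exact coeIdeal_le_one) hx hy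
  have heven : ∀ x ∈ (I : Submodule (𝓞 E) E).toAddSubgroup,
      ∃ z : ℤ, twistedTrace σ α x x = 2 * z := by
    intro x hx
    obtain ⟨z, hz⟩ := exists_trace_mul_norm_eq_intCast hσ hG hunram (α := α) (x := x) (t := 1)
      fun r ↦ hII _ (coe_mul_mem_fractionalIdeal _ hx) _ hx
    have h1 : ((1 : 𝓞 F) : F) = 1 := map_one (algebraMap (𝓞 F) F)
    rw [h1, mul_one] at hz
    exact ⟨z, by rw [twistedTrace_self hσ hG, hz]⟩
  obtain ⟨e, n, he, horth, hn, hn0, hsign⟩ := exists_orthogonal_basis_mem hσ hG hα hd hσd heven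
    (exists_zsmul_mem_fractionalIdeal hI)
  rw [← sum_sign_add_sign_eq hσ hG hα hd hσd, ← hsign]
  have hconj : ∀ w ∈ S, galConj σ (w.asIdeal : FractionalIdeal (𝓞 E)⁰ E)⁻¹ =
      (w.asIdeal : FractionalIdeal (𝓞 E)⁰ E)⁻¹ := fun w hw ↦ by
    rw [map_inv₀, galConj_coeIdeal, hS w hw]
  have hne : ∀ w : HeightOneSpectrum (𝓞 E), (w.asIdeal : FractionalIdeal (𝓞 E)⁰ E) ≠ 0 :=
    fun w ↦ coeIdeal_ne_zero.2 w.ne_bot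
  refine eight_dvd_sum_sign_add (twistedTrace_comm hσ hG α) horth hn hn0 he heven
    (U := fun w ↦ (((w.asIdeal : FractionalIdeal (𝓞 E)⁰ E)⁻¹ * I : FractionalIdeal (𝓞 E)⁰ E) :
        Submodule (𝓞 E) E).toAddSubgroup) ?_ ?_ ?_ ?_ ?_
  · exact fun w _ ↦ le_inv_mul w.ne_bot I
  · intro w hw x hx y hy
    refine exists_twistedTrace_eq_intCast (J := 1 * I) ?_ hx (by rwa [one_mul])
    rw [discrIdeal_mul_mul, hD, map_one, mul_one, ← Finset.mul_prod_erase S _ hw, coeIdeal_mul,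
      inv_mul_cancel_left₀ (hne w)]
    exact coeIdeal_le_one
  · intro w hw w' hw' hww' x hx y hy
    refine exists_twistedTrace_eq_intCast ?_ hx hy
    rw [discrIdeal_mul_mul, hD, hconj w' hw', ← Finset.mul_prod_erase S _ hw,
      ← Finset.mul_prod_erase (S.erase w) _ (Finset.mem_erase.2 ⟨hww'.symm, hw'⟩), coeIdeal_mul,
      coeIdeal_mul, mul_comm _ (w'.asIdeal : FractionalIdeal (𝓞 E)⁰ E)⁻¹, mul_assoc,
      inv_mul_cancel_left₀ (hne w), inv_mul_cancel_left₀ (hne w')]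
    exact coeIdeal_le_one
  · intro x hx
    refine mem_sup_iSup_of_mem_inv_prod_mul I S ?_
    rw [← hD]
    exact (forall_twistedTrace_mem_iff hα hI x).1 hx
  · intro w hw
    have hcop : IsCoprime w.asIdeal (∏ w' ∈ S.erase w, w'.asIdeal) :=
      IsCoprime.prod_right fun w' hw' ↦ by
        have := w.isMaximal
        have := w'.isMaximal
        exact Ideal.isCoprime_of_isMaximal fun h ↦
          (Finset.mem_erase.1 hw').1 (HeightOneSpectrum.ext h).symm
    rw [← Finset.mul_prod_erase S _ hw] at hD
    obtain ⟨hfin, c, hc⟩ := exists_sum_ratExp_eq_neg hσ hG hunram hα hI w.isPrime w.ne_bot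
      (Finset.prod_ne_zero_iff.2 fun w _ ↦ w.ne_bot) (hS w hw) hcop hD
    exact ⟨𝓞 E ⧸ w.asIdeal, hfin, c, hc⟩

/-- The primes of `E` above inert primes are the Galois stable ones. -/
theorem exists_map_eq_iff_gal_smul_eq (hσ : σ ≠ 1) (hG : ∀ g : Gal(E/F), g = 1 ∨ g = σ)
    (hunram : ∀ v : Ideal (𝓞 F), v.IsPrime → v ≠ ⊥ →
      ¬∃ P : Ideal (𝓞 E), P.IsPrime ∧ Ideal.map (algebraMap (𝓞 F) (𝓞 E)) v = P ^ 2)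
    (w : HeightOneSpectrum (𝓞 E)) :
    (∃ v : Ideal (𝓞 F), v.IsPrime ∧ v ≠ ⊥ ∧
      Ideal.map (algebraMap (𝓞 F) (𝓞 E)) v = w.asIdeal) ↔ σ • w.asIdeal = w.asIdeal := by
  constructor
  · rintro ⟨v, -, -, hv⟩
    rw [← hv, gal_smul_map_algebraMap]
  · intro h
    have := w.isPrime
    exact ⟨w.asIdeal.under (𝓞 F), inferInstance, Ideal.under_ne_bot _ w.ne_bot,
      (map_under_eq_and_finrank_eq_two hσ hG hunram w.isPrime w.ne_bot h).1⟩

/-- The signature congruence in terms of a generator of the Galois group. -/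
theorem eight_dvd_of_discrIdeal_le_one (hσ : σ ≠ 1) (hG : ∀ g : Gal(E/F), g = 1 ∨ g = σ)
    (hunram : ∀ v : Ideal (𝓞 F), v.IsPrime → v ≠ ⊥ →
      ¬∃ P : Ideal (𝓞 E), P.IsPrime ∧ Ideal.map (algebraMap (𝓞 F) (𝓞 E)) v = P ^ 2)
    {α : F} (hα : α ≠ 0) {I : FractionalIdeal (𝓞 E)⁰ E} (hI : I ≠ 0)
    (hD : discrIdeal σ α I I ≤ 1) :
    (8 : ℤ) ∣ 2 * (Nat.card {τ : F →+* ℝ // ¬∃ τ' : E →+* ℝ, τ'.comp (algebraMap F E) = τ} : ℤ) -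
      4 * (Nat.card {τ : F →+* ℝ //
        (¬∃ τ' : E →+* ℝ, τ'.comp (algebraMap F E) = τ) ∧ τ α < 0} : ℤ) +
      4 * (Nat.card {w : HeightOneSpectrum (𝓞 E) //
        (∃ v : Ideal (𝓞 F), v.IsPrime ∧ v ≠ ⊥ ∧
          Ideal.map (algebraMap (𝓞 F) (𝓞 E)) v = w.asIdeal) ∧
        Odd (count E w (discrIdeal σ α I I))} : ℤ) := by
  obtain ⟨𝔡, h𝔡⟩ := le_one_iff_exists_coeIdeal.1 hD
  have h𝔡0 : 𝔡 ≠ ⊥ := by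
    rw [← coeIdeal_ne_zero (K := E), h𝔡]
    exact discrIdeal_ne_zero hα hI hI
  have hσ𝔡 : σ • 𝔡 = 𝔡 := by
    apply coeIdeal_injective (K := E)
    change ((σ • 𝔡 : Ideal (𝓞 E)) : FractionalIdeal (𝓞 E)⁰ E) = 𝔡
    rw [← galConj_coeIdeal, h𝔡, galConj_discrIdeal hσ hG]
  obtain ⟨J, S, hJ, hprod, hS, hodd⟩ := exists_eq_mul_smul_mul_prod hσ hG 𝔡 h𝔡0 hσ𝔡
  have hJf : (J : FractionalIdeal (𝓞 E)⁰ E) ≠ 0 := coeIdeal_ne_zero.2 hJ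
  have hσJ : ((σ • J : Ideal (𝓞 E)) : FractionalIdeal (𝓞 E)⁰ E) ≠ 0 := by
    rw [← galConj_coeIdeal]
    exact galConj_ne_zero hJf
  have hdvd := eight_dvd_of_discrIdeal_eq_prod hσ hG hunram hα
    (mul_ne_zero (inv_ne_zero hJf) hI) hS (by
      rw [discrIdeal_mul_mul, ← h𝔡, hprod, map_inv₀, galConj_coeIdeal, coeIdeal_mul, coeIdeal_mul,
        mul_comm (J : FractionalIdeal (𝓞 E)⁰ E)⁻¹, mul_assoc, mul_assoc (J : FractionalIdeal (𝓞 E)⁰ E),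
        inv_mul_cancel_left₀ hJf, inv_mul_cancel_left₀ hσJ])
  have hcard : Nat.card {w : HeightOneSpectrum (𝓞 E) //
      (∃ v : Ideal (𝓞 F), v.IsPrime ∧ v ≠ ⊥ ∧
        Ideal.map (algebraMap (𝓞 F) (𝓞 E)) v = w.asIdeal) ∧
      Odd (count E w (discrIdeal σ α I I))} = S.card := by
    rw [← h𝔡]
    refine Nat.subtype_card S fun w ↦ ?_
    rw [exists_map_eq_iff_gal_smul_eq hσ hG hunram]
    exact ⟨fun hw ↦ ⟨hS w hw, (hodd w (hS w hw)).2 hw⟩, fun hw ↦ (hodd w hw.1).1 hw.2⟩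
  rwa [hcard]

end SignatureCongruence

/-- Suppose no prime of `O_F` ramifies in `E`.  For an `O_E`-lattice
`(I, α)` with discriminant ideal `𝒟 = α·I·σ(I)·D_E`, let `s` be the number of real
embeddings of `F` extending to imaginary embeddings of `E`, `a` the number of such
embeddings `τ` with `τ(α) < 0`, and `m` the number of primes `v` of `O_F` inert in `E`
at whose prime above the valuation of `𝒟` is odd.  Then `2s − 4a ≡ 4m (mod 8)`. -/
theorem signature_congruence_of_unramified
    (E F : Type*) [Field E] [NumberField E] [Field F] [NumberField F] [Algebra F E]
    (σ : E ≃+* E)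
    (hσ2 : ∀ x, σ (σ x) = x)
    (hσne : σ ≠ RingEquiv.refl E)
    (hfix : ∀ x : E, σ x = x ↔ x ∈ (algebraMap F E).range)
    (hunram : ∀ v : Ideal (𝓞 F), v.IsPrime → v ≠ ⊥ →
      ¬∃ P : Ideal (𝓞 E), P.IsPrime ∧ Ideal.map (algebraMap (𝓞 F) (𝓞 E)) v = P ^ 2)
    (I : FractionalIdeal (𝓞 E)⁰ E) (hI : I ≠ 0)
    (Iσ : FractionalIdeal (𝓞 E)⁰ E)
    (hIσ : ∀ x : E, x ∈ Iσ ↔ ∃ y ∈ I, σ y = x)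
    (α : F) (hα : α ≠ 0)
    (hlat : ∀ x ∈ I, ∀ y ∈ I,
      ∃ n : ℤ, Algebra.trace ℚ E (algebraMap F E α * x * σ y) = (n : ℚ))
    (D : FractionalIdeal (𝓞 E)⁰ E)
    (hD : D = spanSingleton (𝓞 E)⁰ (algebraMap F E α) * I * Iσ
        * (differentIdeal ℤ (𝓞 E) : FractionalIdeal (𝓞 E)⁰ E))
    (s a m : ℕ)
    -- `s` : number of real embeddings of `F` extending to imaginary embeddings of `E`
    (hs : s = Nat.card {τ : F →+* ℝ // ¬∃ τ' : E →+* ℝ, τ'.comp (algebraMap F E) = τ})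
    -- `a` : number of those embeddings at which `α` is negative
    (ha : a = Nat.card {τ : F →+* ℝ //
      (¬∃ τ' : E →+* ℝ, τ'.comp (algebraMap F E) = τ) ∧ τ α < 0})
    -- `m` : number of primes of `O_F` inert in `E` with odd valuation of `𝒟` above them
    (hm : m = Nat.card {w : HeightOneSpectrum (𝓞 E) //
      (∃ v : Ideal (𝓞 F), v.IsPrime ∧ v ≠ ⊥ ∧
        Ideal.map (algebraMap (𝓞 F) (𝓞 E)) v = w.asIdeal) ∧
      Odd (FractionalIdeal.count E w D)}) :
    (2 * (s : ℤ) - 4 * (a : ℤ)) ≡ 4 * (m : ℤ) [ZMOD 8] := by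
  obtain ⟨τ, hτ, hGal, hτ1, hG⟩ := exists_gal_of_involution σ hσ2 hσne hfix
  have hIτ : Iσ = galConj τ I := by
    ext x
    rw [hIσ, mem_galConj]
    simp only [hτ]
  have hDτ : D = discrIdeal τ α I I := by rw [hD, hIτ, discrIdeal]
  have hDle : discrIdeal τ α I I ≤ 1 := by
    have hle : I ≤ (discrIdeal τ α I I)⁻¹ * I := fun x hx ↦
      (forall_twistedTrace_mem_iff hα hI x).1 fun y hy ↦ by
        obtain ⟨z, hz⟩ := hlat x hx y hy
        exact ⟨z, by rw [twistedTrace_apply, hτ, hz]⟩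
    have h0 := discrIdeal_ne_zero (σ := τ) hα hI hI
    calc discrIdeal τ α I I = discrIdeal τ α I I * I * I⁻¹ := by
          rw [mul_assoc, mul_inv_cancel₀ hI, mul_one]
      _ ≤ discrIdeal τ α I I * ((discrIdeal τ α I I)⁻¹ * I) * I⁻¹ := by gcongr
      _ = 1 := by rw [mul_inv_cancel_left₀ h0, mul_inv_cancel₀ hI]
  have hdvd := eight_dvd_of_discrIdeal_le_one hτ1 hG hunram hα hI hDle
  rw [← hDτ, ← hs, ← ha, ← hm] at hdvd
  exact (Int.modEq_iff_dvd.2 (by omega))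
end

section
/- Let E be a number field with a nontrivial field automorphism σ of order 2 with fixed field F, and suppose that no prime ideal of O_F lying above 2 ramifies in E. Then every O_E-lattice is even: for every nonzero fractional O_E-ideal I and α ∈ F^× with Tr_{E/ℚ}(α x σ(y)) ∈ ℤ for all x,y ∈ I, one has Tr_{E/ℚ}(α x σ(x)) ∈ 2ℤ for all x ∈ I. -/
set_option synthInstance.maxHeartbeats 1000000
set_option maxHeartbeats 1000000

open NumberField FractionalIdeal
open scoped nonZeroDivisors

theorem finrank_eq_two_of_fixed_iff_mem_range
    {E F : Type*} [Field E] [Field F] [Algebra F E] [FiniteDimensional F E]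
    (σ : E ≃+* E) (hσ2 : ∀ x, σ (σ x) = x) (hσne : σ ≠ RingEquiv.refl E)
    (hfix : ∀ x : E, σ x = x ↔ x ∈ (algebraMap F E).range) :
    Module.finrank F E = 2 := by
  let s : E ≃ₐ[F] E := AlgEquiv.ofRingEquiv (f := σ) fun r ↦ (hfix _).2 ⟨r, rfl⟩
  have hs : ∀ x, s x = σ x := fun _ ↦ rfl
  have hord : orderOf s = 2 := by
    refine orderOf_eq_prime (by ext x; simp [pow_two, hs, hσ2]) fun h ↦ hσne ?_
    ext x
    simpa [hs] using DFunLike.congr_fun h x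
  have hbot : IntermediateField.fixedField (Subgroup.zpowers s) = ⊥ := by
    refine le_antisymm (fun x hx ↦ ?_) bot_le
    exact IntermediateField.mem_bot.2 ((hfix x).1 (hx ⟨s, Subgroup.mem_zpowers s⟩))
  rw [← IntermediateField.finrank_bot', ← hbot, IntermediateField.finrank_fixedField_eq_card,
    Nat.card_zpowers, hord]

theorem Ideal.exists_eq_pow_of_forall_isPrime_eq {S : Type*} [CommRing S] [IsDedekindDomain S]
    {I P : Ideal S} (hI : I ≠ ⊥) (h : ∀ Q : Ideal S, Q.IsPrime → I ≤ Q → Q = P) :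
    ∃ k, I = P ^ k := by
  classical
  refine ⟨(UniqueFactorizationMonoid.normalizedFactors I).card, ?_⟩
  have hr := Multiset.eq_replicate_of_mem (a := P)
    (s := UniqueFactorizationMonoid.normalizedFactors I) fun Q hQ ↦
    h Q (Ideal.isPrime_of_prime (UniqueFactorizationMonoid.prime_of_normalized_factor Q hQ))
      (Ideal.le_of_dvd (UniqueFactorizationMonoid.dvd_of_mem_normalizedFactors hQ))
  conv_lhs => rw [← Ideal.prod_normalizedFactors_eq_self hI, hr, Multiset.prod_replicate]

theorem exists_isPrime_map_eq_sq_of_forall_exists_sub_sq_mem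
    {E F : Type*} [Field E] [NumberField E] [Field F] [NumberField F] [Algebra F E]
    (hrank : Module.finrank F E = 2) {v : Ideal (𝓞 F)} [hv : v.IsMaximal] (hv0 : v ≠ ⊥)
    (h : ∀ x : 𝓞 E, ∃ b : 𝓞 F,
      (x - algebraMap (𝓞 F) (𝓞 E) b) ^ 2 ∈ v.map (algebraMap (𝓞 F) (𝓞 E))) :
    ∃ P : Ideal (𝓞 E), P.IsPrime ∧ v.map (algebraMap (𝓞 F) (𝓞 E)) = P ^ 2 := by
  set f := algebraMap (𝓞 F) (𝓞 E)
  have hover : ∀ Q : Ideal (𝓞 E), Q.IsPrime → v.map f ≤ Q → Q.comap f = v := fun Q hQ hle ↦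
    (hv.eq_of_le (Ideal.IsPrime.comap f).ne_top (Ideal.map_le_iff_le_comap.1 hle)).symm
  have hnorm : Ideal.absNorm (v.map f) = Ideal.absNorm v ^ 2 := by
    rw [Ideal.absNorm_algebraMap, ← IsFractionRing.finrank_eq (𝓞 F) F (𝓞 E) E, hrank]
  have hv1 : 1 < Ideal.absNorm v := by
    have h0 : Ideal.absNorm v ≠ 0 := by rwa [Ne, Ideal.absNorm_eq_zero_iff]
    have h1 : Ideal.absNorm v ≠ 1 := by rw [Ne, Ideal.absNorm_eq_one_iff]; exact hv.ne_top
    omega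
  have hmap : v.map f ≠ ⊤ := fun ht ↦ by
    rw [ht, Ideal.absNorm_top] at hnorm
    nlinarith
  have hmap0 : v.map f ≠ ⊥ := fun ht ↦ by
    rw [ht, Ideal.absNorm_bot] at hnorm
    nlinarith
  obtain ⟨P, hPmax, hP⟩ := Ideal.exists_le_maximal _ hmap
  have hPp := hPmax.isPrime
  have hunique : ∀ Q : Ideal (𝓞 E), Q.IsPrime → v.map f ≤ Q → Q = P := by
    intro Q hQ hle
    refine (hPmax.eq_of_le hQ.ne_top fun x hx ↦ ?_).symm
    obtain ⟨b, hb⟩ := h x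
    have hbP : f b ∈ P := by
      simpa using P.sub_mem hx (hPp.mem_of_pow_mem 2 (hP hb))
    have hbv : b ∈ v := hover P hPp hP ▸ hbP
    simpa using Q.add_mem (hQ.mem_of_pow_mem 2 (hle hb)) (hle (Ideal.mem_map_of_mem f hbv))
  obtain ⟨k, hk⟩ := Ideal.exists_eq_pow_of_forall_isPrime_eq hmap0 hunique
  have hcard : Ideal.absNorm v = Ideal.absNorm P := by
    rw [Ideal.absNorm_apply, Ideal.absNorm_apply, Submodule.cardQuot_apply,
      Submodule.cardQuot_apply]
    refine Nat.card_eq_of_bijective (Ideal.quotientMap P f (hover P hPp hP).ge)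
      ⟨Ideal.quotientMap_injective' (hover P hPp hP).le, fun y ↦ ?_⟩
    obtain ⟨x, rfl⟩ := Ideal.Quotient.mk_surjective y
    obtain ⟨b, hb⟩ := h x
    refine ⟨Ideal.Quotient.mk v b, ?_⟩
    rw [Ideal.quotientMap_mk, eq_comm, Ideal.Quotient.eq]
    exact hPp.mem_of_pow_mem 2 (hP hb)
  refine ⟨P, hPp, ?_⟩
  have : k = 2 := by
    rw [hk, map_pow, ← hcard] at hnorm
    exact Nat.pow_right_injective hv1 hnorm
  rw [hk, this]

theorem exists_sub_sq_mem_map_of_forall_add_mem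
    {R S : Type*} [CommRing R] [CommRing S] [Algebra R S] (τ : S ≃+* S)
    (hnorm : ∀ x : S, ∃ a : R, algebraMap R S a = x * τ x)
    {v : Ideal R} [hv : v.IsMaximal] [Finite (R ⧸ v)] (h2 : (2 : R) ∈ v)
    (h : ∀ x : S, x + τ x ∈ v.map (algebraMap R S)) (x : S) :
    ∃ b : R, (x - algebraMap R S b) ^ 2 ∈ v.map (algebraMap R S) := by
  let : Field (R ⧸ v) := Ideal.Quotient.field v
  obtain ⟨a, ha⟩ := hnorm x
  have hchar : ringChar (R ⧸ v) = 2 :=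
    ringChar.eq_iff.2 <| CharTwo.of_one_ne_zero_of_two_eq_zero one_ne_zero <| by
      rw [← map_ofNat (Ideal.Quotient.mk v) 2]
      exact Ideal.Quotient.eq_zero_iff_mem.2 h2
  obtain ⟨c, hc⟩ := FiniteField.isSquare_of_char_two hchar (Ideal.Quotient.mk v a)
  obtain ⟨b, rfl⟩ := Ideal.Quotient.mk_surjective c
  rw [← map_mul, Ideal.Quotient.eq] at hc
  refine ⟨b, ?_⟩
  have e : (x - algebraMap R S b) ^ 2 = x * (x + τ x) - algebraMap R S (a - b * b)
      - x * algebraMap R S b * algebraMap R S 2 := by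
    simp only [map_sub, map_mul, map_ofNat, ha]
    ring
  rw [e]
  exact sub_mem (sub_mem (Ideal.mul_mem_left _ _ (h x)) (Ideal.mem_map_of_mem _ hc))
    (Ideal.mul_mem_left _ _ (Ideal.mem_map_of_mem _ h2))

theorem exists_add_add_two_mul_eq_one
    {E F : Type*} [Field E] [NumberField E] [Field F] [NumberField F] [Algebra F E]
    (hrank : Module.finrank F E = 2) (τ : 𝓞 E ≃+* 𝓞 E) (hτ2 : ∀ x, τ (τ x) = x)
    (hfix : ∀ x : 𝓞 E, τ x = x ↔ x ∈ (algebraMap (𝓞 F) (𝓞 E)).range)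
    (hdyadic : ∀ v : Ideal (𝓞 F), v.IsPrime → (2 : 𝓞 F) ∈ v →
      ¬∃ P : Ideal (𝓞 E), P.IsPrime ∧ Ideal.map (algebraMap (𝓞 F) (𝓞 E)) v = P ^ 2) :
    ∃ x y : 𝓞 E, x + τ x + 2 * y = 1 := by
  let J : Ideal (𝓞 F) :=
    { carrier := {a | ∃ x y : 𝓞 E, x + τ x + 2 * y = algebraMap (𝓞 F) (𝓞 E) a}
      zero_mem' := ⟨0, 0, by simp⟩
      add_mem' := by
        rintro a b ⟨x, y, h⟩ ⟨x', y', h'⟩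
        refine ⟨x + x', y + y', ?_⟩
        rw [map_add, map_add, ← h, ← h']
        ring
      smul_mem' := by
        rintro c a ⟨x, y, h⟩
        refine ⟨algebraMap _ _ c * x, algebraMap _ _ c * y, ?_⟩
        rw [map_mul, (hfix _).2 ⟨c, rfl⟩, smul_eq_mul, map_mul, ← h]
        ring }
  by_cases hJ : J = ⊤
  · obtain ⟨x, y, h⟩ : (1 : 𝓞 F) ∈ J := hJ ▸ Submodule.mem_top
    exact ⟨x, y, by rw [h, map_one]⟩
  obtain ⟨v, hv, hJv⟩ := Ideal.exists_le_maximal J hJ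
  have h2 : (2 : 𝓞 F) ∈ v := hJv ⟨0, 1, by rw [map_ofNat]; simp⟩
  have hv0 : v ≠ ⊥ := by
    rintro rfl
    exact two_ne_zero ((Submodule.mem_bot _).1 h2)
  have := Ideal.finiteQuotientOfFreeOfNeBot v hv0
  refine absurd (exists_isPrime_map_eq_sq_of_forall_exists_sub_sq_mem hrank hv0
    (exists_sub_sq_mem_map_of_forall_add_mem τ (fun x ↦ (hfix _).1 ?_) h2 fun x ↦ ?_))
    (hdyadic v hv.isPrime h2)
  · rw [map_mul, hτ2, mul_comm]
  · obtain ⟨a, ha⟩ := (hfix (x + τ x)).1 (by rw [map_add, hτ2, add_comm])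
    rw [← ha]
    exact Ideal.mem_map_of_mem _ (hJv ⟨x, 0, by rw [ha]; simp⟩)

theorem NumberField.RingOfIntegers.mapRingEquiv_eq_self_iff_mem_range
    {E F : Type*} [Field E] [Field F] [Algebra F E] {σ : E ≃+* E}
    (hfix : ∀ x : E, σ x = x ↔ x ∈ (algebraMap F E).range) (x : 𝓞 E) :
    RingOfIntegers.mapRingEquiv σ x = x ↔ x ∈ (algebraMap (𝓞 F) (𝓞 E)).range := by
  rw [RingOfIntegers.ext_iff, RingOfIntegers.mapRingEquiv_apply, hfix]
  refine ⟨fun ⟨a, ha⟩ ↦ ?_, fun ⟨a, ha⟩ ↦ ⟨a, ha ▸ rfl⟩⟩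
  have hint : IsIntegral ℤ a := by
    rw [← isIntegral_algebraMap_iff (algebraMap F E).injective, ha]
    exact x.isIntegral_coe
  exact ⟨⟨a, hint⟩, RingOfIntegers.ext ha⟩

/-- If no prime of `O_F` above `2` ramifies in `E`, then every
`O_E`-lattice is even. -/
theorem lattice_even_of_dyadic_unramified
    (E F : Type*) [Field E] [NumberField E] [Field F] [NumberField F] [Algebra F E]
    (σ : E ≃+* E)
    (hσ2 : ∀ x, σ (σ x) = x)
    (hσne : σ ≠ RingEquiv.refl E)
    (hfix : ∀ x : E, σ x = x ↔ x ∈ (algebraMap F E).range)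
    (hdyadic : ∀ v : Ideal (𝓞 F), v.IsPrime → (2 : 𝓞 F) ∈ v →
      ¬∃ P : Ideal (𝓞 E), P.IsPrime ∧ Ideal.map (algebraMap (𝓞 F) (𝓞 E)) v = P ^ 2) :
    ∀ (I : FractionalIdeal (𝓞 E)⁰ E), I ≠ 0 →
    ∀ α : F, α ≠ 0 →
    (∀ x ∈ I, ∀ y ∈ I,
      ∃ n : ℤ, Algebra.trace ℚ E (algebraMap F E α * x * σ y) = (n : ℚ)) →
    ∀ x ∈ I, ∃ n : ℤ, Algebra.trace ℚ E (algebraMap F E α * x * σ x) = 2 * (n : ℚ) := by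
  intro I _ α _ hint x hx
  obtain ⟨l, m, hlm'⟩ := exists_add_add_two_mul_eq_one
    (finrank_eq_two_of_fixed_iff_mem_range σ hσ2 hσne hfix) (RingOfIntegers.mapRingEquiv σ)
    (fun y ↦ RingOfIntegers.ext (hσ2 y))
    (RingOfIntegers.mapRingEquiv_eq_self_iff_mem_range hfix) hdyadic
  have hlm : (l : E) + σ l + 2 * m = 1 := by
    have := congrArg (algebraMap (𝓞 E) E) hlm'
    rwa [map_add, map_add, map_mul, map_ofNat, map_one] at this
  have hmem : ∀ c : 𝓞 E, (c : E) * x ∈ I := fun c ↦ by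
    simpa [Algebra.smul_def] using Submodule.smul_mem (I : Submodule (𝓞 E) E) c hx
  obtain ⟨n₁, h₁⟩ := hint _ (hmem l) x hx
  obtain ⟨n₂, h₂⟩ := hint _ (hmem m) x hx
  refine ⟨n₁ + n₂, ?_⟩
  have hσ : Algebra.trace ℚ E (σ (algebraMap F E α * (l * x) * σ x)) =
      Algebra.trace ℚ E (algebraMap F E α * (l * x) * σ x) :=
    Algebra.trace_eq_of_algEquiv (AlgEquiv.ofRingEquiv (f := σ) fun r ↦ by simp) _
  have hα : σ (algebraMap F E α) = algebraMap F E α := (hfix _).2 ⟨α, rfl⟩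
  have e : algebraMap F E α * x * σ x = algebraMap F E α * (l * x) * σ x
      + σ (algebraMap F E α * (l * x) * σ x)
      + (2 : ℚ) • (algebraMap F E α * (m * x) * σ x) := by
    simp only [map_mul, hα, hσ2, Algebra.smul_def, map_ofNat]
    linear_combination (-(algebraMap F E α * x * σ x)) * hlm
  rw [e, map_add, map_add, map_smul, hσ, h₁, h₂, smul_eq_mul]
  push_cast
  ring
end

section
/- Let E be a number field with a nontrivial field automorphism σ of order 2 with fixed field F, let I be a nonzero fractional O_E-ideal and α ∈ F^× with Tr_{E/ℚ}(α x σ(y)) ∈ ℤ for all x,y ∈ I. Suppose that for every prime P of O_E lying above 2 the P-adic valuation of the fractional ideal α·I·σ(I) is ≥ 0. Then the lattice (I,α) is even: Tr_{E/ℚ}(α x σ(x)) ∈ 2ℤ for all x ∈ I. -/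
set_option synthInstance.maxHeartbeats 1000000
set_option maxHeartbeats 1000000

open NumberField FractionalIdeal IsDedekindDomain
open scoped nonZeroDivisors

/-- The `v`-adic valuation of `x` is `exp (-n)`, with `n` the exponent of `v` in `(x)`. -/
theorem HeightOneSpectrum.valuation_eq_exp_neg_count {R K : Type*} [CommRing R] [IsDedekindDomain R]
    [Field K] [Algebra R K] [IsFractionRing R K] (v : HeightOneSpectrum R) {x : K} (hx : x ≠ 0) :
    v.valuation K x = WithZero.exp (-FractionalIdeal.count K v (spanSingleton R⁰ x)) := by
  classical
  obtain ⟨a, b, hb, rfl⟩ := IsFractionRing.div_surjective (A := R) x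
  have hb0 : b ≠ 0 := nonZeroDivisors.ne_zero hb
  have ha0 : a ≠ 0 := by
    rintro rfl
    simp at hx
  rw [FractionalIdeal.count_well_defined K v (a := b) (J := Ideal.span {a})
    (spanSingleton_ne_zero_iff.mpr hx) (by
      rw [coeIdeal_span_singleton, spanSingleton_mul_spanSingleton, div_eq_inv_mul]),
    map_div₀, v.valuation_of_algebraMap, v.valuation_of_algebraMap, v.intValuation_if_neg ha0,
    v.intValuation_if_neg hb0, ← WithZero.exp_sub]
  congr 1
  ring

/-- An element integral at every prime above a prime number `p` has an algebraic integer
multiple by an integer prime to `p`. -/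
theorem exists_int_not_dvd_mul_isIntegral {E : Type*} [Field E] [NumberField E] {p : ℤ}
    (hp : Prime p) {t : E}
    (ht : ∀ P : HeightOneSpectrum (𝓞 E), (p : 𝓞 E) ∈ P.asIdeal → P.valuation E t ≤ 1) :
    ∃ m : ℤ, ¬ p ∣ m ∧ IsIntegral ℤ ((m : E) * t) := by
  let D : Ideal (𝓞 E) :=
    { carrier := {d | IsIntegral ℤ ((d : E) * t)}
      add_mem' := fun {a b} ha hb => by
        simpa [add_mul] using IsIntegral.add ha hb
      zero_mem' := by simp [isIntegral_zero]
      smul_mem' := fun c d hd => by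
        simpa [mul_assoc] using IsIntegral.mul c.isIntegral_coe hd }
  by_contra! h
  have hle : D.comap (algebraMap ℤ (𝓞 E)) ≤ Ideal.span {p} := fun m hm => by
    rw [Ideal.mem_span_singleton]
    by_contra hpm
    exact h m hpm (by simpa [D] using hm)
  have : (Ideal.span {p}).IsPrime := (Ideal.span_singleton_prime hp.ne_zero).mpr hp
  obtain ⟨Q, hDQ, hQ, hQp⟩ := Ideal.exists_ideal_over_prime_of_isIntegral _ D hle
  have hpQ : (p : 𝓞 E) ∈ Q := by
    have : p ∈ Q.comap (algebraMap ℤ (𝓞 E)) := hQp ▸ Ideal.mem_span_singleton_self p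
    simpa using this
  have hQ0 : Q ≠ ⊥ := by
    rintro rfl
    exact hp.ne_zero (by simpa using hpQ)
  let P : HeightOneSpectrum (𝓞 E) := ⟨Q, hQ, hQ0⟩
  obtain ⟨n, d, hd⟩ := P.exists_primeCompl_mul_eq_of_integer t (ht P hpQ)
  refine d.2 (hDQ ?_)
  change IsIntegral ℤ (((d : 𝓞 E) : E) * t)
  rw [mul_comm]
  exact hd ▸ n.isIntegral_coe

/-- A rational number whose multiples by two coprime integers are integers is an integer. -/
theorem exists_int_eq_of_isCoprime_mul {q : ℚ} {a b : ℤ} (hab : IsCoprime a b)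
    (ha : ∃ n : ℤ, a * q = n) (hb : ∃ n : ℤ, b * q = n) : ∃ n : ℤ, q = n := by
  obtain ⟨u, v, huv⟩ := hab
  obtain ⟨k, hk⟩ := ha
  obtain ⟨l, hl⟩ := hb
  refine ⟨u * k + v * l, ?_⟩
  have huv' : (u * a + v * b : ℚ) = 1 := by exact_mod_cast huv
  push_cast
  rw [← hk, ← hl]
  linear_combination -q * huv'

/-- A finite extension with an automorphism of order two has even degree. -/
theorem two_dvd_finrank_of_orderOf_eq_two {F E : Type*} [Field F] [Field E] [Algebra F E]
    [FiniteDimensional F E] {τ : E ≃ₐ[F] E} (hτ : orderOf τ = 2) :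
    2 ∣ Module.finrank F E := by
  rw [← hτ, ← Nat.card_zpowers,
    ← IntermediateField.finrank_fixedField_eq_card (Subgroup.zpowers τ)]
  exact Dvd.intro_left _
    (Module.finrank_mul_finrank F (IntermediateField.fixedField (Subgroup.zpowers τ)) E)

/-- Let `(I, α)` be an `O_E`-lattice.  If for every prime `P` of `O_E`
above `2` the `P`-adic valuation of the fractional ideal `α·I·σ(I)` is nonnegative, then
the lattice `(I, α)` is even. -/
theorem lattice_even_of_dyadic_valuation_nonneg
    (E F : Type*) [Field E] [NumberField E] [Field F] [NumberField F] [Algebra F E]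
    (σ : E ≃+* E)
    (hσ2 : ∀ x, σ (σ x) = x)
    (hσne : σ ≠ RingEquiv.refl E)
    (hfix : ∀ x : E, σ x = x ↔ x ∈ (algebraMap F E).range)
    (I : FractionalIdeal (𝓞 E)⁰ E) (hI : I ≠ 0)
    (Iσ : FractionalIdeal (𝓞 E)⁰ E)
    (hIσ : ∀ x : E, x ∈ Iσ ↔ ∃ y ∈ I, σ y = x)
    (α : F) (hα : α ≠ 0)
    (hlat : ∀ x ∈ I, ∀ y ∈ I,
      ∃ n : ℤ, Algebra.trace ℚ E (algebraMap F E α * x * σ y) = (n : ℚ))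
    (hdyadic : ∀ P : HeightOneSpectrum (𝓞 E), (2 : 𝓞 E) ∈ P.asIdeal →
      0 ≤ FractionalIdeal.count E P (spanSingleton (𝓞 E)⁰ (algebraMap F E α) * I * Iσ)) :
    ∀ x ∈ I, ∃ n : ℤ, Algebra.trace ℚ E (algebraMap F E α * x * σ x) = 2 * (n : ℚ) := by
  intro x hx
  let τ : E ≃ₐ[F] E := AlgEquiv.ofRingEquiv (f := σ) fun r => (hfix _).mpr ⟨r, rfl⟩
  have hτ : orderOf τ = 2 := orderOf_eq_prime (AlgEquiv.ext fun y => by simp [τ, pow_two, hσ2])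
    fun h => hσne (RingEquiv.ext fun y => DFunLike.congr_fun h y)
  obtain ⟨k, hk⟩ := two_dvd_finrank_of_orderOf_eq_two hτ
  set t := algebraMap F E α * x * σ x with ht_def
  obtain ⟨s, hs⟩ : t ∈ (algebraMap F E).range := by
    rw [← hfix, ht_def, map_mul, map_mul, hσ2, (hfix _).mpr ⟨α, rfl⟩]
    ring
  have htr : Algebra.trace ℚ E t = 2 * (k * Algebra.trace ℚ F s) := by
    rw [← Algebra.trace_trace (S := F), ← hs, Algebra.trace_algebraMap, hk, map_nsmul,
      nsmul_eq_mul]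
    push_cast
    ring
  have htJ : t ∈ spanSingleton (𝓞 E)⁰ (algebraMap F E α) * I * Iσ :=
    FractionalIdeal.mul_mem_mul
      (FractionalIdeal.mul_mem_mul (mem_spanSingleton_self _ _) hx) ((hIσ _).mpr ⟨x, hx, rfl⟩)
  have hval : ∀ P : HeightOneSpectrum (𝓞 E), ((2 : ℤ) : 𝓞 E) ∈ P.asIdeal →
      P.valuation E t ≤ 1 := by
    intro P hP
    by_cases ht0 : t = 0
    · simp [ht0]
    rw [HeightOneSpectrum.valuation_eq_exp_neg_count P ht0, ← WithZero.exp_zero,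
      WithZero.exp_le_exp, neg_nonpos]
    exact (hdyadic P (by simpa using hP)).trans (FractionalIdeal.count_mono E P
      (spanSingleton_ne_zero_iff.mpr ht0) (spanSingleton_le_iff_mem.mpr htJ))
  obtain ⟨m, hm, hmt⟩ := exists_int_not_dvd_mul_isIntegral Int.prime_two hval
  have hms : IsIntegral ℤ ((m : F) * s) := by
    rw [← isIntegral_algebraMap_iff (algebraMap F E).injective, map_mul, hs, map_intCast]
    exact hmt
  obtain ⟨n, hn⟩ := IsIntegrallyClosed.isIntegral_iff.mp
    (Algebra.isIntegral_trace (L := ℚ) hms)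
  have hmtr : (m : ℚ) * Algebra.trace ℚ F s = n := by
    rw [← smul_eq_mul, ← map_smul, Algebra.smul_def, map_intCast, ← hn]
    rfl
  obtain ⟨l, hl⟩ := hlat x hx x hx
  obtain ⟨r, hr⟩ := exists_int_eq_of_isCoprime_mul (q := k * Algebra.trace ℚ F s)
    ((Prime.coprime_iff_not_dvd Int.prime_two).mpr hm)
    ⟨l, by rw [← hl, htr]; norm_num⟩ ⟨k * n, by push_cast; rw [← hmtr]; ring⟩
  exact ⟨r, by rw [htr, hr]⟩
end
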